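/- arXiv:2012.15509 — 3 statements merged into one kernel-verified Lean document; each statement's English description precedes it below -/
import Mathlib

section
/- Let m ≥ 1, let K = ℚ(ζ_m) be the m-th cyclotomic field with ring of integers 𝒪 = ℤ[ζ_m], let 𝔭 ⊂ 𝒪 be a nonzero prime ideal with 𝔭 ∩ ℤ = pℤ for an odd prime p with p ∤ m, and let G be a finite abelian group with n = exp(G) and p ∤ n. Let n₁ be the largest divisor of n with gcd(m, n₁) = 1 and let n' = lcm(m,n)/(m·n₁). Then the following are equivalent: (i) the group ring 𝒪_𝔭[G] is clean; (ii) the ring 𝒪_𝔭[x]/(Φ_n(x)) is clean; (iii) n'·φ(n₁)·ord_m(p) = lcm(ord_{n'm}(p), ord_{n₁}(p)). -/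
open NumberField

/-- A ring is *clean* if every element is the sum of a unit and an idempotent. -/
def IsCleanRing (R : Type*) [Ring R] : Prop :=
  ∀ r : R, ∃ u e : R, IsUnit u ∧ IsIdempotentElem e ∧ r = u + e


lemma IsCleanRing.of_surjective {R S : Type*} [Ring R] [Ring S] (h : IsCleanRing R)
    (f : R →+* S) (hf : Function.Surjective f) : IsCleanRing S := by
  intro s
  obtain ⟨r, rfl⟩ := hf s
  obtain ⟨u, e, hu, he, rfl⟩ := h r
  exact ⟨f u, f e, hu.map f, he.map f, map_add _ _ _⟩

lemma IsCleanRing.isLocalRing {R : Type*} [CommRing R] [IsDomain R] (h : IsCleanRing R) :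
    IsLocalRing R := by
  refine IsLocalRing.of_isUnit_or_isUnit_one_sub_self fun a => ?_
  obtain ⟨u, e, hu, he, rfl⟩ := h a
  rcases IsIdempotentElem.iff_eq_zero_or_one.mp he with rfl | rfl
  · left; simpa using hu
  · right
    have : 1 - (u + 1) = -u := by ring
    rw [this]; exact hu.neg

section Fourier
variable {R B G : Type*} [CommRing R] [CommRing B] [IsDomain B] [Algebra R B]
  [CommGroup G] [Fintype G]

/-- Evaluation of a character on the group ring. -/
noncomputable def charEval (R : Type*) {B G : Type*} [CommRing R] [CommRing B] [Algebra R B]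
    [CommGroup G] (χ : G →* Bˣ) : MonoidAlgebra R G →ₐ[R] B :=
  MonoidAlgebra.lift R B G ((Units.coeHom B).comp χ)

lemma charEval_apply (χ : G →* Bˣ) (x : MonoidAlgebra R G) :
    charEval R χ x = ∑ g, algebraMap R B (x.coeff g) * (χ g : B) := by
  classical
  rw [charEval, MonoidAlgebra.lift_apply, Finsupp.sum_fintype]
  · simp [Algebra.smul_def]
  · simp

/-- A ring automorphism acts on characters. -/
def charConj (σ : B ≃ₐ[R] B) (χ : G →* Bˣ) : G →* Bˣ := (Units.map (σ : B →* B)).comp χ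

lemma charConj_apply (σ : B ≃ₐ[R] B) (χ : G →* Bˣ) (g : G) :
    ((charConj σ χ g : Bˣ) : B) = σ (χ g) := rfl

lemma charEval_conj (σ : B ≃ₐ[R] B) (χ : G →* Bˣ) (x : MonoidAlgebra R G) :
    charEval R (charConj σ χ) x = σ (charEval R χ x) := by
  simp [charEval_apply, charConj_apply]

/-- A ring automorphism permutes the characters. -/
def charConjEquiv (σ : B ≃ₐ[R] B) : (G →* Bˣ) ≃ (G →* Bˣ) where
  toFun := charConj σ
  invFun := charConj σ.symm
  left_inv χ := by ext g; simp [charConj_apply]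
  right_inv χ := by ext g; simp [charConj_apply]

variable [HasEnoughRootsOfUnity B (Monoid.exponent G)]

lemma sum_char_dual [Fintype (G →* Bˣ)] [DecidableEq G] (g : G) :
    ∑ χ : G →* Bˣ, (χ g : B) = if g = 1 then (Fintype.card G : B) else 0 := by
  classical
  have h := sum_hom_units (G := (G →* Bˣ)) (R := B)
    ((Units.coeHom B).comp (MonoidHom.eval g))
  have hc : Fintype.card (G →* Bˣ) = Fintype.card G := by
    simpa [Nat.card_eq_fintype_card] using CommGroup.card_monoidHom_of_hasEnoughRootsOfUnity G B
  rw [hc] at h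
  have hiff : ((Units.coeHom B).comp (MonoidHom.eval g) : (G →* Bˣ) →* B) = 1 ↔ g = 1 := by
    constructor
    · intro h
      by_contra hg
      obtain ⟨φ, hφ⟩ := CommGroup.exists_apply_ne_one_of_hasEnoughRootsOfUnity G B hg
      apply hφ
      have := DFunLike.congr_fun h φ
      exact Units.ext (by simpa using this)
    · rintro rfl
      ext φ
      simp
  simp only [hiff] at h
  simpa using h

lemma sum_char_mul_inv [DecidableEq (G →* Bˣ)] (χ ψ : G →* Bˣ) :
    ∑ g, ((χ g : B) * (ψ g⁻¹ : Bˣ)) = if χ = ψ then (Fintype.card G : B) else 0 := by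
  classical
  have h := sum_hom_units (G := G) (R := B) ((Units.coeHom B).comp (χ / ψ))
  have hiff : ((Units.coeHom B).comp (χ / ψ) : G →* B) = 1 ↔ χ = ψ := by
    rw [← div_eq_one (a := χ)]
    constructor
    · intro h
      ext g
      simpa using DFunLike.congr_fun h g
    · intro h
      rw [h]; ext; simp
  simp only [hiff] at h
  rw [← Nat.cast_zero, ← apply_ite (Nat.cast : ℕ → B), ← h]
  simp [div_eq_mul_inv]

lemma char_jointly_injective (hinj : Function.Injective (algebraMap R B))
    (hcard : IsUnit (Fintype.card G : R)) {x y : MonoidAlgebra R G}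
    (h : ∀ χ : G →* Bˣ, charEval R χ x = charEval R χ y) : x = y := by
  classical
  have := Fintype.ofFinite (G →* Bˣ)
  have key : ∀ z : MonoidAlgebra R G, ∀ g : G,
      ∑ χ : G →* Bˣ, charEval R χ z * (χ g⁻¹ : Bˣ) =
        algebraMap R B (z.coeff g * (Fintype.card G : R)) := by
    intro z g
    simp only [charEval_apply, Finset.sum_mul]
    rw [Finset.sum_comm]
    have : ∀ k : G, ∑ χ : G →* Bˣ, algebraMap R B (z.coeff k) * (χ k : B) * (χ g⁻¹ : Bˣ) =
        if k = g then algebraMap R B (z.coeff k) * (Fintype.card G : B) else 0 := by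
      intro k
      have := sum_char_dual (B := B) (k * g⁻¹)
      simp only [mul_inv_eq_one] at this
      simp only [mul_assoc, ← Finset.mul_sum]
      rw [← mul_ite_zero, ← this]
      simp
    rw [Finset.sum_congr rfl fun k _ => this k]
    simp
  ext g
  have h1 : algebraMap R B (x.coeff g * (Fintype.card G : R)) =
      algebraMap R B (y.coeff g * (Fintype.card G : R)) := by
    rw [← key, ← key]; simp [h]
  exact hcard.mul_left_injective (hinj h1)

lemma exists_of_equivariant
    (hcard : IsUnit (Fintype.card G : R))
    (hinv : ∀ b : B, (∀ σ : B ≃ₐ[R] B, σ b = b) → b ∈ Set.range (algebraMap R B))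
    (a : (G →* Bˣ) → B) (ha : ∀ (σ : B ≃ₐ[R] B) χ, a (charConj σ χ) = σ (a χ)) :
    ∃ x : MonoidAlgebra R G, ∀ χ, charEval R χ x = a χ := by
  classical
  have := Fintype.ofFinite (G →* Bˣ)
  obtain ⟨c, hc⟩ := hcard.exists_right_inv
  have hc' : (Fintype.card G : B) * algebraMap R B c = 1 := by
    rw [← map_one (algebraMap R B), ← hc]; simp
  have h1 : ∀ g : G, ∃ r : R, algebraMap R B r = ∑ ψ : G →* Bˣ, a ψ * (ψ g⁻¹ : Bˣ) := by
    intro g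
    apply hinv
    intro σ
    rw [map_sum]
    refine Fintype.sum_equiv (charConjEquiv σ) _ _ fun ψ => ?_
    show _ = a (charConj σ ψ) * ((charConj σ ψ g⁻¹ : Bˣ) : B)
    rw [ha, charConj_apply, map_mul]
  choose r hr using h1
  refine ⟨∑ g, MonoidAlgebra.single g (c * r g), fun χ => ?_⟩
  have h2 : charEval R χ (∑ g, MonoidAlgebra.single g (c * r g)) =
      algebraMap R B c * ∑ g, (∑ ψ : G →* Bˣ, a ψ * (ψ g⁻¹ : Bˣ)) * (χ g : B) := by
    rw [map_sum, Finset.mul_sum]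
    refine Finset.sum_congr rfl fun g _ => ?_
    rw [charEval, MonoidAlgebra.lift_single, ← hr, Algebra.smul_def, map_mul, mul_assoc]
    rfl
  rw [h2]
  simp only [Finset.sum_mul]
  rw [Finset.sum_comm]
  have h3 : ∀ ψ : G →* Bˣ, ∑ g, a ψ * (ψ g⁻¹ : Bˣ) * (χ g : B) =
      if χ = ψ then a ψ * (Fintype.card G : B) else 0 := by
    intro ψ
    rw [← mul_ite_zero, ← sum_char_mul_inv, Finset.mul_sum]
    exact Finset.sum_congr rfl fun g _ => by ring
  simp only [h3, Finset.sum_ite_eq, Finset.mem_univ, if_true]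
  rw [mul_left_comm, mul_comm (algebraMap R B c), hc', mul_one]

theorem isCleanRing_monoidAlgebra [IsLocalRing B] (hinj : Function.Injective (algebraMap R B))
    (hcard : IsUnit (Fintype.card G : R))
    (hinv : ∀ b : B, (∀ σ : B ≃ₐ[R] B, σ b = b) → b ∈ Set.range (algebraMap R B)) :
    IsCleanRing (MonoidAlgebra R G) := by
  classical
  intro r
  obtain ⟨e, he⟩ := exists_of_equivariant (G := G) hcard hinv
    (fun χ => if IsUnit (charEval R χ r) then 0 else 1) (by
      intro σ χ
      have : IsUnit (σ (charEval R χ r)) ↔ IsUnit (charEval R χ r) := isUnit_map_iff σ _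
      simp only [charEval_conj, this]
      split_ifs <;> simp)
  have hu : ∀ χ : G →* Bˣ, IsUnit (charEval R χ (r - e)) := by
    intro χ
    rw [map_sub, he]
    split_ifs with h
    · simpa using h
    · rcases IsLocalRing.isUnit_or_isUnit_one_sub_self (charEval R χ r) with h' | h'
      · exact absurd h' h
      · simpa using h'.neg
  obtain ⟨v, hv⟩ := exists_of_equivariant (G := G) hcard hinv
    (fun χ => Ring.inverse (charEval R χ (r - e))) (by
      intro σ χ
      simp only [charEval_conj]
      obtain ⟨w, hw⟩ := hu χ
      rw [← hw, Ring.inverse_unit]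
      exact Ring.inverse_unit (Units.map (σ : B →* B) w))
  refine ⟨r - e, e, ?_, ?_, by ring⟩
  · refine IsUnit.of_mul_eq_one v (char_jointly_injective hinj hcard fun χ => ?_)
    rw [map_mul, hv, map_one, Ring.mul_inverse_cancel _ (hu χ)]
  · refine char_jointly_injective hinj hcard fun χ => ?_
    rw [map_mul, he]
    split_ifs <;> simp

end Fourier
open Polynomial in
theorem isLocalRing_adjoinRoot_iff {R : Type*} [CommRing R] [IsLocalRing R] (f : R[X])
    (hf : f.Monic) (hsq : Squarefree (f.map (IsLocalRing.residue R)))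
    (hdeg : 0 < f.natDegree) :
    IsLocalRing (AdjoinRoot f) ↔ Irreducible (f.map (IsLocalRing.residue R)) := by
  let k := IsLocalRing.ResidueField R
  let fb : k[X] := f.map (IsLocalRing.residue R)
  have hfb : fb.Monic := hf.map _
  have hdegb : fb.natDegree = f.natDegree := hf.natDegree_map _
  have hnu : ¬ IsUnit fb := by
    intro h
    have := natDegree_eq_zero_of_isUnit h
    omega
  let I : Ideal (AdjoinRoot f) := (IsLocalRing.maximalIdeal R).map (AdjoinRoot.of f)
  let e : AdjoinRoot f ⧸ I ≃+* k[X] ⧸ Ideal.span {fb} :=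
    AdjoinRoot.quotAdjoinRootEquivQuotPolynomialQuot (IsLocalRing.maximalIdeal R) f
  constructor
  · intro hloc
    have hnt : Nontrivial (k[X] ⧸ Ideal.span {fb}) := by
      rw [Ideal.Quotient.nontrivial_iff, Ne, Ideal.span_singleton_eq_top]
      exact hnu
    have hl : IsLocalRing (k[X] ⧸ Ideal.span {fb}) :=
      IsLocalRing.of_surjective' (e.toRingHom.comp (Ideal.Quotient.mk I))
        (e.surjective.comp Ideal.Quotient.mk_surjective)
    refine ⟨hnu, ?_⟩
    intro g h hgh
    have hgh' : fb = g * h := hgh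
    have hne : g * h ≠ 0 := hgh' ▸ hfb.ne_zero
    have hcop : IsCoprime g h := by
      have : IsRelPrime g h := by
        apply IsRelPrime.of_squarefree_mul
        rw [← hgh']; exact hsq
      exact this.isCoprime
    obtain ⟨a, b, hab⟩ := hcop
    have key : ∀ a g h : k[X], fb = g * h → g * h ≠ 0 →
        IsUnit (Ideal.Quotient.mk (Ideal.span {fb}) (a * g)) → IsUnit g := by
      intro a g h hfg hne hu
      rw [map_mul] at hu
      have hu' := isUnit_of_mul_isUnit_right hu
      have h0 : Ideal.Quotient.mk (Ideal.span {fb}) g * Ideal.Quotient.mk (Ideal.span {fb}) h = 0 := by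
        rw [← map_mul, ← hfg, Ideal.Quotient.eq_zero_iff_mem]
        exact Ideal.mem_span_singleton_self _
      have h1 := (hu'.mul_right_eq_zero).mp h0
      rw [Ideal.Quotient.eq_zero_iff_mem, Ideal.mem_span_singleton, hfg] at h1
      obtain ⟨c, hc⟩ := h1
      have hh : h ≠ 0 := right_ne_zero_of_mul hne
      refine IsUnit.of_mul_eq_one c (mul_left_cancel₀ hh ?_)
      rw [mul_one]; nth_rewrite 2 [hc]; ring
    have h1 : Ideal.Quotient.mk (Ideal.span {fb}) (a * g) +
        Ideal.Quotient.mk (Ideal.span {fb}) (b * h) = 1 := by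
      rw [← map_add, hab, map_one]
    rcases IsLocalRing.isUnit_or_isUnit_of_add_one h1 with h2 | h2
    · exact Or.inl (key a g h hgh' hne h2)
    · exact Or.inr (key b h g (hgh'.trans (mul_comm _ _)) (mul_comm g h ▸ hne) h2)
  · intro hirr
    have hmax : (Ideal.span {fb}).IsMaximal :=
      PrincipalIdealRing.isMaximal_of_irreducible hirr
    have hImax : I.IsMaximal := by
      apply Ideal.Quotient.maximal_of_isField
      exact e.toMulEquiv.isField ((Ideal.Quotient.maximal_ideal_iff_isField_quotient _).mp hmax)
    refine IsLocalRing.of_unique_max_ideal ⟨I, hImax, fun N hN => ?_⟩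
    have : Module.Finite R (AdjoinRoot f) := hf.finite_adjoinRoot
    have : Algebra.IsIntegral R (AdjoinRoot f) := inferInstance
    have hN' : (N.comap (algebraMap R (AdjoinRoot f))).IsMaximal :=
      Ideal.isMaximal_comap_of_isIntegral_of_isMaximal N
    have hle : I ≤ N := by
      rw [Ideal.map_le_iff_le_comap, ← IsLocalRing.eq_maximalIdeal hN']
      exact le_rfl
    exact (hImax.eq_of_le hN.ne_top hle).symm

section Cyclo
variable {R K E : Type*} [CommRing R] [IsDomain R] [IsLocalRing R] [IsIntegrallyClosed R]
  [Field K] [Algebra R K] [IsFractionRing R K] [Field E] [Algebra K E] [Algebra R E]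
  [IsScalarTower R K E] {n : ℕ} [NeZero n] {ζ : E}

/-- The generator of `R[ζ]`. -/
def adjGen (R : Type*) {E : Type*} [CommRing R] [Field E] [Algebra R E] (ζ : E) :
    Algebra.adjoin R ({ζ} : Set E) := ⟨ζ, Algebra.subset_adjoin rfl⟩

lemma adjGen_prim {R E : Type*} [CommRing R] [Field E] [Algebra R E] {n : ℕ} {ζ : E}
    (hζ : IsPrimitiveRoot ζ n) : IsPrimitiveRoot (adjGen R ζ) n :=
  IsPrimitiveRoot.of_map_of_injective (f := (Algebra.adjoin R ({ζ} : Set E)).val)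
    (by simpa [adjGen] using hζ) Subtype.val_injective

lemma adj_surjective {R E A : Type*} [CommRing R] [Field E] [Algebra R E] {ζ : E}
    [CommRing A] [Algebra R A] (φ : A →ₐ[R] Algebra.adjoin R ({ζ} : Set E))
    (h : ∃ a, φ a = adjGen R ζ) : Function.Surjective φ := by
  intro b
  obtain ⟨a, ha⟩ := h
  have hle : Algebra.adjoin R ({ζ} : Set E) ≤
      ((Algebra.adjoin R ({ζ} : Set E)).val.comp φ).range := by
    rw [Algebra.adjoin_le_iff, Set.singleton_subset_iff]
    exact ⟨a, by simp [ha, adjGen]⟩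
  obtain ⟨x, hx⟩ := hle b.2
  exact ⟨x, Subtype.ext hx⟩

lemma adj_enough {R E : Type*} [CommRing R] [Field E] [Algebra R E] {n : ℕ} [NeZero n] {ζ : E}
    (hζ : IsPrimitiveRoot ζ n) :
    HasEnoughRootsOfUnity (Algebra.adjoin R ({ζ} : Set E)) n where
  prim := ⟨_, adjGen_prim hζ⟩
  cyc := rootsOfUnity.isCyclic _ n

lemma exists_char_prim {B G : Type*} [CommRing B] [IsDomain B] [CommGroup G] [Fintype G]
    [HasEnoughRootsOfUnity B (Monoid.exponent G)] :
    ∃ (χ : G →* Bˣ) (g : G), IsPrimitiveRoot ((χ g : Bˣ) : B) (Monoid.exponent G) := by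
  obtain ⟨eq⟩ := CommGroup.monoidHom_mulEquiv_of_hasEnoughRootsOfUnity G B
  have hexp : Monoid.exponent (G →* Bˣ) = Monoid.exponent G :=
    Monoid.exponent_eq_of_mulEquiv eq
  obtain ⟨χ, hχ⟩ := Monoid.exists_orderOf_eq_exponent
    (Monoid.ExponentExists.of_finite (G := (G →* Bˣ)))
  rw [hexp] at hχ
  have hfr : Finite χ.range := Finite.of_surjective _ χ.rangeRestrict_surjective
  obtain ⟨y, hy⟩ := Monoid.exists_orderOf_eq_exponent
    (Monoid.ExponentExists.of_finite (G := χ.range))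
  obtain ⟨g, hgy⟩ := χ.rangeRestrict_surjective y
  have hg : orderOf (χ g) = Monoid.exponent G := by
    have hy' : orderOf (χ g) = Monoid.exponent χ.range := by
      rw [← hy, ← hgy, ← Subgroup.orderOf_coe]
      rfl
    apply Nat.dvd_antisymm
    · exact (orderOf_map_dvd χ g).trans (Monoid.order_dvd_exponent g)
    · rw [hy', ← hχ]
      apply orderOf_dvd_of_pow_eq_one
      apply MonoidHom.ext
      intro k
      have := Monoid.pow_exponent_eq_one (χ.rangeRestrict k)
      exact congrArg Subtype.val this
  refine ⟨χ, g, ?_⟩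
  rw [IsPrimitiveRoot.coe_units_iff, ← hg]
  exact IsPrimitiveRoot.orderOf _

/-- If the group ring is clean, then `R[ζ]` is local. -/
lemma isLocalRing_of_clean_group {R E G : Type*} [CommRing R] [Field E] [Algebra R E] {ζ : E}
    [CommGroup G] [Fintype G]
    (hζ : IsPrimitiveRoot ζ (Monoid.exponent G)) (h : IsCleanRing (MonoidAlgebra R G)) :
    IsLocalRing (Algebra.adjoin R ({ζ} : Set E)) := by
  have := adj_enough (R := R) hζ
  obtain ⟨χ, g, hprim⟩ := exists_char_prim (B := Algebra.adjoin R ({ζ} : Set E)) (G := G)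
  obtain ⟨i, _, hi⟩ := hprim.eq_pow_of_pow_eq_one (adjGen_prim (R := R) hζ).pow_eq_one
  have hclean : IsCleanRing (Algebra.adjoin R ({ζ} : Set E)) :=
    h.of_surjective (charEval R χ).toRingHom
    (adj_surjective (charEval R χ) ⟨MonoidAlgebra.single (g ^ i) 1, by
      rw [charEval, MonoidAlgebra.lift_single, ← hi]; simp⟩)
  exact hclean.isLocalRing

open Polynomial in
lemma isLocalRing_of_clean_quot {R E : Type*} [CommRing R] [Field E] [Algebra R E] {ζ : E}
    {n : ℕ} [NeZero n] [NeZero (n : E)]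
    (hζ : IsPrimitiveRoot ζ n) (h : IsCleanRing (R[X] ⧸ Ideal.span {cyclotomic n R})) :
    IsLocalRing (Algebra.adjoin R ({ζ} : Set E)) := by
  have h0 : aeval (adjGen R ζ) (cyclotomic n R) = 0 := by
    apply Subtype.ext
    have : ((aeval (adjGen R ζ) (cyclotomic n R) : Algebra.adjoin R ({ζ} : Set E)) : E) =
      aeval ζ (cyclotomic n R) := by
        rw [← Subalgebra.coe_val, ← aeval_algHom_apply]; rfl
    rw [this, aeval_def, eval₂_eq_eval_map, map_cyclotomic]
    exact (isRoot_cyclotomic_iff.mpr hζ)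
  let φ : (R[X] ⧸ Ideal.span {cyclotomic n R}) →ₐ[R] Algebra.adjoin R ({ζ} : Set E) :=
    Ideal.Quotient.liftₐ _ (aeval (adjGen R ζ)) (by
      intro a ha
      obtain ⟨c, rfl⟩ := Ideal.mem_span_singleton.mp ha
      rw [map_mul, h0, zero_mul])
  have hclean := h.of_surjective φ.toRingHom (adj_surjective φ ⟨Ideal.Quotient.mk _ X,
    aeval_X (adjGen R ζ)⟩)
  exact hclean.isLocalRing

lemma exists_restrict {R E : Type*} [CommRing R] [Field E] [Algebra R E] (S : Subalgebra R E)
    (τ : E ≃ₐ[R] E) (h : ∀ x ∈ S, τ x ∈ S) (h' : ∀ x ∈ S, τ.symm x ∈ S) :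
    ∃ σ : S ≃ₐ[R] S, ∀ b : S, (σ b : E) = τ (b : E) :=
  ⟨AlgEquiv.ofAlgHom (((τ : E →ₐ[R] E).comp S.val).codRestrict S fun x => h x x.2)
    (((τ.symm : E →ₐ[R] E).comp S.val).codRestrict S fun x => h' x x.2)
    (AlgHom.ext fun x => Subtype.ext (τ.apply_symm_apply (x : E)))
    (AlgHom.ext fun x => Subtype.ext (τ.symm_apply_apply (x : E))), fun _ => rfl⟩

lemma exists_restrict_adjoin {R E : Type*} [CommRing R] [Field E] [Algebra R E] {n : ℕ} [NeZero n]
    {ζ : E} (hζ : IsPrimitiveRoot ζ n) (τ : E ≃ₐ[R] E) :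
    ∃ σ : Algebra.adjoin R ({ζ} : Set E) ≃ₐ[R] Algebra.adjoin R ({ζ} : Set E),
      ∀ b : Algebra.adjoin R ({ζ} : Set E), (σ b : E) = τ (b : E) := by
  have hle : ∀ τ : E ≃ₐ[R] E, ∀ x ∈ Algebra.adjoin R ({ζ} : Set E),
      τ x ∈ Algebra.adjoin R ({ζ} : Set E) := by
    intro τ x hx
    have h1 : Algebra.adjoin R ({ζ} : Set E) ≤
        (Algebra.adjoin R ({ζ} : Set E)).comap (τ : E →ₐ[R] E) := by
      rw [Algebra.adjoin_le_iff, Set.singleton_subset_iff]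
      have : (τ ζ) ^ n = 1 := by rw [← map_pow, hζ.pow_eq_one, map_one]
      obtain ⟨i, _, hi⟩ := hζ.eq_pow_of_pow_eq_one this
      show τ ζ ∈ Algebra.adjoin R ({ζ} : Set E)
      rw [← hi]
      exact pow_mem (Algebra.self_mem_adjoin_singleton R ζ) i
    exact h1 hx
  exact exists_restrict _ τ (hle τ) (hle τ.symm)

lemma adj_invariant [IsCyclotomicExtension {n} K E] (hζ : IsPrimitiveRoot ζ n)
    (b : Algebra.adjoin R ({ζ} : Set E))
    (hb : ∀ σ : Algebra.adjoin R ({ζ} : Set E) ≃ₐ[R] Algebra.adjoin R ({ζ} : Set E), σ b = b) :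
    b ∈ Set.range (algebraMap R (Algebra.adjoin R ({ζ} : Set E))) := by
  have : IsGalois K E := IsCyclotomicExtension.isGalois {n} K E
  have hfd : FiniteDimensional K E := IsCyclotomicExtension.finiteDimensional {n} K E
  have hfix : (b : E) ∈ Set.range (algebraMap K E) := by
    rw [IsGalois.mem_range_algebraMap_iff_fixed]
    intro σ
    obtain ⟨σ', hσ'⟩ := exists_restrict_adjoin (R := R) hζ (σ.restrictScalars R)
    have h1 := hσ' b
    rw [hb σ'] at h1
    exact h1.symm
  obtain ⟨y, hy⟩ := hfix
  have hζint : IsIntegral R ζ := (hζ.isIntegral (NeZero.pos n)).tower_top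
  have hbint : IsIntegral R (b : E) :=
    adjoin_le_integralClosure hζint b.2
  have hyint : IsIntegral R y := by
    rw [← hy] at hbint
    exact (isIntegral_algebraMap_iff (algebraMap K E).injective).mp hbint
  obtain ⟨r, hr⟩ := IsIntegrallyClosed.isIntegral_iff.mp hyint
  refine ⟨r, Subtype.ext ?_⟩
  rw [← hy, ← hr, ← IsScalarTower.algebraMap_apply]
  rfl

lemma clean_group_of_local [IsCyclotomicExtension {n} K E] (hζ : IsPrimitiveRoot ζ n)
    (hloc : IsLocalRing (Algebra.adjoin R ({ζ} : Set E)))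
    {G : Type*} [CommGroup G] [Fintype G] (hG : Monoid.exponent G ∣ n)
    (hcard : IsUnit (Fintype.card G : R)) : IsCleanRing (MonoidAlgebra R G) := by
  have := adj_enough (R := R) hζ
  have : HasEnoughRootsOfUnity (Algebra.adjoin R ({ζ} : Set E)) (Monoid.exponent G) :=
    HasEnoughRootsOfUnity.of_dvd _ hG
  refine isCleanRing_monoidAlgebra (B := Algebra.adjoin R ({ζ} : Set E)) ?_ hcard
    (adj_invariant (K := K) hζ)
  intro x y hxy
  have h2 := congrArg Subtype.val hxy
  have h3 : algebraMap R E x = algebraMap R E y := h2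
  rw [IsScalarTower.algebraMap_apply R K E, IsScalarTower.algebraMap_apply R K E] at h3
  exact IsFractionRing.injective R K ((algebraMap K E).injective h3)

open Polynomial in
lemma clean_of_local [IsCyclotomicExtension {n} K E] (hζ : IsPrimitiveRoot ζ n)
    (hloc : IsLocalRing (Algebra.adjoin R ({ζ} : Set E))) (hn : IsUnit (n : R))
    {A : Type*} [CommRing A] [Algebra R A] (x : A) (hx : x ^ n = 1)
    (hsurj : Function.Surjective (aeval (R := R) x)) : IsCleanRing A := by
  let u : Aˣ := Units.ofPowEqOne x n hx (NeZero.ne n)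
  have hux : (u : A) = x := rfl
  have hu : u ^ n = 1 := Units.ext (by rw [Units.val_pow_eq_pow_val, hux, hx, Units.val_one])
  clear_value u
  have hfo : IsOfFinOrder u := isOfFinOrder_iff_pow_eq_one.mpr ⟨n, NeZero.pos n, hu⟩
  have : Finite (Subgroup.zpowers u) := hfo.finite_zpowers
  have := Fintype.ofFinite (Subgroup.zpowers u)
  have hcard : Fintype.card (Subgroup.zpowers u) ∣ n := by
    rw [← Nat.card_eq_fintype_card, Nat.card_zpowers]
    exact orderOf_dvd_of_pow_eq_one hu
  have hc : IsCleanRing (MonoidAlgebra R (Subgroup.zpowers u)) := by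
    refine clean_group_of_local (K := K) hζ hloc ?_ ?_
    · refine dvd_trans ?_ hcard
      rw [← Nat.card_eq_fintype_card]
      exact Group.exponent_dvd_nat_card
    · exact isUnit_of_dvd_unit (Nat.cast_dvd_cast hcard) hn
  let φ : MonoidAlgebra R (Subgroup.zpowers u) →ₐ[R] A :=
    MonoidAlgebra.lift R A _ ((Units.coeHom A).comp (Subgroup.zpowers u).subtype)
  refine hc.of_surjective φ.toRingHom ?_
  intro a
  obtain ⟨P, rfl⟩ := hsurj a
  refine ⟨aeval (MonoidAlgebra.single ⟨u, Subgroup.mem_zpowers u⟩ 1) P, ?_⟩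
  show φ _ = _
  rw [← aeval_algHom_apply]
  have : φ (MonoidAlgebra.single ⟨u, Subgroup.mem_zpowers u⟩ 1) = x := by
    simp only [φ, MonoidAlgebra.lift_single]
    simp [hux]
  rw [this]

open Polynomial in
lemma clean_quot_of_local [IsCyclotomicExtension {n} K E] (hζ : IsPrimitiveRoot ζ n)
    (hloc : IsLocalRing (Algebra.adjoin R ({ζ} : Set E))) (hn : IsUnit (n : R)) :
    IsCleanRing (R[X] ⧸ Ideal.span {cyclotomic n R}) := by
  refine clean_of_local (K := K) hζ hloc hn (Ideal.Quotient.mk _ X) ?_ ?_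
  · rw [← sub_eq_zero, ← map_pow, ← map_one (Ideal.Quotient.mk _), ← map_sub,
      Ideal.Quotient.eq_zero_iff_mem, Ideal.mem_span_singleton]
    exact cyclotomic.dvd_X_pow_sub_one n R
  · intro a
    obtain ⟨P, rfl⟩ := Ideal.Quotient.mk_surjective a
    refine ⟨P, ?_⟩
    have h2 : (Ideal.Quotient.mkₐ R (Ideal.span {cyclotomic n R})) P =
        aeval (Ideal.Quotient.mk (Ideal.span {cyclotomic n R}) X) P := by
      conv_lhs => rw [← aeval_X_left_apply P]
      rw [← aeval_algHom_apply]; rfl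
    exact h2.symm

open Polynomial in
lemma local_iff_degree [IsCyclotomicExtension {n} K E] (hζ : IsPrimitiveRoot ζ n)
    {p a : ℕ} (hp : p.Prime) (hk : Nat.card (IsLocalRing.ResidueField R) = p ^ a)
    (hpn : p.Coprime n) (hn : IsUnit (n : R)) :
    IsLocalRing (Algebra.adjoin R ({ζ} : Set E)) ↔
      Module.finrank K E = orderOf ((p ^ a : ℕ) : ZMod n) := by
  have : Fact p.Prime := ⟨hp⟩
  have hζint : IsIntegral R ζ := (hζ.isIntegral (NeZero.pos n)).tower_top
  have hNE : NeZero (n : E) := hζ.neZero'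
  have : Module.IsTorsionFree R E := by
    have : FaithfulSMul R E := by
      rw [faithfulSMul_iff_algebraMap_injective, IsScalarTower.algebraMap_eq R K E]
      exact (algebraMap K E).injective.comp (IsFractionRing.injective R K)
    infer_instance
  have hmon := minpoly.monic hζint
  have hdvd : minpoly R ζ ∣ cyclotomic n R := by
    apply minpoly.isIntegrallyClosed_dvd hζint
    rw [aeval_def, eval₂_eq_eval_map, map_cyclotomic]
    exact (isRoot_cyclotomic_iff.mpr hζ)
  have hdvd' : (minpoly R ζ).map (IsLocalRing.residue R) ∣
      cyclotomic n (IsLocalRing.ResidueField R) := by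
    rw [← map_cyclotomic n (IsLocalRing.residue R)]
    exact Polynomial.map_dvd _ hdvd
  have hnk : NeZero (n : IsLocalRing.ResidueField R) := by
    refine ⟨?_⟩
    have := (hn.map (IsLocalRing.residue R)).ne_zero
    simpa using this
  have hsq : Squarefree ((minpoly R ζ).map (IsLocalRing.residue R)) :=
    Squarefree.squarefree_of_dvd hdvd' (squarefree_cyclotomic n _)
  have hdeg : (minpoly R ζ).natDegree = Module.finrank K E := by
    rw [(hζ.powerBasis K).finrank, IsPrimitiveRoot.powerBasis_dim,
      minpoly.isIntegrallyClosed_eq_field_fractions' K hζint, hmon.natDegree_map]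
  have hdegb : ((minpoly R ζ).map (IsLocalRing.residue R)).natDegree = Module.finrank K E := by
    rw [hmon.natDegree_map, hdeg]
  have hfd : FiniteDimensional K E := IsCyclotomicExtension.finiteDimensional {n} K E
  have hpos : 0 < (minpoly R ζ).natDegree := hdeg ▸ Module.finrank_pos
  have hord : orderOf (ZMod.unitOfCoprime _ (hpn.pow_left a)) =
      orderOf ((p ^ a : ℕ) : ZMod n) := by
    rw [← orderOf_units, ZMod.coe_unitOfCoprime]
  have h1 : IsLocalRing (Algebra.adjoin R ({ζ} : Set E)) ↔
      IsLocalRing (AdjoinRoot (minpoly R ζ)) :=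
    ⟨fun _ => (minpoly.equivAdjoin hζint).symm.toRingEquiv.isLocalRing,
      fun _ => (minpoly.equivAdjoin hζint).toRingEquiv.isLocalRing⟩
  rw [h1, isLocalRing_adjoinRoot_iff _ hmon hsq hpos, ← hdegb, ← hord]
  have : Finite (IsLocalRing.ResidueField R) :=
    Nat.finite_of_card_ne_zero (hk ▸ pow_ne_zero _ hp.ne_zero)
  have := Fintype.ofFinite (IsLocalRing.ResidueField R)
  exact ⟨fun h => natDegree_of_dvd_cyclotomic_of_irreducible (by rw [← hk, Nat.card_eq_fintype_card]) hpn hdvd' h,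
    fun h => irreducible_of_dvd_cyclotomic_of_natDegree (by rw [← hk, Nat.card_eq_fintype_card]) hpn hdvd' h⟩

end Cyclo

section Arith

lemma orderOf_zmod_dvd (p N k : ℕ) : orderOf (p : ZMod N) ∣ k ↔ (N : ℤ) ∣ (p : ℤ) ^ k - 1 := by
  rw [orderOf_dvd_iff_pow_eq_one, ← sub_eq_zero, ← ZMod.intCast_zmod_eq_zero_iff_dvd]
  simp

lemma orderOf_zmod_lcm (p a b : ℕ) :
    orderOf (p : ZMod (Nat.lcm a b)) = Nat.lcm (orderOf (p : ZMod a)) (orderOf (p : ZMod b)) := by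
  have key : ∀ k, orderOf (p : ZMod (Nat.lcm a b)) ∣ k ↔
      Nat.lcm (orderOf (p : ZMod a)) (orderOf (p : ZMod b)) ∣ k := by
    intro k
    rw [Nat.lcm_dvd_iff, orderOf_zmod_dvd, orderOf_zmod_dvd, orderOf_zmod_dvd]
    simp only [Int.natCast_dvd, Nat.lcm_dvd_iff]
  exact Nat.dvd_antisymm ((key _).mpr dvd_rfl) ((key _).mp dvd_rfl)

lemma orderOf_zmod_pos {p m : ℕ} [NeZero m] (h : p.Coprime m) : 0 < orderOf (p : ZMod m) := by
  rw [← ZMod.coe_unitOfCoprime p h, orderOf_units]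
  exact orderOf_pos _

lemma orderOf_pow_mul (p m n : ℕ) [NeZero m] (h : p.Coprime m) :
    orderOf ((p ^ orderOf (p : ZMod m) : ℕ) : ZMod n) * orderOf (p : ZMod m) =
      orderOf (p : ZMod (Nat.lcm m n)) := by
  rw [Nat.cast_pow, orderOf_pow' _ (orderOf_zmod_pos h).ne', orderOf_zmod_lcm, Nat.lcm_comm,
    Nat.lcm, Nat.div_mul_right_comm (Nat.gcd_dvd_left _ _)]

lemma totient_mul_of_primes {a m : ℕ} (ha : a ≠ 0) (hm : m ≠ 0)
    (h : ∀ r : ℕ, r.Prime → r ∣ a → r ∣ m) : Nat.totient (a * m) = a * Nat.totient m := by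
  have h1 := Nat.totient_mul_prod_primeFactors (a * m)
  have h2 := Nat.totient_mul_prod_primeFactors m
  have h3 : (a * m).primeFactors = m.primeFactors := by
    rw [Nat.primeFactors_mul ha hm, Finset.union_eq_right]
    intro r hr
    rw [Nat.mem_primeFactors] at hr ⊢
    exact ⟨hr.1, h r hr.1 hr.2.1, hm⟩
  rw [h3, mul_assoc, ← h2, ← mul_assoc] at h1
  refine Nat.eq_of_mul_eq_mul_right ?_ h1
  exact Finset.prod_pos fun r hr => (Nat.prime_of_mem_primeFactors hr).pos

lemma arith_decomp {m n n₁ n' : ℕ} (hm : 0 < m) (hn : 0 < n)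
    (hn₁ : n₁ ∣ n ∧ Nat.Coprime m n₁ ∧ ∀ k : ℕ, k ∣ n → Nat.Coprime m k → k ≤ n₁)
    (hn' : n' = Nat.lcm m n / (m * n₁)) :
    Nat.lcm m n = Nat.lcm (n' * m) n₁ ∧
      Nat.totient (Nat.lcm m n) = n' * Nat.totient n₁ * Nat.totient m := by
  obtain ⟨⟨n₂, rfl⟩, hcop, hmax⟩ := hn₁
  have h1 : 0 < n₁ := Nat.pos_of_mul_pos_right hn
  have h2 : 0 < n₂ := Nat.pos_of_mul_pos_left hn
  have hpr : ∀ r : ℕ, r.Prime → r ∣ n₂ → r ∣ m := by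
    intro r hr hrn
    by_contra hrm
    have hc : Nat.Coprime m r := ((Nat.Prime.coprime_iff_not_dvd hr).mpr hrm).symm
    have := hmax (n₁ * r) (Nat.mul_dvd_mul_left _ hrn) (Nat.Coprime.mul_right hcop hc)
    have := hr.two_le
    nlinarith
  have hc12 : Nat.Coprime n₁ n₂ := by
    apply Nat.Coprime.symm
    apply Nat.coprime_of_dvd
    intro r hr hr2 hr1
    exact Nat.Prime.not_coprime_iff_dvd.mpr ⟨r, hr, hpr r hr hr2, hr1⟩ hcop
  have hclcm : Nat.Coprime (Nat.lcm m n₂) n₁ := by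
    refine Nat.Coprime.coprime_dvd_left (Nat.lcm_dvd_mul m n₂) ?_
    exact Nat.Coprime.mul_left hcop hc12.symm
  have hl : Nat.lcm m (n₁ * n₂) = Nat.lcm m n₂ * n₁ := by
    rw [← hclcm.lcm_eq_mul, Nat.lcm_assoc, Nat.lcm_comm n₂ n₁, hc12.lcm_eq_mul]
  obtain ⟨c, hc⟩ := Nat.dvd_lcm_left m n₂
  have hcn : n' = c := by
    rw [hn', hl, hc, show m * c * n₁ = c * (m * n₁) by ring]
    exact Nat.mul_div_cancel _ (Nat.mul_pos hm h1)
  subst hcn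
  have hc' : Nat.lcm m n₂ = n' * m := by rw [hc, mul_comm]
  have hn'0 : n' ≠ 0 := by
    rintro rfl
    have := Nat.lcm_pos hm h2
    omega
  rw [hc'] at hclcm hl
  have hprn' : ∀ r : ℕ, r.Prime → r ∣ n' → r ∣ m := by
    intro r hr hrn
    have : r ∣ m * n₂ := (hrn.trans (Dvd.intro_left m hc.symm)).trans (Nat.lcm_dvd_mul m n₂)
    rcases (Nat.Prime.dvd_mul hr).mp this with h | h
    · exact h
    · exact hpr r hr h
  refine ⟨by rw [hl, hclcm.lcm_eq_mul], ?_⟩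
  rw [hl, Nat.totient_mul hclcm, totient_mul_of_primes hn'0 hm.ne' hprn']
  ring

end Arith

lemma finrank_cyclo (m n : ℕ) [NeZero m] [NeZero n] (K E : Type*) [Field K] [CharZero K] [Field E]
    [Algebra K E] [IsCyclotomicExtension {m} ℚ K] [IsCyclotomicExtension {n} K E] :
    Module.finrank K E * Nat.totient m = Nat.totient (Nat.lcm m n) := by
  have : CharZero E := charZero_of_injective_algebraMap (algebraMap K E).injective
  have h1 : IsCyclotomicExtension ({m} ∪ {n}) ℚ E :=
    IsCyclotomicExtension.trans {m} {n} ℚ K E (algebraMap K E).injective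
  have hL : Nat.lcm m n ≠ 0 := Nat.lcm_ne_zero (NeZero.ne m) (NeZero.ne n)
  have : NeZero (Nat.lcm m n) := ⟨hL⟩
  obtain ⟨x, hx⟩ := h1.exists_isPrimitiveRoot (n := m) (by simp) (NeZero.ne m)
  obtain ⟨y, hy⟩ := h1.exists_isPrimitiveRoot (n := n) (by simp) (NeZero.ne n)
  have hz := IsPrimitiveRoot.pow_mul_pow_lcm hx hy (NeZero.ne m) (NeZero.ne n)
  have h2 := IsCyclotomicExtension.union_of_isPrimitiveRoot ({m} ∪ {n}) ℚ E hz
  have h3 : IsCyclotomicExtension ({Nat.lcm m n} ∪ {m} ∪ {n}) ℚ E := by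
    rwa [Set.union_assoc, Set.union_comm]
  have h4 : IsCyclotomicExtension ({Nat.lcm m n} ∪ {m}) ℚ E :=
    (IsCyclotomicExtension.iff_union_of_dvd ℚ E
      ⟨Nat.lcm m n, by simp, hL, Nat.dvd_lcm_right m n⟩).mpr h3
  have h5 : IsCyclotomicExtension {Nat.lcm m n} ℚ E :=
    (IsCyclotomicExtension.iff_union_of_dvd ℚ E
      ⟨Nat.lcm m n, by simp, hL, Nat.dvd_lcm_left m n⟩).mpr h4
  have f1 : Module.finrank ℚ K = Nat.totient m :=
    IsCyclotomicExtension.finrank K (Polynomial.cyclotomic.irreducible_rat (NeZero.pos m))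
  have f2 : Module.finrank ℚ E = Nat.totient (Nat.lcm m n) :=
    IsCyclotomicExtension.finrank E (Polynomial.cyclotomic.irreducible_rat (Nat.pos_of_ne_zero hL))
  rw [← f1, ← f2, mul_comm]
  exact Module.finrank_mul_finrank ℚ K E

theorem clean_main {R K : Type*} (E : Type*) [CommRing R] [IsDomain R] [IsLocalRing R] [IsIntegrallyClosed R]
    [Field K] [CharZero K] [Algebra R K] [IsFractionRing R K] (m : ℕ) [NeZero m]
    [IsCyclotomicExtension {m} ℚ K] (p : ℕ) (hp : p.Prime) (hpm : ¬ p ∣ m)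
    (hk : Nat.card (IsLocalRing.ResidueField R) = p ^ orderOf (p : ZMod m))
    (hunit : ∀ k : ℕ, ¬ p ∣ k → IsUnit (k : R))
    (G : Type*) [CommGroup G] [Fintype G]
    (n : ℕ) [Field E] [Algebra K E] [Algebra R E] [IsScalarTower R K E]
    [IsCyclotomicExtension {n} K E] (hn : Monoid.exponent G = n) (hpn : ¬ p ∣ n)
    (n₁ : ℕ) (hn₁ : n₁ ∣ n ∧ Nat.Coprime m n₁ ∧
      ∀ k : ℕ, k ∣ n → Nat.Coprime m k → k ≤ n₁)
    (n' : ℕ) (hn' : n' = Nat.lcm m n / (m * n₁)) :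
    (IsCleanRing (MonoidAlgebra R G) ↔
      IsCleanRing (Polynomial R ⧸ Ideal.span {Polynomial.cyclotomic n R})) ∧
    (IsCleanRing (MonoidAlgebra R G) ↔
      n' * Nat.totient n₁ * orderOf ((p : ZMod m)) =
        Nat.lcm (orderOf ((p : ZMod (n' * m)))) (orderOf ((p : ZMod n₁)))) := by
  have hn0 : n ≠ 0 := hn ▸ Monoid.exponent_ne_zero_of_finite
  have : NeZero n := ⟨hn0⟩
  have hm0 : 0 < m := NeZero.pos m
  have : CharZero E := charZero_of_injective_algebraMap (algebraMap K E).injective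
  have : NeZero (n : E) := ⟨Nat.cast_ne_zero.mpr hn0⟩
  have hζ := IsCyclotomicExtension.zeta_spec n K E
  have hcop : p.Coprime n := (Nat.Prime.coprime_iff_not_dvd hp).mpr hpn
  have hcopm : p.Coprime m := (Nat.Prime.coprime_iff_not_dvd hp).mpr hpm
  have hcard : ¬ p ∣ Fintype.card G := by
    intro h
    have := Fact.mk hp
    obtain ⟨g, hg⟩ := exists_prime_orderOf_dvd_card p h
    exact hpn (hn ▸ hg ▸ Monoid.order_dvd_exponent g)
  have h1 : IsCleanRing (MonoidAlgebra R G) ↔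
      IsLocalRing (Algebra.adjoin R ({IsCyclotomicExtension.zeta n K E} : Set E)) := by
    refine ⟨fun h => ?_, fun h => ?_⟩
    · exact isLocalRing_of_clean_group (G := G) (by rw [hn]; exact hζ) h
    · exact clean_group_of_local (K := K) hζ h hn.dvd (hunit _ hcard)
  have h2 : IsCleanRing (Polynomial R ⧸ Ideal.span {Polynomial.cyclotomic n R}) ↔
      IsLocalRing (Algebra.adjoin R ({IsCyclotomicExtension.zeta n K E} : Set E)) :=
    ⟨fun h => isLocalRing_of_clean_quot hζ h,
      fun h => clean_quot_of_local (K := K) hζ h (hunit _ hpn)⟩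
  refine ⟨h1.trans h2.symm, h1.trans ?_⟩
  rw [local_iff_degree (K := K) hζ hp hk hcop (hunit _ hpn)]
  obtain ⟨e1, e2⟩ := arith_decomp hm0 (Nat.pos_of_ne_zero hn0) hn₁ hn'
  have e3 := finrank_cyclo m n K E
  rw [e2] at e3
  have e4 : Module.finrank K E = n' * Nat.totient n₁ :=
    Nat.eq_of_mul_eq_mul_right (Nat.totient_pos.mpr hm0) e3
  have e5 := orderOf_pow_mul p m n hcopm
  rw [e1, orderOf_zmod_lcm] at e5
  rw [e4, ← e5]
  exact ⟨fun h => by rw [h], fun h => Nat.eq_of_mul_eq_mul_right (orderOf_zmod_pos hcopm) h⟩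

/-- Let `K = ℚ(ζ_m)` with ring of integers `𝒪`, let `𝔭` be a nonzero prime ideal of `𝒪`
lying over an odd prime `p` with `p ∤ m`, and let `G` be a finite abelian group with
`n = exp(G)` and `p ∤ n`. With `n₁` the largest divisor of `n` coprime to `m` and
`n' = lcm(m,n)/(m·n₁)`, the following are equivalent: (i) `𝒪_𝔭[G]` is clean;
(ii) `𝒪_𝔭[x]/(Φ_n(x))` is clean; (iii) `n'·φ(n₁)·ord_m(p) = lcm(ord_{n'm}(p), ord_{n₁}(p))`. -/
theorem clean_cyclotomic_localization_monoidAlgebra_iff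
    (m : ℕ+) (p : ℕ) (hp : p.Prime) (hp2 : p ≠ 2) (hpm : ¬ p ∣ (m : ℕ))
    (𝔭 : Ideal (𝓞 (CyclotomicField m ℚ))) [𝔭.IsPrime] (h𝔭 : 𝔭 ≠ ⊥)
    (hcomap : Ideal.comap (algebraMap ℤ (𝓞 (CyclotomicField m ℚ))) 𝔭 =
      Ideal.span {(p : ℤ)})
    (G : Type*) [CommGroup G] [Fintype G]
    (n : ℕ) (hn : Monoid.exponent G = n) (hpn : ¬ p ∣ n)
    (n₁ : ℕ) (hn₁ : n₁ ∣ n ∧ Nat.Coprime (m : ℕ) n₁ ∧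
      ∀ k : ℕ, k ∣ n → Nat.Coprime (m : ℕ) k → k ≤ n₁)
    (n' : ℕ) (hn' : n' = Nat.lcm (m : ℕ) n / ((m : ℕ) * n₁)) :
    (IsCleanRing (MonoidAlgebra (Localization.AtPrime 𝔭) G) ↔
      IsCleanRing (Polynomial (Localization.AtPrime 𝔭) ⧸
        Ideal.span {Polynomial.cyclotomic n (Localization.AtPrime 𝔭)})) ∧
    (IsCleanRing (MonoidAlgebra (Localization.AtPrime 𝔭) G) ↔
      n' * Nat.totient n₁ * orderOf ((p : ZMod (m : ℕ))) =
        Nat.lcm (orderOf ((p : ZMod (n' * (m : ℕ))))) (orderOf ((p : ZMod n₁)))) := by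
  have : NeZero (m : ℕ) := ⟨m.ne_zero⟩
  have := Fact.mk hp
  let K := CyclotomicField (m : ℕ) ℚ
  have : IsCyclotomicExtension {(m : ℕ)} ℚ K := CyclotomicField.isCyclotomicExtension m ℚ
  have hmax : 𝔭.IsMaximal := Ideal.IsPrime.isMaximal inferInstance h𝔭
  have hle : 𝔭.primeCompl ≤ nonZeroDivisors (𝓞 K) := 𝔭.primeCompl_le_nonZeroDivisors
  let : Algebra (Localization.AtPrime 𝔭) K :=
    (IsLocalization.lift (M := 𝔭.primeCompl) (S := Localization.AtPrime 𝔭)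
      (g := algebraMap (𝓞 K) K) (fun y =>
        IsLocalization.map_units K (⟨y, hle y.2⟩ : nonZeroDivisors (𝓞 K)))).toAlgebra
  have : IsScalarTower (𝓞 K) (Localization.AtPrime 𝔭) K :=
    IsScalarTower.of_algebraMap_eq' (IsLocalization.lift_comp _).symm
  have : IsFractionRing (Localization.AtPrime 𝔭) K :=
    IsFractionRing.isFractionRing_of_isDomain_of_isLocalization 𝔭.primeCompl _ K
  have : IsIntegrallyClosed (Localization.AtPrime 𝔭) :=
    isIntegrallyClosed_of_isLocalization _ 𝔭.primeCompl hle
  have hlies : 𝔭.LiesOver (Ideal.span {(p : ℤ)}) := ⟨hcomap.symm⟩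
  have : NeZero n := ⟨hn ▸ Monoid.exponent_ne_zero_of_finite⟩
  have : CharZero K := inferInstanceAs (CharZero (CyclotomicField (m : ℕ) ℚ))
  have : IsCyclotomicExtension {n} K (CyclotomicField n K) :=
    CyclotomicField.isCyclotomicExtension n K
  refine clean_main (K := K) (CyclotomicField n K) m p hp hpm ?_ ?_ G n hn hpn n₁ hn₁ n' hn'
  · rw [← IsCyclotomicExtension.Rat.inertiaDeg_eq_of_not_dvd p K 𝔭 hpm, Ideal.pow_inertiaDeg p 𝔭]
    exact (Nat.card_congr (Equiv.ofBijective _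
      (Ideal.bijective_algebraMap_quotient_residueField 𝔭))).symm
  · intro k hkp
    have h1 : (k : 𝓞 K) ∈ 𝔭.primeCompl := by
      intro hmem
      have : (k : ℤ) ∈ Ideal.comap (algebraMap ℤ (𝓞 K)) 𝔭 := by simpa using hmem
      rw [hcomap, Ideal.mem_span_singleton] at this
      exact hkp (by exact_mod_cast this)
    simpa using IsLocalization.map_units (Localization.AtPrime 𝔭) (⟨_, h1⟩ : 𝔭.primeCompl)
end

section
/- Let m ≥ 1, let K = ℚ(ζ_m) be the m-th cyclotomic field with ring of integers 𝒪 = ℤ[ζ_m], let 𝔭 ⊂ 𝒪 be a nonzero prime ideal with 𝔭 ∩ ℤ = pℤ for an odd prime p with p ∤ m, and let G be a finite abelian group with n = exp(G) and p ∤ n. Let n₁ be the largest divisor of n with gcd(m, n₁) = 1 and let n' = lcm(m,n)/(m·n₁). Then the following are equivalent: (i) the group ring 𝒪_𝔭[G] is feebly clean but not clean; (ii) n'·φ(n₁)·ord_m(p) = 2·lcm(ord_{n'm}(p), ord_{n₁}(p)); (iii) one of the following holds: (a) ord_{n₁}(p) = φ(n₁), ord_{n'm}(p) = n'·ord_m(p),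 and gcd(ord_{n₁}(p), ord_{n'm}(p)) = 2; (b) ord_{n₁}(p) = φ(n₁)/2, ord_{n'm}(p) = n'·ord_m(p), and gcd(ord_{n₁}(p), ord_{n'm}(p)) = 1; (c) ord_{n₁}(p) = φ(n₁), ord_{n'm}(p) = n'·ord_m(p)/2, and gcd(ord_{n₁}(p), ord_{n'm}(p)) = 1. -/
open NumberField

/-- A ring is *feebly clean* if every element can be written as `u + e₁ - e₂` with `u`
a unit and `e₁`, `e₂` orthogonal idempotents. -/
def IsFeeblyCleanRing (R : Type*) [Ring R] : Prop :=
  ∀ r : R, ∃ u e₁ e₂ : R, IsUnit u ∧ IsIdempotentElem e₁ ∧ IsIdempotentElem e₂ ∧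
    e₁ * e₂ = 0 ∧ r = u + e₁ - e₂

/-- Count primes over an unramified `p` in a cyclotomic field. -/
theorem aux_count_Q (m p : ℕ) [NeZero m] (hp : p.Prime) (hpm : ¬ p ∣ m)
    (K : Type*) [Field K] [NumberField K] [IsCyclotomicExtension {m} ℚ K] :
    ((Ideal.span {(p : ℤ)}).primesOver (𝓞 K)).ncard * orderOf (p : ZMod m) = Nat.totient m := by
  have : Fact p.Prime := ⟨hp⟩
  have : IsGalois ℚ K := IsCyclotomicExtension.isGalois {m} ℚ K
  have hpr : (Ideal.span {(p : ℤ)}).IsPrime := by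
    rw [Ideal.span_singleton_prime (by exact_mod_cast hp.ne_zero)]
    exact Nat.prime_iff_prime_int.mp hp
  have h := Ideal.ncard_primesOver_mul_ramificationIdxIn_mul_inertiaDegIn
    (Ideal.span {(p : ℤ)}) (𝓞 K) Gal(K/ℚ)
  rw [IsCyclotomicExtension.Rat.inertiaDegIn_eq_of_not_dvd p K hpm,
    IsCyclotomicExtension.Rat.ramificationIdxIn_eq_of_not_dvd p K hpm, one_mul,
    IsGalois.card_aut_eq_finrank, IsCyclotomicExtension.Rat.finrank m K] at h
  exact h

theorem aux_cyclo_lcm (m n : ℕ) [NeZero m] [NeZero n]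
    (K L : Type*) [Field K] [Field L] [CharZero L] [CharZero K] [Algebra K L]
    [IsCyclotomicExtension {m} ℚ K] [IsCyclotomicExtension {n} K L] :
    IsCyclotomicExtension {m.lcm n} ℚ L := by
  have h0 : m.lcm n ≠ 0 := Nat.lcm_ne_zero (NeZero.ne m) (NeZero.ne n)
  have : NeZero (m.lcm n) := ⟨h0⟩
  have h : IsCyclotomicExtension ({m} ∪ {n}) ℚ L :=
    IsCyclotomicExtension.trans {m} {n} ℚ K L (algebraMap K L).injective
  have hm := (IsCyclotomicExtension.zeta_spec m ℚ K).map_of_injective (algebraMap K L).injective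
  have hn := IsCyclotomicExtension.zeta_spec n K L
  obtain ⟨r, hr⟩ : ∃ r : L, IsPrimitiveRoot r (m.lcm n) := ⟨_, hm.pow_mul_pow_lcm hn (NeZero.ne m) (NeZero.ne n)⟩
  have h2 : IsCyclotomicExtension ({m} ∪ {n} ∪ {m.lcm n}) ℚ L := by
    refine IsCyclotomicExtension.union_of_isPrimitiveRoot ({m} ∪ {n}) ℚ L hr
  have h3 : IsCyclotomicExtension ({m.lcm n} ∪ {m}) ℚ L ↔ _ :=
    (IsCyclotomicExtension.iff_union_of_dvd ℚ L (S := {m.lcm n}) (n := m)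
    ⟨_, rfl, h0, Nat.dvd_lcm_left m n⟩).symm
  rw [← h3]
  rw [IsCyclotomicExtension.iff_union_of_dvd ℚ L (S := {m.lcm n} ∪ {m}) (n := n)
    ⟨m.lcm n, by simp, h0, Nat.dvd_lcm_right m n⟩]
  convert h2 using 1
  ext; simp; tauto

theorem aux_count_rel (m n p : ℕ) [NeZero m] [NeZero n] (hp : p.Prime) (hpm : ¬ p ∣ m)
    (hpn : ¬ p ∣ n)
    (K L : Type*) [Field K] [Field L] [NumberField K] [NumberField L] [Algebra K L]
    [IsCyclotomicExtension {m} ℚ K] [IsCyclotomicExtension {n} K L]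
    (𝔭 : Ideal (𝓞 K)) [𝔭.IsPrime]
    (hcomap : Ideal.comap (algebraMap ℤ (𝓞 K)) 𝔭 = Ideal.span {(p : ℤ)}) :
    (𝔭.primesOver (𝓞 L)).ncard * orderOf (p : ZMod (m.lcm n)) * Nat.totient m =
      Nat.totient (m.lcm n) * orderOf (p : ZMod m) := by
  have h0 : m.lcm n ≠ 0 := Nat.lcm_ne_zero (NeZero.ne m) (NeZero.ne n)
  have : NeZero (m.lcm n) := ⟨h0⟩
  have hpN : ¬ p ∣ m.lcm n := by
    intro h
    rcases hp.dvd_mul.mp (h.trans (Nat.lcm_dvd_mul m n)) with h | h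
    exacts [hpm h, hpn h]
  have := aux_cyclo_lcm m n K L
  have h1 := aux_count_Q m p hp hpm K
  have h2 := aux_count_Q (m.lcm n) p hp hpN L
  have : IsGalois ℚ K := IsCyclotomicExtension.isGalois {m} ℚ K
  have : IsGalois ℚ L := IsCyclotomicExtension.isGalois {m.lcm n} ℚ L
  have : 𝔭.LiesOver (Ideal.span {(p : ℤ)}) := ⟨hcomap.symm⟩
  have h3 := Ideal.ncard_primesOver_mul_ncard_primesOver (p := Ideal.span {(p : ℤ)}) 𝔭 Gal(K/ℚ) (𝓞 L) Gal(L/ℚ)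
  rw [← h1, ← h2, ← h3]
  ring

theorem aux_totient (k : ℕ) : ∀ m : ℕ, k ≠ 0 → (∀ q, q.Prime → q ∣ k → q ∣ m) →
    Nat.totient (k * m) = k * Nat.totient m := by
  induction k using Nat.recOnMul with
  | zero => intro _ h; exact absurd rfl h
  | one => simp
  | prime q hq => intro m _ h; exact Nat.totient_mul_of_prime_of_dvd hq (h q hq dvd_rfl)
  | mul a b ha hb =>
    intro m hk0 h
    rw [mul_assoc, ha (b * m) (left_ne_zero_of_mul hk0)
        (fun q hq hqd => (h q hq (hqd.mul_right b)).mul_left b),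
      hb m (right_ne_zero_of_mul hk0) (fun q hq hqd => h q hq (hqd.mul_left a)), mul_assoc]

theorem aux_pow_dvd (k : ℕ) : ∀ (M : ℕ) (x : ℤ), (∀ q, q.Prime → q ∣ k → q ∣ M) → k ≠ 0 →
    (M : ℤ) ∣ x - 1 → ((k * M : ℕ) : ℤ) ∣ x ^ k - 1 := by
  induction k using Nat.recOnMul with
  | zero => intro _ _ _ h; exact absurd rfl h
  | one => intro M x _ _ h; simpa using h
  | prime q hq =>
    intro M x h _ hd
    have hqM : (q : ℤ) ∣ M := by exact_mod_cast h q hq dvd_rfl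
    have e : x ^ q - 1 = (∑ i ∈ Finset.range q, x ^ i) * (x - 1) := (geom_sum_mul x q).symm
    rw [e]; push_cast
    refine mul_dvd_mul ?_ hd
    have hx : x ≡ 1 [ZMOD q] := (Int.modEq_iff_dvd.mpr (hqM.trans hd)).symm
    have : (∑ i ∈ Finset.range q, x ^ i) ≡ ∑ i ∈ Finset.range q, 1 [ZMOD q] := by
      apply Int.ModEq.sum
      intro i _
      simpa using hx.pow i
    rw [← Int.modEq_zero_iff_dvd]
    refine this.trans ?_
    simp
  | mul a b ha hb =>
    intro M x h h0 hd
    have h1 := ha M x (fun q hq hqd => h q hq (hqd.mul_right b)) (left_ne_zero_of_mul h0) hd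
    have h2 := hb (a * M) (x ^ a) (fun q hq hqd => (h q hq (hqd.mul_left a)).mul_left a)
      (right_ne_zero_of_mul h0) h1
    rw [pow_mul, mul_comm a b, mul_assoc]
    exact h2

theorem aux_order_dvd (m k p : ℕ) (hk : k ≠ 0) (h : ∀ q, q.Prime → q ∣ k → q ∣ m) :
    orderOf (p : ZMod (k * m)) ∣ k * orderOf (p : ZMod m) := by
  apply orderOf_dvd_of_pow_eq_one
  have h1 : (m : ℤ) ∣ (p : ℤ) ^ orderOf (p : ZMod m) - 1 := by
    rw [← ZMod.intCast_zmod_eq_zero_iff_dvd]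
    push_cast
    rw [pow_orderOf_eq_one, sub_self]
  have h2 := aux_pow_dvd k m _ h hk h1
  rw [← ZMod.intCast_zmod_eq_zero_iff_dvd] at h2
  push_cast at h2
  rw [mul_comm k (orderOf _), pow_mul]
  exact sub_eq_zero.mp h2

theorem aux_order_coprime (a b p : ℕ) (h : a.Coprime b) :
    orderOf (p : ZMod (a * b)) = Nat.lcm (orderOf (p : ZMod a)) (orderOf (p : ZMod b)) := by
  rw [← orderOf_injective (ZMod.chineseRemainder h).toMonoidHom
    (ZMod.chineseRemainder h).injective]
  rw [← Prod.orderOf_mk]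
  congr 1
  simp; rfl

theorem aux_order_totient (a p : ℕ) (h : p.Coprime a) :
    orderOf (p : ZMod a) ∣ Nat.totient a := by
  apply orderOf_dvd_of_pow_eq_one
  have := ZMod.pow_totient (ZMod.unitOfCoprime p h)
  have h2 := congrArg Units.val this
  rwa [Units.val_pow_eq_pow_val, ZMod.coe_unitOfCoprime, Units.val_one] at h2

theorem aux_structure (m n n₁ n' : ℕ) (hm : m ≠ 0) (hn : n ≠ 0) (hn₁ : n₁ ∣ n ∧ Nat.Coprime m n₁ ∧
      ∀ k : ℕ, k ∣ n → Nat.Coprime m k → k ≤ n₁)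
    (hn' : n' = Nat.lcm m n / (m * n₁)) :
    n' ≠ 0 ∧ n₁ ≠ 0 ∧ m.lcm n = n' * m * n₁ ∧ (∀ q, q.Prime → q ∣ n' → q ∣ m) ∧
      (n' * m).Coprime n₁ := by
  obtain ⟨h1, h2, h3⟩ := hn₁
  have h0 : m.lcm n ≠ 0 := Nat.lcm_ne_zero hm hn
  have hd : m * n₁ ∣ m.lcm n :=
    h2.mul_dvd_of_dvd_of_dvd (Nat.dvd_lcm_left m n) (h1.trans (Nat.dvd_lcm_right m n))
  have e : m.lcm n = n' * m * n₁ := by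
    rw [hn', mul_assoc, Nat.div_mul_cancel hd]
  have hn10 : n₁ ≠ 0 := by rintro rfl; exact hn (zero_dvd_iff.mp h1)
  have hn'0 : n' ≠ 0 := by intro h; rw [h] at e; simp at e; omega
  have hq : ∀ q, q.Prime → q ∣ n' → q ∣ m := by
    intro q hq hqn
    by_contra hqm
    have hc : Nat.Coprime m (q * n₁) :=
      Nat.Coprime.mul_right ((Nat.Prime.coprime_iff_not_dvd hq).mpr hqm).symm h2
    have : q * n₁ ∣ m * n := by
      refine Dvd.dvd.trans ?_ (Nat.lcm_dvd_mul m n)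
      rw [e, mul_assoc]
      exact mul_dvd_mul hqn (dvd_mul_left _ _)
    have := h3 _ (hc.symm.dvd_of_dvd_mul_left this) hc
    have := hq.two_le
    nlinarith [Nat.pos_of_ne_zero hn10]
  refine ⟨hn'0, hn10, e, hq, Nat.Coprime.mul_left ?_ h2⟩
  rw [Nat.coprime_iff_gcd_eq_one]
  by_contra hg
  obtain ⟨q, hqp, hqg⟩ := Nat.exists_prime_and_dvd hg
  have := hq q hqp (hqg.trans (Nat.gcd_dvd_left _ _))
  have := Nat.dvd_gcd this (hqg.trans (Nat.gcd_dvd_right _ _))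
  rw [h2] at this
  exact hqp.one_lt.ne' (Nat.dvd_one.mp this)

theorem aux_cases (A B a b : ℕ) (hA : A ≠ 0) (hB : B ≠ 0) (ha : a ∣ A) (hb : b ∣ B) :
    B * A = 2 * Nat.lcm b a ↔
    ((a = A ∧ b = B ∧ Nat.gcd a b = 2) ∨ (2 * a = A ∧ b = B ∧ Nat.gcd a b = 1) ∨
      (a = A ∧ 2 * b = B ∧ Nat.gcd a b = 1)) := by
  obtain ⟨x, rfl⟩ := ha
  obtain ⟨y, rfl⟩ := hb
  have ha0 := left_ne_zero_of_mul hA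
  have hb0 := left_ne_zero_of_mul hB
  have hg : a.gcd b * b.lcm a = a * b := by rw [Nat.lcm_comm]; exact Nat.gcd_mul_lcm a b
  have hl : b.lcm a ≠ 0 := Nat.lcm_ne_zero hb0 ha0
  have k1 : b * y * (a * x) = 2 * b.lcm a ↔ x * y * a.gcd b = 2 := by
    rw [show b * y * (a * x) = (x * y * a.gcd b) * b.lcm a by
      rw [mul_assoc (x*y), hg]; ring]
    exact Nat.mul_left_inj hl
  have k2 : a = a * x ↔ x = 1 := by
    constructor
    · intro h; exact Nat.eq_of_mul_eq_mul_left (Nat.pos_of_ne_zero ha0) (by omega)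
    · rintro rfl; simp
  have k3 : b = b * y ↔ y = 1 := by
    constructor
    · intro h; exact Nat.eq_of_mul_eq_mul_left (Nat.pos_of_ne_zero hb0) (by omega)
    · rintro rfl; simp
  have k4 : 2 * a = a * x ↔ x = 2 := by
    rw [mul_comm 2 a, Nat.mul_right_inj ha0]; exact eq_comm
  have k5 : 2 * b = b * y ↔ y = 2 := by
    rw [mul_comm 2 b, Nat.mul_right_inj hb0]; exact eq_comm
  rw [k1, k2, k3, k4, k5]
  generalize a.gcd b = g
  constructor
  · intro h
    have hx : x ∣ 2 := ⟨y * g, by rw [← h]; ring⟩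
    have hy : y ∣ 2 := ⟨x * g, by rw [← h]; ring⟩
    have hx2 := Nat.le_of_dvd two_pos hx
    have hy2 := Nat.le_of_dvd two_pos hy
    interval_cases x <;> interval_cases y <;> omega
  · rintro (⟨rfl, rfl, rfl⟩ | ⟨rfl, rfl, rfl⟩ | ⟨rfl, rfl, rfl⟩) <;> rfl

/-! ### Fourier analysis on the group ring -/

/-- Hypotheses for Galois descent of the group ring. -/
structure GData (R K L G : Type*) [CommRing R] [Field K] [Field L] [Algebra K L]
    [CommGroup G] [Fintype G] (ι : R →+* L) (S : Subring L) : Prop where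
  inj : Function.Injective ι
  mem : ∀ r, ι r ∈ S
  fix : ∀ (σ : Gal(L/K)) r, σ (ι r) = ι r
  stable : ∀ (σ : Gal(L/K)) x, x ∈ S → σ x ∈ S
  desc : ∀ x ∈ S, (∀ σ : Gal(L/K), σ x = x) → ∃ r, ι r = x
  root : ∀ (x : L) (k : ℕ), 0 < k → x ^ k = 1 → x ∈ S
  card_ne : (Fintype.card G : L) ≠ 0
  card_inv : ((Fintype.card G : L))⁻¹ ∈ S
  gen : ∀ ζ : L, IsPrimitiveRoot ζ (Monoid.exponent G) → ∀ σ : Gal(L/K), σ ζ = ζ → σ = 1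

/-- Being a unit of the subring `S` of the field `L`. -/
def SUnit {L : Type*} [Field L] (S : Subring L) (x : L) : Prop := x ∈ S ∧ x ≠ 0 ∧ x⁻¹ ∈ S

/-- The Galois action on characters. -/
def galAct {K L G : Type*} [Field K] [Field L] [Algebra K L] [CommGroup G]
    (σ : Gal(L/K)) (ψ : G →* Lˣ) : G →* Lˣ :=
  (Units.map (σ : L →* L)).comp ψ

@[simp] theorem galAct_apply {K L G : Type*} [Field K] [Field L] [Algebra K L] [CommGroup G]
    (σ : Gal(L/K)) (ψ : G →* Lˣ) (g : G) : ((galAct σ ψ g : Lˣ) : L) = σ (ψ g : L) := rfl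

/-- Evaluation of the group ring at a character. -/
noncomputable def gev {R L G : Type*} [CommRing R] [Field L] [CommGroup G]
    (ι : R →+* L) (ψ : G →* Lˣ) : MonoidAlgebra R G →+* L :=
  MonoidAlgebra.liftNCRingHom ι ((Units.coeHom L).comp ψ) (fun _ _ => Commute.all _ _)

set_option linter.unusedSectionVars false
section
variable {R K L G : Type*} [CommRing R] [Field K] [Field L] [Algebra K L]
    [CommGroup G] [Fintype G] {ι : R →+* L} {S : Subring L}

theorem gev_eq (ψ : G →* Lˣ) (a : MonoidAlgebra R G) :
    gev ι ψ a = ∑ g, ι (a.coeff g) * (ψ g : L) := by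
  classical
  induction a using MonoidAlgebra.induction_linear with
  | zero => simp
  | add a b ha hb =>
    rw [map_add, ha, hb, ← Finset.sum_add_distrib]
    refine Finset.sum_congr rfl fun g _ => ?_
    simp [add_mul]
  | single g r =>
    rw [gev, MonoidAlgebra.liftNCRingHom_single, Finset.sum_eq_single g]
    · simp
    · intro b _ hb
      simp [MonoidAlgebra.coeff_single, hb.symm]
    · simp

theorem psi_mem (h : GData R K L G ι S) (ψ : G →* Lˣ) (g : G) : (ψ g : L) ∈ S := by
  refine h.root _ (Fintype.card G) Fintype.card_pos ?_
  rw [← Units.val_pow_eq_pow_val, ← map_pow, pow_card_eq_one, map_one, Units.val_one]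

theorem gev_mem (h : GData R K L G ι S) (ψ : G →* Lˣ) (a : MonoidAlgebra R G) :
    gev ι ψ a ∈ S := by
  rw [gev_eq]
  exact S.sum_mem fun g _ => S.mul_mem (h.mem _) (psi_mem h ψ g)

theorem gev_gal (h : GData R K L G ι S) (σ : Gal(L/K)) (ψ : G →* Lˣ) (a : MonoidAlgebra R G) :
    gev ι (galAct σ ψ) a = σ (gev ι ψ a) := by
  rw [gev_eq, gev_eq, map_sum]
  refine Finset.sum_congr rfl fun g _ => ?_
  rw [map_mul, h.fix, galAct_apply]

theorem galAct_bij (σ : Gal(L/K)) :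
    Function.Bijective (galAct σ : (G →* Lˣ) → (G →* Lˣ)) := by
  refine Function.bijective_iff_has_inverse.mpr ⟨galAct σ⁻¹, fun ψ => ?_, fun ψ => ?_⟩
  · ext g; rw [galAct_apply, galAct_apply]; exact σ.symm_apply_apply _
  · ext g; rw [galAct_apply, galAct_apply]; exact σ.apply_symm_apply _

variable [HasEnoughRootsOfUnity L (Monoid.exponent G)]

theorem sum_chars [Fintype (G →* Lˣ)] (g : G) (hg : g ≠ 1) :
    ∑ ψ : G →* Lˣ, (ψ g : L) = 0 := by
  obtain ⟨φ, hφ⟩ := CommGroup.exists_apply_ne_one_of_hasEnoughRootsOfUnity G L hg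
  let F : (G →* Lˣ) →* L := (Units.coeHom L).comp (MonoidHom.eval g)
  exact sum_hom_units_eq_zero F (fun h => hφ (by
    have := DFunLike.congr_fun h φ
    exact Units.ext this))

theorem sum_grp (ψ : G →* Lˣ) (hψ : ψ ≠ 1) : ∑ g : G, (ψ g : L) = 0 := by
  refine sum_hom_units_eq_zero ((Units.coeHom L).comp ψ) (fun h => hψ ?_)
  ext g
  exact DFunLike.congr_fun h g

theorem card_chars [Fintype (G →* Lˣ)] : Fintype.card (G →* Lˣ) = Fintype.card G := by
  rw [← Nat.card_eq_fintype_card, ← Nat.card_eq_fintype_card]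
  exact CommGroup.card_monoidHom_of_hasEnoughRootsOfUnity G L

instance finite_chars : Finite (G →* Lˣ) := by
  obtain ⟨e⟩ := CommGroup.monoidHom_mulEquiv_of_hasEnoughRootsOfUnity G L
  exact Finite.of_equiv G e.symm.toEquiv

theorem gev_inj (h : GData R K L G ι S) (a b : MonoidAlgebra R G)
    (hab : ∀ ψ : G →* Lˣ, gev ι ψ a = gev ι ψ b) : a = b := by
  have : Fintype (G →* Lˣ) := Fintype.ofFinite _
  classical
  have key : ∀ (a : MonoidAlgebra R G) (g : G),
      ∑ ψ : G →* Lˣ, gev ι ψ a * (ψ g⁻¹ : L) = Fintype.card G * ι (a.coeff g) := by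
    intro a g
    simp_rw [gev_eq, Finset.sum_mul]
    rw [Finset.sum_comm, Finset.sum_eq_single g]
    · have : ∀ ψ : G →* Lˣ, ι (a.coeff g) * (ψ g : L) * (ψ g⁻¹ : L) = ι (a.coeff g) := by
        intro ψ
        rw [mul_assoc, ← Units.val_mul, ← map_mul]; simp
      simp_rw [this]
      simp [card_chars]
    · intro g' _ hg'
      have : ∀ ψ : G →* Lˣ, ι (a.coeff g') * (ψ g' : L) * (ψ g⁻¹ : L) =
          ι (a.coeff g') * (ψ (g' * g⁻¹) : L) := by
        intro ψ
        rw [mul_assoc, ← Units.val_mul, ← map_mul]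
      simp_rw [this]
      rw [← Finset.mul_sum, sum_chars _ (fun h => hg' (mul_inv_eq_one.mp h)), mul_zero]
    · simp
  ext g
  apply h.inj
  refine mul_left_cancel₀ h.card_ne ?_
  rw [← key, ← key]
  simp_rw [hab]

theorem gev_surj (h : GData R K L G ι S) (f : (G →* Lˣ) → L) (hf : ∀ ψ, f ψ ∈ S)
    (hfσ : ∀ (σ : Gal(L/K)) ψ, f (galAct σ ψ) = σ (f ψ)) :
    ∃ a : MonoidAlgebra R G, ∀ ψ, gev ι ψ a = f ψ := by
  have : Fintype (G →* Lˣ) := Fintype.ofFinite _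
  classical
  let c : G → L := fun g => (Fintype.card G : L)⁻¹ * ∑ ψ : G →* Lˣ, f ψ * (ψ g⁻¹ : L)
  have hc : ∀ g, ∃ r, ι r = c g := by
    intro g
    refine h.desc _ (S.mul_mem h.card_inv (S.sum_mem fun ψ _ => S.mul_mem (hf ψ) (psi_mem h ψ _))) ?_
    intro σ
    simp only [c]
    rw [map_mul, map_inv₀, map_natCast, map_sum]
    congr 1
    refine Fintype.sum_bijective (galAct σ) (galAct_bij σ) _ _ fun ψ => ?_
    rw [map_mul, hfσ, galAct_apply]
  choose r hr using hc
  refine ⟨∑ g, MonoidAlgebra.single g (r g), fun φ => ?_⟩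
  have e1 : gev ι φ (∑ g, MonoidAlgebra.single g (r g)) = ∑ g, c g * (φ g : L) := by
    rw [map_sum]
    refine Finset.sum_congr rfl fun g _ => ?_
    rw [gev, MonoidAlgebra.liftNCRingHom_single, hr]; rfl
  rw [e1]
  simp only [c]
  simp_rw [mul_assoc, ← Finset.mul_sum, Finset.sum_mul]
  rw [Finset.sum_comm, Finset.sum_eq_single φ]
  · have : ∀ g : G, f φ * (φ g⁻¹ : L) * (φ g : L) = f φ := by
      intro g
      rw [mul_assoc, ← Units.val_mul, ← map_mul]; simp
    simp_rw [this]
    have := h.card_ne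
    simp
    field_simp
  · intro ψ _ hψ
    have : ∀ g : G, f ψ * (ψ g⁻¹ : L) * (φ g : L) = f ψ * ((ψ⁻¹ * φ) g : L) := by
      intro g
      simp [mul_assoc]
    simp_rw [this]
    rw [← Finset.mul_sum, sum_grp, mul_zero]
    intro h1
    exact hψ (inv_mul_eq_one.mp h1)
  · simp

theorem sunit_gal (h : GData R K L G ι S) (σ : Gal(L/K)) (x : L) :
    SUnit S (σ x) ↔ SUnit S x := by
  have key : ∀ (σ : Gal(L/K)) (x : L), SUnit S x → SUnit S (σ x) := by
    rintro σ x ⟨h1, h2, h3⟩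
    refine ⟨h.stable σ _ h1, by simpa using h2, ?_⟩
    rw [← map_inv₀]; exact h.stable σ _ h3
  refine ⟨fun hx => ?_, key σ x⟩
  have := key σ⁻¹ _ hx
  rwa [show σ⁻¹ (σ x) = x from σ.symm_apply_apply x] at this

theorem gev_isUnit (h : GData R K L G ι S) (a : MonoidAlgebra R G) :
    IsUnit a ↔ ∀ ψ : G →* Lˣ, SUnit S (gev ι ψ a) := by
  constructor
  · intro ha ψ
    obtain ⟨b, hb⟩ := isUnit_iff_exists_inv.mp ha
    have hb' : gev ι ψ a * gev ι ψ b = 1 := by rw [← map_mul, hb, map_one]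
    refine ⟨gev_mem h _ _, left_ne_zero_of_mul_eq_one hb', ?_⟩
    rw [inv_eq_of_mul_eq_one_right hb']
    exact gev_mem h _ _
  · intro ha
    obtain ⟨b, hb⟩ := gev_surj h (fun ψ => (gev ι ψ a)⁻¹) (fun ψ => (ha ψ).2.2)
      (fun σ ψ => by rw [gev_gal h, map_inv₀])
    refine isUnit_iff_exists_inv.mpr ⟨b, gev_inj h _ _ fun ψ => ?_⟩
    rw [map_mul, hb, map_one, mul_inv_cancel₀ (ha ψ).2.1]

theorem exists_gen_char (h : GData R K L G ι S) :
    ∃ ψ₀ : G →* Lˣ, ∀ σ : Gal(L/K), galAct σ ψ₀ = ψ₀ → σ = 1 := by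
  obtain ⟨e⟩ := CommGroup.monoidHom_mulEquiv_of_hasEnoughRootsOfUnity G L
  have hexp : Monoid.exponent (G →* Lˣ) = Monoid.exponent G := Monoid.exponent_eq_of_mulEquiv e
  obtain ⟨ψ, hψ⟩ := Monoid.exists_orderOf_eq_exponent (G := G →* Lˣ)
    (Monoid.exponent_ne_zero.mp (by rw [hexp]; exact Monoid.exponent_ne_zero_of_finite))
  refine ⟨ψ, fun σ hσ => ?_⟩
  have : Finite ψ.range := Finite.of_surjective ψ.rangeRestrict ψ.rangeRestrict_surjective
  have hcyc : IsCyclic ψ.range := inferInstance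
  have hn : Monoid.exponent ψ.range = Monoid.exponent G := by
    rw [← hexp, ← hψ]
    apply Nat.dvd_antisymm
    · apply Monoid.exponent_dvd_of_forall_pow_eq_one
      rintro ⟨_, g, rfl⟩
      ext
      have h1 := congrArg Units.val (DFunLike.congr_fun (pow_orderOf_eq_one ψ) g)
      exact h1
    · apply orderOf_dvd_of_pow_eq_one
      ext g
      have := Monoid.pow_exponent_eq_one (⟨ψ g, g, rfl⟩ : ψ.range)
      simpa using congrArg (fun x : ψ.range => ((x : Lˣ) : L)) this
  obtain ⟨⟨_, g, rfl⟩, hg⟩ := Monoid.exists_orderOf_eq_exponent (G := ψ.range)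
    (Monoid.ExponentExists.of_finite)
  have hg' : orderOf (ψ g : L) = Monoid.exponent G := by
    rw [orderOf_units, ← hn, ← hg, ← Subgroup.orderOf_coe]
  refine h.gen (ψ g : L) (hg' ▸ IsPrimitiveRoot.orderOf _) σ ?_
  rw [← galAct_apply, hσ]

theorem gev_surj_at [FiniteDimensional K L] (h : GData R K L G ι S) :
    ∃ ψ₀ : G →* Lˣ, ∀ x ∈ S, ∃ a : MonoidAlgebra R G, gev ι ψ₀ a = x := by
  classical
  obtain ⟨ψ₀, h₀⟩ := exists_gen_char h
  refine ⟨ψ₀, fun x hx => ?_⟩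
  obtain ⟨a, ha⟩ := gev_surj h (fun ψ => ∑ σ : Gal(L/K), if galAct σ ψ₀ = ψ then σ x else 0)
    (fun ψ => S.sum_mem fun σ _ => by
      split_ifs
      exacts [h.stable σ _ hx, S.zero_mem]) (fun τ ψ => by
      rw [map_sum]
      refine (Fintype.sum_bijective (fun σ => τ * σ) (Group.mulLeft_bijective τ) _ _ fun σ => ?_).symm
      have : galAct (τ * σ) ψ₀ = galAct τ ψ ↔ galAct σ ψ₀ = ψ :=
        ⟨fun hh => (galAct_bij τ).1 (by rw [← hh]; rfl), fun hh => by rw [← hh]; rfl⟩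
      simp only [this]
      split_ifs <;> simp)
  refine ⟨a, ?_⟩
  rw [ha, Finset.sum_eq_single 1]
  · rw [if_pos (by ext; rfl)]; rfl
  · intro σ _ hσ
    rw [if_neg (fun hh => hσ (h₀ σ hh))]
  · simp

theorem idem_field {x : L} (hx : IsIdempotentElem x) : x = 0 ∨ x = 1 :=
  IsIdempotentElem.iff_eq_zero_or_one.mp hx

theorem clean_iff [FiniteDimensional K L] (h : GData R K L G ι S) :
    IsCleanRing (MonoidAlgebra R G) ↔ ∀ x ∈ S, SUnit S x ∨ SUnit S (x - 1) := by
  classical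
  constructor
  · intro hc x hx
    obtain ⟨ψ, hψ⟩ := gev_surj_at h
    obtain ⟨a, rfl⟩ := hψ x hx
    obtain ⟨u, e, hu, he, rfl⟩ := hc a
    have hu' := (gev_isUnit h u).mp hu ψ
    rcases idem_field (he.map (gev ι ψ)) with h0 | h0
    · left; rwa [map_add, h0, add_zero]
    · right; rwa [map_add, h0, add_sub_cancel_right]
  · intro hS a
    obtain ⟨e, he⟩ := gev_surj h (fun ψ => if SUnit S (gev ι ψ a) then 0 else 1)
      (fun ψ => by split_ifs; exacts [S.zero_mem, S.one_mem])
      (fun σ ψ => by rw [gev_gal h, sunit_gal h]; split_ifs <;> simp)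
    refine ⟨a - e, e, ?_, ?_, by ring⟩
    · rw [gev_isUnit h]
      intro ψ
      rw [map_sub, he]
      split_ifs with h1
      · simpa using h1
      · exact (hS _ (gev_mem h ψ a)).resolve_left h1
    · apply gev_inj h
      intro ψ
      rw [map_mul, he]
      split_ifs <;> simp

theorem feebly_iff [FiniteDimensional K L] (h : GData R K L G ι S) :
    IsFeeblyCleanRing (MonoidAlgebra R G) ↔
      ∀ x ∈ S, SUnit S x ∨ SUnit S (x - 1) ∨ SUnit S (x + 1) := by
  classical
  constructor
  · intro hc x hx
    obtain ⟨ψ, hψ⟩ := gev_surj_at h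
    obtain ⟨a, rfl⟩ := hψ x hx
    obtain ⟨u, e, e', hu, he, he', hee, rfl⟩ := hc a
    have hu' := (gev_isUnit h u).mp hu ψ
    have hmul : gev ι ψ e * gev ι ψ e' = 0 := by rw [← map_mul, hee, map_zero]
    rcases idem_field (he.map (gev ι ψ)) with h0 | h0 <;>
    rcases idem_field (he'.map (gev ι ψ)) with h1 | h1
    · left; rwa [map_sub, map_add, h0, h1, add_zero, sub_zero]
    · right; right; rwa [map_sub, map_add, h0, h1, add_zero, sub_add_cancel]
    · right; left; rwa [map_sub, map_add, h0, h1, sub_zero, add_sub_cancel_right]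
    · rw [h0, h1] at hmul; simp at hmul
  · intro hS a
    obtain ⟨e, he⟩ := gev_surj h (fun ψ => if SUnit S (gev ι ψ a) then 0 else
        if SUnit S (gev ι ψ a - 1) then 1 else 0)
      (fun ψ => by split_ifs; exacts [S.zero_mem, S.one_mem, S.zero_mem])
      (fun σ ψ => by
        rw [gev_gal h, sunit_gal h, show σ (gev ι ψ a) - 1 = σ (gev ι ψ a - 1) by simp,
          sunit_gal h]; split_ifs <;> simp)
    obtain ⟨e', he'⟩ := gev_surj h (fun ψ => if SUnit S (gev ι ψ a) then 0 else
        if SUnit S (gev ι ψ a - 1) then 0 else 1)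
      (fun ψ => by split_ifs; exacts [S.zero_mem, S.zero_mem, S.one_mem])
      (fun σ ψ => by
        rw [gev_gal h, sunit_gal h, show σ (gev ι ψ a) - 1 = σ (gev ι ψ a - 1) by simp,
          sunit_gal h]; split_ifs <;> simp)
    refine ⟨a - e + e', e, e', ?_, ?_, ?_, ?_, by ring⟩
    · rw [gev_isUnit h]
      intro ψ
      rw [map_add, map_sub, he, he']
      split_ifs with h1 h2
      · simpa using h1
      · simpa using h2
      · simpa using ((hS _ (gev_mem h ψ a)).resolve_left h1).resolve_left h2
    all_goals
      apply gev_inj h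
      intro ψ
      rw [map_mul]
      simp only [he, he']
      split_ifs <;> simp
end

theorem crt_three {A : Type*} [CommRing A] {P Q T : Ideal A} (c1 : IsCoprime P Q)
    (c2 : IsCoprime P T) (c3 : IsCoprime Q T) : ∃ a : A, a ∈ P ∧ a - 1 ∈ Q ∧ a + 1 ∈ T := by
  obtain ⟨p1, hp1, q, hq, e1⟩ := Ideal.isCoprime_iff_exists.mp c1
  obtain ⟨p2, hp2, t, ht, e2⟩ := Ideal.isCoprime_iff_exists.mp c2
  obtain ⟨q3, hq3, t3, ht3, e3⟩ := Ideal.isCoprime_iff_exists.mp c3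
  refine ⟨p1 * (t3 - q3) + p2 * (q * (t3 - q3)),
    P.add_mem (P.mul_mem_right _ hp1) (P.mul_mem_right _ hp2), ?_, ?_⟩
  · have : p1 * (t3 - q3) + p2 * (q * (t3 - q3)) - 1 = q3 * (-2) + q * (-t * (t3 - q3)) := by
      linear_combination (t3 - q3) * e1 + q * (t3 - q3) * e2 + e3
    rw [this]
    exact Q.add_mem (Q.mul_mem_right _ hq3) (Q.mul_mem_right _ hq)
  · have : p1 * (t3 - q3) + p2 * (q * (t3 - q3)) + 1 = t3 * 2 + t * (-q * (t3 - q3)) := by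
      linear_combination (t3 - q3) * e1 + q * (t3 - q3) * e2 - e3
    rw [this]
    exact T.add_mem (T.mul_mem_right _ ht3) (T.mul_mem_right _ ht)

/-! ### The semilocal ring `𝓞_L` localized at `𝔭` -/

set_option linter.unusedSectionVars false
section
variable {K : Type*} (L : Type*) [Field K] [Field L] [Algebra K L] [NumberField K] [NumberField L]

theorem coeL_mul (s t : 𝓞 K) : algebraMap K L ((s * t : 𝓞 K) : K) =
    algebraMap K L s * algebraMap K L t := by simp

/-- The semilocal ring of elements of `L` that are integral at `𝔭`. -/
def locSub (𝔭 : Ideal (𝓞 K)) [h𝔭 : 𝔭.IsPrime] : Subring L where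
  carrier := {x | ∃ s : 𝓞 K, s ∉ 𝔭 ∧ IsIntegral ℤ (algebraMap K L s * x)}
  mul_mem' := by
    rintro x y ⟨s, hs, hx⟩ ⟨t, ht, hy⟩
    refine ⟨s * t, h𝔭.mul_notMem hs ht, ?_⟩
    have e : algebraMap K L ((s * t : 𝓞 K) : K) * (x * y) =
      (algebraMap K L s * x) * (algebraMap K L t * y) := by rw [coeL_mul]; ring
    rw [e]; exact hx.mul hy
  one_mem' := ⟨1, h𝔭.one_notMem, by simpa using isIntegral_one⟩
  add_mem' := by
    rintro x y ⟨s, hs, hx⟩ ⟨t, ht, hy⟩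
    refine ⟨s * t, h𝔭.mul_notMem hs ht, ?_⟩
    have hs' : IsIntegral ℤ (algebraMap K L s) := (RingOfIntegers.isIntegral_coe s).algebraMap
    have ht' : IsIntegral ℤ (algebraMap K L t) := (RingOfIntegers.isIntegral_coe t).algebraMap
    have e : algebraMap K L ((s * t : 𝓞 K) : K) * (x + y) =
      algebraMap K L t * (algebraMap K L s * x) + algebraMap K L s * (algebraMap K L t * y) := by
      rw [coeL_mul]; ring
    rw [e]; exact (ht'.mul hx).add (hs'.mul hy)
  zero_mem' := ⟨1, h𝔭.one_notMem, by simpa using isIntegral_zero⟩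
  neg_mem' := by
    rintro x ⟨s, hs, hx⟩
    exact ⟨s, hs, by simpa using hx.neg⟩

variable {L}
variable (𝔭 : Ideal (𝓞 K)) [h𝔭 : 𝔭.IsPrime]

theorem mem_locSub {x : L} : x ∈ locSub L 𝔭 ↔
    ∃ s : 𝓞 K, s ∉ 𝔭 ∧ IsIntegral ℤ (algebraMap K L s * x) := Iff.rfl

theorem locSub_of_integral {x : L} (hx : IsIntegral ℤ x) : x ∈ locSub L 𝔭 :=
  ⟨1, h𝔭.one_notMem, by simpa using hx⟩

theorem coe_algebraMap' (s : 𝓞 K) : ((algebraMap (𝓞 K) (𝓞 L) s : 𝓞 L) : L) = algebraMap K L s := rfl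

theorem not_mem_ne_zero {s : 𝓞 K} (hs : s ∉ 𝔭) : algebraMap K L s ≠ 0 := by
  have : s ≠ 0 := by rintro rfl; exact hs 𝔭.zero_mem
  simpa using this

theorem locSub_inv {s : 𝓞 K} (hs : s ∉ 𝔭) : (algebraMap K L s)⁻¹ ∈ locSub L 𝔭 :=
  ⟨s, hs, by rw [mul_inv_cancel₀ (not_mem_ne_zero 𝔭 hs)]; exact isIntegral_one⟩

/-- Every element of `locSub` is a fraction. -/
theorem locSub_frac {x : L} (hx : x ∈ locSub L 𝔭) :
    ∃ (s : 𝓞 K) (y : 𝓞 L), s ∉ 𝔭 ∧ algebraMap K L s * x = y := by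
  obtain ⟨s, hs, hi⟩ := hx
  exact ⟨s, ⟨_, hi⟩, hs, rfl⟩

theorem mem_over_iff {P : Ideal (𝓞 L)} (hP : P ∈ 𝔭.primesOver (𝓞 L)) (s : 𝓞 K) :
    algebraMap (𝓞 K) (𝓞 L) s ∈ P ↔ s ∈ 𝔭 := by
  have := hP.2.over
  conv_rhs => rw [this]
  rfl

/-- Unit criterion. -/
theorem sunit_iff {s : 𝓞 K} (hs : s ∉ 𝔭) {x : L} {y : 𝓞 L} (hxy : algebraMap K L s * x = y) :
    SUnit (locSub L 𝔭) x ↔ ∀ P ∈ 𝔭.primesOver (𝓞 L), y ∉ P := by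
  have hs0 := not_mem_ne_zero (L := L) 𝔭 hs
  have hxe : x = (algebraMap K L s)⁻¹ * y := by rw [← hxy]; field_simp
  have hxm : x ∈ locSub L 𝔭 := ⟨s, hs, by rw [hxy]; exact RingOfIntegers.isIntegral_coe y⟩
  constructor
  · rintro ⟨-, h0, hinv⟩ P hP hyP
    obtain ⟨t, z, ht, hz⟩ := locSub_frac 𝔭 hinv
    have e : algebraMap (𝓞 K) (𝓞 L) (s * t) = y * z := by
      apply RingOfIntegers.ext
      rw [coe_algebraMap', coeL_mul]
      change _ = (y : L) * (z : L)
      rw [← hxy, ← hz]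
      field_simp
    have h1 : algebraMap (𝓞 K) (𝓞 L) (s * t) ∈ P := e ▸ P.mul_mem_right z hyP
    rw [mem_over_iff 𝔭 hP] at h1
    exact h𝔭.mul_notMem hs ht h1
  · intro h
    have : ¬ (Ideal.span {y}).comap (algebraMap (𝓞 K) (𝓞 L)) ≤ 𝔭 := by
      intro hle
      obtain ⟨Q, hQ, hQp, hQc⟩ := Ideal.exists_ideal_over_prime_of_isIntegral 𝔭 (Ideal.span {y}) hle
      exact h Q ⟨hQp, ⟨hQc.symm⟩⟩ (hQ (Ideal.mem_span_singleton_self y))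
    obtain ⟨t, ht, ht'⟩ := SetLike.not_le_iff_exists.mp this
    obtain ⟨z, hz⟩ := Ideal.mem_span_singleton.mp (Ideal.mem_comap.mp ht)
    have hz' : algebraMap K L t = (y : L) * (z : L) := by
      rw [← coe_algebraMap', hz]; push_cast; rfl
    have ht0 := not_mem_ne_zero (L := L) 𝔭 ht'
    have hy0 : (y : L) ≠ 0 := by intro h0; rw [h0, zero_mul] at hz'; exact ht0 hz'
    have hx0 : x ≠ 0 := by rintro rfl; apply hy0; rw [← hxy, mul_zero]
    refine ⟨hxm, hx0, t, ht', ?_⟩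
    have : algebraMap K L t * x⁻¹ = algebraMap K L s * (z : L) := by
      rw [hz', ← hxy]; field_simp
    rw [this, ← coe_algebraMap']
    exact (RingOfIntegers.isIntegral_coe _).mul (RingOfIntegers.isIntegral_coe _)

theorem exists_bad {x : L} {s : 𝓞 K} (hs : s ∉ 𝔭) {y : 𝓞 L} (hxy : algebraMap K L s * x = y)
    (h : ¬ SUnit (locSub L 𝔭) x) : ∃ P ∈ 𝔭.primesOver (𝓞 L), y ∈ P := by
  rw [sunit_iff 𝔭 hs hxy] at h
  push Not at h
  exact h

theorem fin_over : (𝔭.primesOver (𝓞 L)).Finite := Algebra.QuasiFinite.finite_primesOver 𝔭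

theorem sunit_of_integral (y : 𝓞 L) :
    SUnit (locSub L 𝔭) (y : L) ↔ ∀ P ∈ 𝔭.primesOver (𝓞 L), y ∉ P :=
  sunit_iff 𝔭 (s := 1) h𝔭.one_notMem (by simp)

theorem over_max (h0 : 𝔭 ≠ ⊥) {P : Ideal (𝓞 L)} (hP : P ∈ 𝔭.primesOver (𝓞 L)) : P.IsMaximal := by
  have := hP.1
  have := hP.2
  have : 𝔭.IsMaximal := h𝔭.isMaximal h0
  exact Ideal.IsMaximal.of_liesOver_isMaximal P 𝔭

theorem local_iff (h0 : 𝔭 ≠ ⊥) : (∀ x ∈ locSub L 𝔭, SUnit (locSub L 𝔭) x ∨ SUnit (locSub L 𝔭) (x - 1)) ↔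
    (𝔭.primesOver (𝓞 L)).ncard ≤ 1 := by
  constructor
  · intro h
    by_contra hc
    push Not at hc
    obtain ⟨P, Q, hP, hQ, hPQ⟩ := (Set.one_lt_ncard_iff (fin_over 𝔭)).mp hc
    have h1 := over_max 𝔭 h0 hP
    have h2 := over_max 𝔭 h0 hQ
    obtain ⟨a, ha, b, hb, hab⟩ := Ideal.isCoprime_iff_exists.mp
      (Ideal.isCoprime_of_isMaximal hPQ)
    rcases h a (locSub_of_integral 𝔭 (RingOfIntegers.isIntegral_coe a)) with h3 | h3
    · exact (sunit_of_integral 𝔭 a).mp h3 P hP ha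
    · rw [show (a : L) - 1 = ((a - 1 : 𝓞 L) : L) by push_cast; rfl] at h3
      refine (sunit_of_integral 𝔭 (a - 1)).mp h3 Q hQ ?_
      rw [← hab, sub_add_cancel_left]
      exact neg_mem hb
  · intro h x hx
    by_contra! hc
    obtain ⟨s, y, hs, hy⟩ := locSub_frac 𝔭 hx
    obtain ⟨P, hP, hyP⟩ := exists_bad 𝔭 hs hy hc.1
    obtain ⟨Q, hQ, hyQ⟩ := exists_bad 𝔭 hs (y := y - algebraMap (𝓞 K) (𝓞 L) s)
      (by rw [mul_sub, hy, mul_one]; rfl) hc.2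
    obtain rfl : P = Q := (Set.ncard_le_one (fin_over 𝔭)).mp h P hP Q hQ
    have := P.sub_mem hyP hyQ
    rw [sub_sub_cancel, mem_over_iff 𝔭 hP] at this
    exact hs this

theorem semilocal_iff (h0 : 𝔭 ≠ ⊥) (h2 : (2 : 𝓞 K) ∉ 𝔭) :
    (∀ x ∈ locSub L 𝔭, SUnit (locSub L 𝔭) x ∨ SUnit (locSub L 𝔭) (x - 1) ∨
      SUnit (locSub L 𝔭) (x + 1)) ↔
    (𝔭.primesOver (𝓞 L)).ncard ≤ 2 := by
  constructor
  · intro h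
    by_contra hc
    push Not at hc
    obtain ⟨P, Q, T, hP, hQ, hT, hPQ, hPT, hQT⟩ := (Set.two_lt_ncard_iff (fin_over 𝔭)).mp hc
    have m1 := over_max 𝔭 h0 hP
    have m2 := over_max 𝔭 h0 hQ
    have m3 := over_max 𝔭 h0 hT
    have c1 : IsCoprime P Q := Ideal.isCoprime_of_isMaximal hPQ
    have c2 : IsCoprime P T := Ideal.isCoprime_of_isMaximal hPT
    have c3 : IsCoprime Q T := Ideal.isCoprime_of_isMaximal hQT
    obtain ⟨a, a0, a1, a2⟩ := crt_three c1 c2 c3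
    rcases h a (locSub_of_integral 𝔭 (RingOfIntegers.isIntegral_coe a)) with h3 | h3 | h3
    · exact (sunit_of_integral 𝔭 a).mp h3 P hP a0
    · rw [show (a : L) - 1 = ((a - 1 : 𝓞 L) : L) by push_cast; rfl] at h3
      exact (sunit_of_integral 𝔭 (a - 1)).mp h3 Q hQ a1
    · rw [show (a : L) + 1 = ((a + 1 : 𝓞 L) : L) by push_cast; rfl] at h3
      exact (sunit_of_integral 𝔭 (a + 1)).mp h3 T hT a2
  · intro h x hx
    by_contra! hc
    obtain ⟨s, y, hs, hy⟩ := locSub_frac 𝔭 hx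
    obtain ⟨P, hP, hyP⟩ := exists_bad 𝔭 hs hy hc.1
    obtain ⟨Q, hQ, hyQ⟩ := exists_bad 𝔭 hs (y := y - algebraMap (𝓞 K) (𝓞 L) s)
      (by rw [mul_sub, hy, mul_one]; rfl) hc.2.1
    obtain ⟨T, hT, hyT⟩ := exists_bad 𝔭 hs (y := y + algebraMap (𝓞 K) (𝓞 L) s)
      (by rw [mul_add, hy, mul_one]; rfl) hc.2.2
    have hPQ : P ≠ Q := by
      rintro rfl
      have := P.sub_mem hyP hyQ
      rw [sub_sub_cancel, mem_over_iff 𝔭 hP] at this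
      exact hs this
    have hPT : P ≠ T := by
      rintro rfl
      have := P.sub_mem hyT hyP
      rw [add_sub_cancel_left, mem_over_iff 𝔭 hP] at this
      exact hs this
    have hQT : Q ≠ T := by
      rintro rfl
      have := Q.sub_mem hyT hyQ
      rw [show y + algebraMap (𝓞 K) (𝓞 L) s - (y - algebraMap (𝓞 K) (𝓞 L) s) =
        algebraMap (𝓞 K) (𝓞 L) (2 * s) by rw [map_mul, map_ofNat]; ring, mem_over_iff 𝔭 hQ] at this
      exact h𝔭.mul_notMem h2 hs this
    have := (Set.two_lt_ncard_iff (fin_over 𝔭)).mpr ⟨P, Q, T, hP, hQ, hT, hPQ, hPT, hQT⟩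
    omega

/-- The embedding of the localization into `K`. -/
noncomputable def locEmb : Localization.AtPrime 𝔭 →+* K :=
  IsLocalization.lift (M := 𝔭.primeCompl) (g := algebraMap (𝓞 K) K) (fun s => by
    rw [isUnit_iff_ne_zero]
    have : (s : 𝓞 K) ≠ 0 := fun h => s.2 (h ▸ 𝔭.zero_mem)
    simpa using this)

theorem locEmb_mk (a : 𝓞 K) (s : 𝔭.primeCompl) :
    (s : 𝓞 K) * locEmb 𝔭 (IsLocalization.mk' _ a s) = (a : K) := by
  have h1 : locEmb 𝔭 (algebraMap _ _ (s : 𝓞 K)) = (s : 𝓞 K) := IsLocalization.lift_eq _ _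
  have h2 : locEmb 𝔭 (algebraMap _ _ (a : 𝓞 K)) = a := IsLocalization.lift_eq _ _
  rw [← h1, ← h2, ← map_mul, mul_comm, IsLocalization.mk'_spec]

theorem locEmb_inj : Function.Injective (locEmb 𝔭) := by
  rw [injective_iff_map_eq_zero]
  intro r hr
  obtain ⟨a, s, rfl⟩ := IsLocalization.exists_mk'_eq 𝔭.primeCompl r
  have := locEmb_mk 𝔭 a s
  rw [hr, mul_zero] at this
  have h : a = 0 := RingOfIntegers.ext this.symm
  rw [h, IsLocalization.mk'_zero]

theorem locEmb_mem (r : Localization.AtPrime 𝔭) : algebraMap K L (locEmb 𝔭 r) ∈ locSub L 𝔭 := by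
  obtain ⟨a, s, rfl⟩ := IsLocalization.exists_mk'_eq 𝔭.primeCompl r
  refine ⟨s, s.2, ?_⟩
  rw [← map_mul, locEmb_mk]
  exact (RingOfIntegers.isIntegral_coe a).algebraMap

theorem locEmb_desc (x : K) (hx : algebraMap K L x ∈ locSub L 𝔭) : ∃ r, locEmb 𝔭 r = x := by
  obtain ⟨s, hs, hi⟩ := hx
  rw [← map_mul, isIntegral_algebraMap_iff (algebraMap K L).injective] at hi
  let z : 𝓞 K := ⟨_, hi⟩
  refine ⟨IsLocalization.mk' _ z (⟨s, hs⟩ : 𝔭.primeCompl), ?_⟩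
  have := locEmb_mk 𝔭 z (⟨s, hs⟩ : 𝔭.primeCompl)
  have hs0 : (s : K) ≠ 0 := by
    have : s ≠ 0 := by rintro rfl; exact hs 𝔭.zero_mem
    simpa using this
  exact mul_left_cancel₀ hs0 this
end

/-! ### Assembling -/

theorem natCast_mem_iff {K : Type*} [Field K] [NumberField K] (𝔭 : Ideal (𝓞 K)) (p : ℕ)
    (hcomap : Ideal.comap (algebraMap ℤ (𝓞 K)) 𝔭 = Ideal.span {(p : ℤ)}) (k : ℕ) :
    ((k : ℕ) : 𝓞 K) ∈ 𝔭 ↔ p ∣ k := by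
  have h : (k : ℤ) ∈ Ideal.comap (algebraMap ℤ (𝓞 K)) 𝔭 ↔ (k : ℤ) ∈ Ideal.span {(p : ℤ)} := by
    rw [hcomap]
  rw [Ideal.mem_comap, Ideal.mem_span_singleton, Int.natCast_dvd_natCast, map_natCast] at h
  exact h

theorem gdata_cyclo {K L G : Type*} [Field K] [Field L] [Algebra K L] [NumberField K]
    [NumberField L] [CommGroup G] [Fintype G] [IsGalois K L]
    [IsCyclotomicExtension {Monoid.exponent G} K L]
    (𝔭 : Ideal (𝓞 K)) [h𝔭 : 𝔭.IsPrime] (hcard : (Fintype.card G : 𝓞 K) ∉ 𝔭) :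
    GData (Localization.AtPrime 𝔭) K L G ((algebraMap K L).comp (locEmb 𝔭)) (locSub L 𝔭) where
  inj := (algebraMap K L).injective.comp (locEmb_inj 𝔭)
  mem := locEmb_mem 𝔭
  fix := fun σ r => σ.commutes _
  stable := by
    rintro σ x ⟨s, hs, hi⟩
    refine ⟨s, hs, ?_⟩
    have : algebraMap K L s * σ x = σ (algebraMap K L s * x) := by rw [map_mul, σ.commutes]
    rw [this]
    exact hi.map (σ.toAlgHom.restrictScalars ℤ)
  desc := by
    intro x hx hfix
    obtain ⟨y, rfl⟩ := (IsGalois.mem_range_algebraMap_iff_fixed (F := K) x).mpr hfix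
    obtain ⟨r, rfl⟩ := locEmb_desc 𝔭 y hx
    exact ⟨r, rfl⟩
  root := by
    intro x k hk hx
    refine locSub_of_integral 𝔭 (IsIntegral.of_pow hk ?_)
    rw [hx]; exact isIntegral_one
  card_ne := by exact_mod_cast Fintype.card_ne_zero
  card_inv := by
    have := locSub_inv (L := L) 𝔭 hcard
    simpa using this
  gen := by
    intro ζ hζ σ hσ
    have : NeZero (Monoid.exponent G) := ⟨Monoid.exponent_ne_zero_of_finite⟩
    have h := (hζ.powerBasis K).algHom_ext (f := (σ : L →ₐ[K] L)) (g := AlgHom.id K L)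
      (by simpa using hσ)
    ext x
    exact DFunLike.congr_fun h x

theorem main_iff {K L G : Type*} [Field K] [Field L] [Algebra K L] [NumberField K]
    [NumberField L] [CommGroup G] [Fintype G]
    [IsCyclotomicExtension {Monoid.exponent G} K L]
    (𝔭 : Ideal (𝓞 K)) [h𝔭 : 𝔭.IsPrime] (h0 : 𝔭 ≠ ⊥) (p : ℕ) (hp : p.Prime) (hp2 : p ≠ 2)
    (hcomap : Ideal.comap (algebraMap ℤ (𝓞 K)) 𝔭 = Ideal.span {(p : ℤ)})
    (hpn : ¬ p ∣ Monoid.exponent G) :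
    (IsFeeblyCleanRing (MonoidAlgebra (Localization.AtPrime 𝔭) G) ∧
        ¬ IsCleanRing (MonoidAlgebra (Localization.AtPrime 𝔭) G)) ↔
      (𝔭.primesOver (𝓞 L)).ncard = 2 := by
  have hne : NeZero (Monoid.exponent G) := ⟨Monoid.exponent_ne_zero_of_finite⟩
  have : IsGalois K L := IsCyclotomicExtension.isGalois {Monoid.exponent G} K L
  have hcard : (Fintype.card G : 𝓞 K) ∉ 𝔭 := by
    rw [natCast_mem_iff 𝔭 p hcomap]
    intro hd
    have : Fact p.Prime := ⟨hp⟩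
    obtain ⟨g, hg⟩ := exists_prime_orderOf_dvd_card p hd
    exact hpn (hg ▸ Monoid.order_dvd_exponent g)
  have h2 : (2 : 𝓞 K) ∉ 𝔭 := by
    have := (natCast_mem_iff 𝔭 p hcomap 2).not
    rw [Nat.cast_ofNat] at this
    rw [this, Nat.prime_dvd_prime_iff_eq hp Nat.prime_two]
    exact hp2
  have hζ := IsCyclotomicExtension.zeta_spec (Monoid.exponent G) K L
  have hroots : HasEnoughRootsOfUnity L (Monoid.exponent G) :=
    ⟨⟨_, hζ⟩, rootsOfUnity.isCyclic L (Monoid.exponent G)⟩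
  have hG := gdata_cyclo (L := L) (G := G) 𝔭 hcard
  have : FiniteDimensional K L := IsCyclotomicExtension.finiteDimensional {Monoid.exponent G} K L
  rw [clean_iff hG, feebly_iff hG, local_iff 𝔭 h0, semilocal_iff 𝔭 h0 h2]
  omega

/-- Let `K = ℚ(ζ_m)` with ring of integers `𝒪`, let `𝔭` be a nonzero prime ideal of `𝒪`
lying over an odd prime `p` with `p ∤ m`, and let `G` be a finite abelian group with
`n = exp(G)` and `p ∤ n`. With `n₁` the largest divisor of `n` coprime to `m` and
`n' = lcm(m,n)/(m·n₁)`, the following are equivalent: (i) `𝒪_𝔭[G]` is feebly clean but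
not clean; (ii) `n'·φ(n₁)·ord_m(p) = 2·lcm(ord_{n'm}(p), ord_{n₁}(p))`; (iii) one of the
conditions (a), (b), (c) holds. -/
theorem feeblyClean_not_clean_cyclotomic_localization_monoidAlgebra_iff
    (m : ℕ+) (p : ℕ) (hp : p.Prime) (hp2 : p ≠ 2) (hpm : ¬ p ∣ (m : ℕ))
    (𝔭 : Ideal (𝓞 (CyclotomicField m ℚ))) [𝔭.IsPrime] (h𝔭 : 𝔭 ≠ ⊥)
    (hcomap : Ideal.comap (algebraMap ℤ (𝓞 (CyclotomicField m ℚ))) 𝔭 =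
      Ideal.span {(p : ℤ)})
    (G : Type*) [CommGroup G] [Fintype G]
    (n : ℕ) (hn : Monoid.exponent G = n) (hpn : ¬ p ∣ n)
    (n₁ : ℕ) (hn₁ : n₁ ∣ n ∧ Nat.Coprime (m : ℕ) n₁ ∧
      ∀ k : ℕ, k ∣ n → Nat.Coprime (m : ℕ) k → k ≤ n₁)
    (n' : ℕ) (hn' : n' = Nat.lcm (m : ℕ) n / ((m : ℕ) * n₁)) :
    ((IsFeeblyCleanRing (MonoidAlgebra (Localization.AtPrime 𝔭) G) ∧
        ¬ IsCleanRing (MonoidAlgebra (Localization.AtPrime 𝔭) G)) ↔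
      n' * Nat.totient n₁ * orderOf ((p : ZMod (m : ℕ))) =
        2 * Nat.lcm (orderOf ((p : ZMod (n' * (m : ℕ))))) (orderOf ((p : ZMod n₁)))) ∧
    ((IsFeeblyCleanRing (MonoidAlgebra (Localization.AtPrime 𝔭) G) ∧
        ¬ IsCleanRing (MonoidAlgebra (Localization.AtPrime 𝔭) G)) ↔
      -- (a)
      ((orderOf ((p : ZMod n₁)) = Nat.totient n₁ ∧
          orderOf ((p : ZMod (n' * (m : ℕ)))) = n' * orderOf ((p : ZMod (m : ℕ))) ∧
          Nat.gcd (orderOf ((p : ZMod n₁))) (orderOf ((p : ZMod (n' * (m : ℕ))))) = 2) ∨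
      -- (b)
        (2 * orderOf ((p : ZMod n₁)) = Nat.totient n₁ ∧
          orderOf ((p : ZMod (n' * (m : ℕ)))) = n' * orderOf ((p : ZMod (m : ℕ))) ∧
          Nat.gcd (orderOf ((p : ZMod n₁))) (orderOf ((p : ZMod (n' * (m : ℕ))))) = 1) ∨
      -- (c)
        (orderOf ((p : ZMod n₁)) = Nat.totient n₁ ∧
          2 * orderOf ((p : ZMod (n' * (m : ℕ)))) = n' * orderOf ((p : ZMod (m : ℕ))) ∧
          Nat.gcd (orderOf ((p : ZMod n₁))) (orderOf ((p : ZMod (n' * (m : ℕ))))) = 1))) := by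
  subst hn
  have hn0 : Monoid.exponent G ≠ 0 := Monoid.exponent_ne_zero_of_finite
  have hne : NeZero (Monoid.exponent G) := ⟨hn0⟩
  have hnm : NeZero (m : ℕ) := ⟨m.ne_zero⟩
  let K := CyclotomicField (m : ℕ) ℚ
  let L := CyclotomicField (Monoid.exponent G) K
  have hNL : NumberField L := IsCyclotomicExtension.numberField {Monoid.exponent G} K L
  have hNm : NeZero ((m : ℕ) : ℚ) := ⟨by exact_mod_cast m.ne_zero⟩
  have hK : IsCyclotomicExtension {(m : ℕ)} ℚ K :=
    CyclotomicField.isCyclotomicExtension (m : ℕ) ℚ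
  have hmain := main_iff (L := L) (G := G) 𝔭 h𝔭 p hp hp2 hcomap hpn
  have hcount := aux_count_rel (m : ℕ) (Monoid.exponent G) p hp hpm hpn K L 𝔭 hcomap
  obtain ⟨hn'0, hn10, hlcm, hq, hcop⟩ := aux_structure (m : ℕ) (Monoid.exponent G) n₁ n'
    m.ne_zero hn0 hn₁ hn'
  have hpn1 : p.Coprime n₁ := (Nat.Prime.coprime_iff_not_dvd hp).mpr fun h => hpn (h.trans hn₁.1)
  have hpm' : p.Coprime m := (Nat.Prime.coprime_iff_not_dvd hp).mpr hpm
  have hord := aux_order_coprime (n' * m) n₁ p hcop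
  rw [hlcm, Nat.totient_mul hcop, aux_totient n' m hn'0 hq] at hcount
  rw [hord] at hcount
  have hphi : Nat.totient m ≠ 0 := (Nat.totient_pos.mpr m.pos).ne'
  have hphi1 : Nat.totient n₁ ≠ 0 := (Nat.totient_pos.mpr (Nat.pos_of_ne_zero hn10)).ne'
  have hd1 := aux_order_totient n₁ p hpn1
  have hdm := aux_order_totient m p hpm'
  have hd2 := aux_order_dvd m n' p hn'0 hq
  have hm0 : orderOf (p : ZMod (m : ℕ)) ≠ 0 := fun h => hphi (zero_dvd_iff.mp (h ▸ hdm))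
  have hB : n' * orderOf (p : ZMod (m : ℕ)) ≠ 0 := mul_ne_zero hn'0 hm0
  have hl0 : Nat.lcm (orderOf ((p : ZMod (n' * (m : ℕ))))) (orderOf ((p : ZMod n₁))) ≠ 0 :=
    Nat.lcm_ne_zero (fun h => hB (zero_dvd_iff.mp (h ▸ hd2)))
      (fun h => hphi1 (zero_dvd_iff.mp (h ▸ hd1)))
  have hkey : (𝔭.primesOver (𝓞 L)).ncard *
      Nat.lcm (orderOf ((p : ZMod (n' * (m : ℕ))))) (orderOf ((p : ZMod n₁))) =
      n' * Nat.totient n₁ * orderOf ((p : ZMod (m : ℕ))) := by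
    apply Nat.eq_of_mul_eq_mul_right (Nat.pos_of_ne_zero hphi)
    rw [hcount]; ring
  have hii : (𝔭.primesOver (𝓞 L)).ncard = 2 ↔
      n' * Nat.totient n₁ * orderOf ((p : ZMod (m : ℕ))) =
        2 * Nat.lcm (orderOf ((p : ZMod (n' * (m : ℕ))))) (orderOf ((p : ZMod n₁))) := by
    rw [← hkey]
    exact (Nat.mul_left_inj hl0).symm
  refine ⟨hmain.trans hii, (hmain.trans hii).trans ?_⟩
  rw [← aux_cases _ _ _ _ hphi1 hB hd1 hd2]
  rw [mul_right_comm]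
end

section
/- Let d ≠ 0, 1 be a squarefree integer, K = ℚ(√d) with ring of integers 𝒪 and discriminant Δ (Δ = 4d if d ≡ 2, 3 (mod 4), Δ = d if d ≡ 1 (mod 4)), let 𝔭 ⊂ 𝒪 be a nonzero prime ideal with 𝔭 ∩ ℤ = pℤ for an odd prime p, and let G be a nontrivial finite abelian group with p ∤ exp(G). Suppose Δ does not divide exp(G). Then the following are equivalent: (i) the group ring 𝒪_𝔭[G] is clean; (ii) the ring 𝒪_𝔭[x]/(Φ_{exp(G)}(x)) is clean; (iii) either [φ(exp(G)) = ord_{exp(G)}(p) and the Legendre symbol (Δ/p) equals 1 or 0], or [exp(G) = 2 and (Δ/p) = −1]. -/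
open NumberField

section CleanAux
open Polynomial




lemma jac_one_of_modEq {m : ℤ} {a : ℕ} (h : a ≡ 1 [MOD 4 * m.natAbs]) (h2 : Odd a) : jacobiSym m a = 1 := by
  rw [jacobiSym.mod_right m h2, h, ← jacobiSym.mod_right m odd_one, jacobiSym.one_right]

lemma case_odd_prime (d : ℤ) (hd : Squarefree d) (hd0 : d ≠ 0) (n : ℕ) (hn : 0 < n)
    (l : ℕ) (hl : l.Prime) (hl2 : l ≠ 2) (hld : (l : ℤ) ∣ d) (hln : ¬ l ∣ n) :
    ∃ a : ℕ, a.Coprime (8 * n * d.natAbs) ∧ a ≡ 1 [MOD n] ∧ jacobiSym d a = -1 := by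
  have : Fact l.Prime := ⟨hl⟩
  obtain ⟨m, rfl⟩ := hld
  have hlm : ¬ l ∣ m.natAbs := by
    intro h
    have h1 : (l : ℤ) ∣ m := Int.natCast_dvd.mpr h
    have := hd (l : ℤ) (mul_dvd_mul_left _ h1)
    rw [Int.isUnit_iff] at this
    have := hl.one_lt
    omega
  obtain ⟨r, hr⟩ := FiniteField.exists_nonsquare (F := ZMod l) (by rw [ZMod.ringChar_zmod_n]; exact hl2)
  have hcop : (8 * n * m.natAbs).Coprime l := by
    refine Nat.Coprime.symm ((Nat.Prime.coprime_iff_not_dvd hl).2 ?_)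
    intro h
    rcases hl.dvd_mul.1 h with h | h
    · rcases hl.dvd_mul.1 h with h | h
      · have : l ∣ 2 ^ 3 := by simpa using h
        exact hl2 ((Nat.prime_dvd_prime_iff_eq hl Nat.prime_two).1 (hl.dvd_of_dvd_pow this))
      · exact hln h
    · exact hlm h
  obtain ⟨a, ha1, ha2⟩ := Nat.chineseRemainder hcop 1 r.val
  have har : (a : ZMod l) = r := by
    rw [(ZMod.natCast_eq_natCast_iff _ _ _).2 ha2]; simp
  have ha8 : a ≡ 1 [MOD 8] := ha1.of_dvd (by simp [mul_assoc])
  have hao : Odd a := by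
    rw [Nat.odd_iff]; unfold Nat.ModEq at ha8; omega
  refine ⟨a, ?_, ha1.of_dvd ⟨8 * m.natAbs, by ring⟩, ?_⟩
  · rw [Int.natAbs_mul, show 8 * n * ((l:ℤ).natAbs * m.natAbs) = (8 * n * m.natAbs) * l by simp; ring]
    refine Nat.Coprime.mul_right ?_ ?_
    · unfold Nat.Coprime; rw [ha1.gcd_eq]; simp
    · refine Nat.Coprime.symm ((Nat.Prime.coprime_iff_not_dvd hl).2 ?_)
      intro h
      rw [(ZMod.natCast_eq_zero_iff a l).2 h] at har
      exact hr (har ▸ ⟨0, by simp⟩)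
  · rw [jacobiSym.mul_left, jac_one_of_modEq (m := m) (ha1.of_dvd ⟨2 * n, by ring⟩) hao, mul_one,
      jacobiSym.quadratic_reciprocity_one_mod_four' (hl.odd_of_ne_two hl2) (by unfold Nat.ModEq at ha8; omega),
      ZMod.nonsquare_iff_jacobiSym_eq_neg_one]
    simpa [har] using hr

lemma case_three (d : ℤ) (n : ℕ) (hn : 0 < n) (hd4 : d % 4 = 3) (hdn : d.natAbs ∣ n) (h4 : ¬ 4 ∣ n) :
    ∃ a : ℕ, a.Coprime (8 * n * d.natAbs) ∧ a ≡ 1 [MOD n] ∧ jacobiSym d a = -1 := by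
  obtain ⟨k, hk1, hkn, hk2⟩ : ∃ k, Odd k ∧ k ∣ n ∧ n ∣ 2 * k := by
    rcases Nat.even_or_odd n with h | h
    · obtain ⟨k, hk⟩ := h
      refine ⟨k, ?_, ⟨2, by omega⟩, ⟨1, by omega⟩⟩
      rw [Nat.odd_iff]; omega
    · exact ⟨n, h, dvd_rfl, ⟨2, by ring⟩⟩
  have hdo : Odd d.natAbs := by rw [Nat.odd_iff]; omega
  have hdk : d.natAbs ∣ k := by
    refine Nat.Coprime.dvd_of_dvd_mul_left (Nat.Coprime.symm (Nat.coprime_two_left.2 hdo)) (hdn.trans hk2)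
  obtain ⟨a, ha1, ha2⟩ := Nat.chineseRemainder (n := 4) (m := k) (by
    rw [show 4 = 2 ^ 2 by norm_num]; exact Nat.Coprime.pow_left _ (Nat.coprime_two_left.2 hk1)) 3 1
  have ha4 : a % 4 = 3 := ha1
  have hao : Odd a := by rw [Nat.odd_iff]; omega
  have ha2k : a ≡ 1 [MOD 2 * k] := by
    refine (Nat.modEq_and_modEq_iff_modEq_mul (Nat.coprime_two_left.2 hk1)).1 ⟨?_, ha2⟩
    unfold Nat.ModEq; omega
  have had : a ≡ 1 [MOD d.natAbs] := ha2.of_dvd hdk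
  have hJ : jacobiSym (a : ℤ) d.natAbs = 1 := by
    have : ((a : ℤ)) % (d.natAbs : ℤ) = 1 % (d.natAbs : ℤ) := by exact_mod_cast had
    rw [jacobiSym.mod_left' this, jacobiSym.one_left]
  refine ⟨a, ?_, ha2k.of_dvd hk2, ?_⟩
  · refine Nat.Coprime.mul_right (Nat.Coprime.mul_right ?_ ?_) ?_
    · rw [show 8 = 2 ^ 3 by norm_num]; exact Nat.Coprime.pow_right _ (Nat.coprime_two_right.2 hao)
    · unfold Nat.Coprime; rw [(ha2k.of_dvd hk2).gcd_eq]; simp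
    · unfold Nat.Coprime; rw [had.gcd_eq]; simp
  · rcases Int.natAbs_eq d with h | h
    · rw [h, jacobiSym.quadratic_reciprocity_three_mod_four (by omega) ha4, hJ]
    · rw [h, jacobiSym.neg _ hao, ZMod.χ₄_nat_three_mod_four ha4, jacobiSym.quadratic_reciprocity_one_mod_four (by omega) hao, hJ]
      norm_num

lemma case_two (m : ℤ) (n : ℕ) (hn : 0 < n) (hm : Odd m.natAbs) (hdn : m.natAbs ∣ n) (h8 : ¬ 8 ∣ n) :
    ∃ a : ℕ, a.Coprime (8 * n * (2 * m).natAbs) ∧ a ≡ 1 [MOD n] ∧ jacobiSym (2 * m) a = -1 := by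
  obtain ⟨k, hk1, hk2⟩ : ∃ k, Odd k ∧ n ∣ 4 * k := by
    obtain ⟨v, k, hk, hv⟩ := Nat.exists_eq_two_pow_mul_odd hn.ne'
    refine ⟨k, hk, ?_⟩
    have : v ≤ 2 := by
      by_contra h
      apply h8
      rw [hv]
      exact Dvd.dvd.mul_right (pow_dvd_pow 2 (show 3 ≤ v by omega)) _
    rw [hv]
    exact mul_dvd_mul_right (pow_dvd_pow 2 this) _
  have hdk : m.natAbs ∣ k := by
    refine Nat.Coprime.dvd_of_dvd_mul_left (Nat.Coprime.symm ?_) (hdn.trans hk2)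
    rw [show 4 = 2 ^ 2 by norm_num]; exact Nat.Coprime.pow_left _ (Nat.coprime_two_left.2 hm)
  obtain ⟨a, ha1, ha2⟩ := Nat.chineseRemainder (n := 8) (m := k) (by
    rw [show 8 = 2 ^ 3 by norm_num]; exact Nat.Coprime.pow_left _ (Nat.coprime_two_left.2 hk1)) 5 1
  have ha8 : a % 8 = 5 := ha1
  have hao : Odd a := by rw [Nat.odd_iff]; omega
  have ha4k : a ≡ 1 [MOD 4 * k] := by
    refine (Nat.modEq_and_modEq_iff_modEq_mul ?_).1 ⟨?_, ha2⟩
    · rw [show 4 = 2 ^ 2 by norm_num]; exact Nat.Coprime.pow_left _ (Nat.coprime_two_left.2 hk1)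
    · unfold Nat.ModEq; omega
  have h2 : a.Coprime 2 := Nat.coprime_two_right.2 hao
  refine ⟨a, ?_, ha4k.of_dvd hk2, ?_⟩
  · refine Nat.Coprime.mul_right (Nat.Coprime.mul_right ?_ ?_) ?_
    · rw [show 8 = 2 ^ 3 by norm_num]; exact Nat.Coprime.pow_right _ h2
    · unfold Nat.Coprime; rw [(ha4k.of_dvd hk2).gcd_eq]; simp
    · rw [Int.natAbs_mul]
      refine Nat.Coprime.mul_right h2 ?_
      unfold Nat.Coprime; rw [(ha2.of_dvd hdk).gcd_eq]; simp
  · rw [jacobiSym.mul_left, jac_one_of_modEq (m := m) (ha4k.of_dvd (mul_dvd_mul_left _ hdk)) hao,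
      jacobiSym.at_two hao, ZMod.χ₈_nat_eq_if_mod_eight]
    simp [ha8, Nat.odd_iff.1 hao]

lemma exists_residue (d : ℤ) (hd : Squarefree d) (hd0 : d ≠ 0) (Δ : ℤ)
    (hΔ : (d % 4 = 1 ∧ Δ = d) ∨ (d % 4 ≠ 1 ∧ Δ = 4 * d)) (n : ℕ) (hn : 0 < n) (hΔn : ¬ Δ ∣ (n : ℤ)) :
    ∃ a : ℕ, a.Coprime (8 * n * d.natAbs) ∧ a ≡ 1 [MOD n] ∧ jacobiSym d a = -1 := by
  by_cases H : ∃ l : ℕ, l.Prime ∧ l ≠ 2 ∧ (l : ℤ) ∣ d ∧ ¬ l ∣ n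
  · obtain ⟨l, h1, h2, h3, h4⟩ := H
    exact case_odd_prime d hd hd0 n hn l h1 h2 h3 h4
  push Not at H
  have key : ∀ e : ℤ, e ∣ d → Odd e → e.natAbs ∣ n := by
    intro e he ho
    have hsq : Squarefree e.natAbs := Int.squarefree_natAbs.2 (hd.squarefree_of_dvd he)
    rw [← Nat.prod_primeFactors_of_squarefree hsq]
    refine Finset.prod_primes_dvd _ (fun l hl => (Nat.prime_of_mem_primeFactors hl).prime) ?_
    intro l hl
    have hle : (l : ℤ) ∣ e := Int.natCast_dvd.2 (Nat.dvd_of_mem_primeFactors hl)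
    refine H l (Nat.prime_of_mem_primeFactors hl) ?_ (hle.trans he)
    rintro rfl
    rw [Int.odd_iff] at ho
    push_cast at hle
    omega
  have h4 : d % 4 ≠ 0 := by
    intro h
    have := hd 2 (by norm_num; omega)
    rw [Int.isUnit_iff] at this
    omega
  rcases hΔ with ⟨h1, rfl⟩ | ⟨h1, rfl⟩
  · exact absurd (Int.natAbs_dvd.1 (Int.natCast_dvd_natCast.2 (key _ dvd_rfl (by rw [Int.odd_iff]; omega)))) hΔn
  rcases (show d % 4 = 2 ∨ d % 4 = 3 by omega) with h | h
  · obtain ⟨m, rfl⟩ : (2 : ℤ) ∣ d := by omega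
    have hmo : Odd m := by rw [Int.odd_iff]; omega
    have hmn := key m (Dvd.intro_left _ rfl) hmo
    refine case_two m n hn (Int.natAbs_odd.2 hmo) hmn ?_
    intro h8
    apply hΔn
    rw [Int.dvd_natCast, Int.natAbs_mul, Int.natAbs_mul]
    rw [← mul_assoc]
    refine Nat.Coprime.mul_dvd_of_dvd_of_dvd ?_ h8 hmn
    exact Nat.Coprime.pow_left 3 (Nat.coprime_two_left.2 (Int.natAbs_odd.2 hmo))
  · have hmo : Odd d := by rw [Int.odd_iff]; omega
    have hmn := key d dvd_rfl hmo
    refine case_three d n hn h hmn ?_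
    intro h8
    apply hΔn
    rw [Int.dvd_natCast, Int.natAbs_mul]
    refine Nat.Coprime.mul_dvd_of_dvd_of_dvd ?_ h8 hmn
    exact Nat.Coprime.pow_left 2 (Nat.coprime_two_left.2 (Int.natAbs_odd.2 hmo))

lemma exists_prime_residue (d : ℤ) (hd : Squarefree d) (hd0 : d ≠ 0) (Δ : ℤ)
    (hΔ : (d % 4 = 1 ∧ Δ = d) ∨ (d % 4 ≠ 1 ∧ Δ = 4 * d)) (n : ℕ) (hn : 0 < n) (hΔn : ¬ Δ ∣ (n : ℤ)) (N : ℕ) :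
    ∃ q : ℕ, N < q ∧ q.Prime ∧ q ≡ 1 [MOD n] ∧ ¬ IsSquare (d : ZMod q) := by
  obtain ⟨a, h1, h2, h3⟩ := exists_residue d hd hd0 Δ hΔ n hn hΔn
  have : NeZero (8 * n * d.natAbs) := ⟨by simp [hn.ne', hd0]⟩
  obtain ⟨q, hq1, hq2, hq3⟩ := Nat.forall_exists_prime_gt_and_eq_mod ((ZMod.isUnit_iff_coprime _ _).2 h1) N
  have : Fact q.Prime := ⟨hq2⟩
  rw [ZMod.natCast_eq_natCast_iff] at hq3
  refine ⟨q, hq1, hq2, (hq3.of_dvd ⟨8 * d.natAbs, by ring⟩).trans h2, ?_⟩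
  rw [← ZMod.nonsquare_iff_jacobiSym_eq_neg_one, ← h3]
  have hao : Odd a := by
    rw [← Nat.coprime_two_right]
    exact h1.coprime_dvd_right ⟨4 * n * d.natAbs, by ring⟩
  have hqo : Odd q := by
    have := hq3.of_dvd (show 2 ∣ 8 * n * d.natAbs from ⟨4 * n * d.natAbs, by ring⟩)
    rw [Nat.odd_iff] at *
    unfold Nat.ModEq at this
    omega
  rw [jacobiSym.mod_right d hqo, jacobiSym.mod_right d hao, hq3.of_dvd ⟨2 * n, by ring⟩]


lemma no_sqrt_mod_cyclotomic (d : ℤ) (hd : Squarefree d) (hd0 : d ≠ 0) (Δ : ℤ)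
    (hΔ : (d % 4 = 1 ∧ Δ = d) ∨ (d % 4 ≠ 1 ∧ Δ = 4 * d)) (n : ℕ) (hn : 0 < n) (hΔn : ¬ Δ ∣ (n : ℤ))
    (f : ℚ[X]) (hf : cyclotomic n ℚ ∣ f ^ 2 - C (d : ℚ)) : False := by
  obtain ⟨b, hb, hg⟩ := IsLocalization.integerNormalization_spec (nonZeroDivisors ℤ) f
  set g := IsLocalization.integerNormalization (nonZeroDivisors ℤ) f with hgdef
  have hg' : g.map (Int.castRingHom ℚ) = C (b : ℚ) * f := by
    ext i
    have := congrArg (fun P => P.coeff i) hg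
    simp only [coeff_map, coeff_C_mul, eq_intCast]
    simpa using this
  have hb0 : b ≠ 0 := nonZeroDivisors.ne_zero hb
  have hdvd : cyclotomic n ℤ ∣ g ^ 2 - C (b ^ 2 * d) := by
    rw [← map_dvd_map (Int.castRingHom ℚ) Int.cast_injective (cyclotomic.monic n ℤ)]
    rw [map_cyclotomic, Polynomial.map_sub, Polynomial.map_pow, hg', map_C]
    refine (hf.mul_left (C (b : ℚ) ^ 2)).trans (dvd_of_eq ?_)
    simp
    ring
  obtain ⟨q, hq1, hq2, hq3, hq4⟩ := exists_prime_residue d hd hd0 Δ hΔ n hn hΔn (max b.natAbs n)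
  have : Fact q.Prime := ⟨hq2⟩
  have : NeZero (n : ZMod q) := ⟨by
    rw [Ne, ZMod.natCast_eq_zero_iff]
    exact Nat.not_dvd_of_pos_of_lt hn (lt_of_le_of_lt (le_max_right _ _) hq1)⟩
  have hbq : (b : ZMod q) ≠ 0 := by
    rw [Ne, ZMod.intCast_zmod_eq_zero_iff_dvd, Int.natCast_dvd]
    exact Nat.not_dvd_of_pos_of_lt (Int.natAbs_pos.2 hb0) (lt_of_le_of_lt (le_max_left _ _) hq1)
  obtain ⟨z, hz⟩ : ∃ z : ZMod q, IsPrimitiveRoot z n := by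
    have hdv : n ∣ q - 1 := (Nat.modEq_iff_dvd' hq2.one_lt.le).1 hq3.symm
    have : IsCyclic (ZMod q)ˣ := inferInstance
    obtain ⟨u, hu⟩ := IsCyclic.exists_generator (α := (ZMod q)ˣ)
    have h1 : IsPrimitiveRoot u (q - 1) := by
      rw [← ZMod.card_units q, ← Nat.card_eq_fintype_card, ← orderOf_eq_card_of_forall_mem_zpowers hu]
      exact IsPrimitiveRoot.orderOf u
    obtain ⟨k, hk⟩ := hdv
    have := h1.pow (by have := hq2.one_lt; omega) (hk.trans (mul_comm _ _))
    exact ⟨_, (IsPrimitiveRoot.coe_units_iff).2 this⟩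
  have hroot : (cyclotomic n (ZMod q)).eval z = 0 := (isRoot_cyclotomic_iff.2 hz)
  obtain ⟨h, hh⟩ := hdvd
  have := congrArg (fun P => (P.map (Int.castRingHom (ZMod q))).eval z) hh
  simp [hroot] at this
  apply hq4
  refine ⟨(g.map (Int.castRingHom (ZMod q))).eval z / b, ?_⟩
  field_simp
  rw [sub_eq_zero] at this
  rw [this]; ring

lemma irreducible_cyclotomic_quadratic (d : ℤ) (hd : Squarefree d) (hd0 : d ≠ 0)
    (K : Type*) [Field K] [NumberField K]
    (α : K) (hα : α ^ 2 = (d : K)) (hrank : Module.finrank ℚ K = 2) (Δ : ℤ)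
    (hΔ : (d % 4 = 1 ∧ Δ = d) ∨ (d % 4 ≠ 1 ∧ Δ = 4 * d)) (n : ℕ) (hn : 0 < n) (hΔn : ¬ Δ ∣ (n : ℤ)) :
    Irreducible (cyclotomic n K) := by
  have : NeZero n := ⟨hn.ne'⟩
  let L := CyclotomicField n K
  let ζ : L := IsCyclotomicExtension.zeta n K L
  have hζ : IsPrimitiveRoot ζ n := IsCyclotomicExtension.zeta_spec n K L
  have hint : IsIntegral K ζ := hζ.isIntegral hn |>.tower_top
  have hdvd : minpoly K ζ ∣ cyclotomic n K := by
    apply minpoly.dvd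
    rw [aeval_def, eval₂_eq_eval_map, map_cyclotomic]
    exact (isRoot_cyclotomic_iff.2 hζ)
  by_contra hirr
  have hlt : (minpoly K ζ).natDegree < n.totient := by
    rw [← natDegree_cyclotomic n K]
    by_contra hle
    push Not at hle
    have := Polynomial.eq_of_monic_of_dvd_of_natDegree_le (minpoly.monic hint) (cyclotomic.monic n K) hdvd hle
    exact hirr (this ▸ minpoly.irreducible hint)
  have hmin : cyclotomic n ℚ = minpoly ℚ ζ := cyclotomic_eq_minpoly_rat hζ hn
  have hintQ : IsIntegral ℚ ζ := hζ.isIntegral hn |>.tower_top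
  have hKL : Module.finrank K L = (minpoly K ζ).natDegree := by
    have h1 : IntermediateField.adjoin K {ζ} = ⊤ := by
      have := IsCyclotomicExtension.adjoin_primitive_root_eq_top (A := K) (B := L) hζ
      rw [← IntermediateField.toSubalgebra_injective.eq_iff, IntermediateField.adjoin_simple_toSubalgebra_of_isAlgebraic hint.isAlgebraic, this]
      rfl
    rw [← IntermediateField.adjoin.finrank hint, h1, IntermediateField.finrank_top']
  have hQL : Module.finrank ℚ L = 2 * (minpoly K ζ).natDegree := by
    rw [← Module.finrank_mul_finrank ℚ K L, hrank, hKL]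
  have hQζ : Module.finrank ℚ (IntermediateField.adjoin ℚ {ζ}) = n.totient := by
    rw [IntermediateField.adjoin.finrank hintQ, ← hmin, natDegree_cyclotomic]
  have : FiniteDimensional ℚ L := FiniteDimensional.trans ℚ K L
  have htop : IntermediateField.adjoin ℚ {ζ} = ⊤ := by
    have hm := Module.finrank_mul_finrank ℚ (IntermediateField.adjoin ℚ {ζ}) L
    rw [hQζ, hQL] at hm
    rw [← IntermediateField.finrank_eq_one_iff_eq_top]
    have hpos : 0 < Module.finrank (IntermediateField.adjoin ℚ {ζ}) L := Module.finrank_pos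
    nlinarith
  have hmem : algebraMap K L α ∈ Algebra.adjoin ℚ {ζ} := by
    rw [← IntermediateField.adjoin_simple_toSubalgebra_of_isAlgebraic hintQ.isAlgebraic, htop]
    trivial
  rw [Algebra.adjoin_singleton_eq_range_aeval] at hmem
  obtain ⟨f, hf⟩ := hmem
  refine no_sqrt_mod_cyclotomic d hd hd0 Δ hΔ n hn hΔn f ?_
  rw [hmin]
  apply minpoly.dvd
  have hf' : aeval ζ f = algebraMap K L α := hf
  rw [map_sub, map_pow, hf', ← map_pow, hα]
  simp


lemma int_of_rat_sq (d : ℤ) (hd : Squarefree d) (w : ℚ) (m : ℤ) (h : (d : ℚ) * w ^ 2 = m) : ∃ b : ℤ, w = b := by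
  refine ⟨w.num, ?_⟩
  have hden : (w.den : ℚ) ≠ 0 := by exact_mod_cast w.den_nz
  have h1 : d * w.num ^ 2 = m * (w.den : ℤ) ^ 2 := by
    have : (d : ℚ) * w.num ^ 2 = m * (w.den : ℚ) ^ 2 := by
      have hw : w * w.den = w.num := Rat.mul_den_eq_num w
      rw [← h, ← hw]
      ring
    exact_mod_cast this
  have hcop : IsCoprime ((w.den : ℤ) ^ 2) (w.num ^ 2) := by
    apply IsCoprime.pow
    rw [Int.isCoprime_iff_gcd_eq_one, Int.gcd_comm, Int.gcd_eq_natAbs]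
    exact w.reduced
  have h2 : (w.den : ℤ) ^ 2 ∣ d := hcop.dvd_of_dvd_mul_right ⟨m, by rw [h1]; ring⟩
  have h3 := hd (w.den : ℤ) (by rwa [← sq])
  have h4 : w.den = 1 := by
    rw [Int.isUnit_iff] at h3
    have := w.den_pos
    omega
  exact (Rat.coe_int_num_of_den_eq_one h4).symm

lemma rat_int_of_integral {K : Type*} [Field K] [NumberField K] (r : ℚ) (h : IsIntegral ℤ (algebraMap ℚ K r)) :
    ∃ m : ℤ, r = m := by
  have : IsIntegral ℤ r := (isIntegral_algebraMap_iff (algebraMap ℚ K).injective).1 h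
  obtain ⟨m, hm⟩ := IsIntegrallyClosed.isIntegral_iff.1 this
  exact ⟨m, by simpa using hm.symm⟩

lemma two_mul_integer_form (d : ℤ) (hd : Squarefree d) (hd1 : d ≠ 1)
    (K : Type*) [Field K] [NumberField K]
    (α : K) (hα : α ^ 2 = (d : K)) (hrank : Module.finrank ℚ K = 2) (x : 𝓞 K) :
    ∃ a b : ℤ, 2 * (x : K) = a + b * α := by
  have hnot : α ∉ (algebraMap ℚ K).range := by
    rintro ⟨r, rfl⟩
    have h : r ^ 2 = d := by
      apply (algebraMap ℚ K).injective
      rw [map_pow, hα]; simp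
    obtain ⟨b, hb⟩ := int_of_rat_sq 1 squarefree_one r d (by simpa using h)
    subst hb
    have h' : b ^ 2 = d := by exact_mod_cast h
    have := hd b ⟨1, by rw [← h']; ring⟩
    rw [Int.isUnit_iff] at this
    rcases this with rfl | rfl <;> simp at h' <;> exact hd1 h'.symm
  have hαint : IsIntegral ℚ α := IsIntegral.of_finite ℚ α
  have hmon : (X ^ 2 - C (d : ℚ)).Monic := monic_X_pow_sub_C _ (by norm_num)
  have hmin : minpoly ℚ α = X ^ 2 - C (d : ℚ) := by
    refine (eq_of_monic_of_dvd_of_natDegree_le (minpoly.monic hαint) hmon ?_ ?_).symm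
    · apply minpoly.dvd
      simp [hα]
    · rw [natDegree_X_pow_sub_C]
      exact (minpoly.two_le_natDegree_iff hαint).2 hnot
  have htr : Algebra.trace ℚ K α = 0 := by
    rw [trace_eq_finrank_mul_minpoly_nextCoeff, hmin, nextCoeff, natDegree_X_pow_sub_C]
    simp [-map_intCast]
  have hli : LinearIndependent ℚ ![(1 : K), α] := by
    rw [LinearIndependent.pair_iff]
    intro s t hst
    have ht : t = 0 := by
      by_contra ht
      apply hnot
      refine ⟨-s / t, ?_⟩
      have ht' : (t : K) ≠ 0 := by exact_mod_cast ht
      simp [Algebra.smul_def] at hst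
      simp
      field_simp
      linear_combination -hst
    subst ht
    simpa using hst
  have hspan := hli.span_eq_top_of_card_eq_finrank (by simp [hrank])
  have hx : (x : K) ∈ Submodule.span ℚ (Set.range ![(1 : K), α]) := hspan ▸ Submodule.mem_top
  simp only [Matrix.range_cons, Matrix.range_empty, Set.union_empty, Set.singleton_union] at hx
  obtain ⟨u, v, huv⟩ := Submodule.mem_span_pair.1 hx
  have hxi : IsIntegral ℤ (x : K) := x.isIntegral_coe
  have hu : ∃ a : ℤ, 2 * u = a := by
    have h1 : Algebra.trace ℚ K (x : K) = 2 * u := by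
      rw [← huv, map_add, map_smul, map_smul, htr, ← map_one (algebraMap ℚ K), Algebra.trace_algebraMap, hrank]
      simp [mul_comm]
    have h2 := Algebra.isIntegral_trace (L := ℚ) hxi
    obtain ⟨m, hm⟩ := IsIntegrallyClosed.isIntegral_iff.1 h2
    exact ⟨m, by rw [← h1, ← hm]; simp⟩
  obtain ⟨a, ha⟩ := hu
  have huv' : (x : K) = u + v * α := by rw [← huv]; simp [Algebra.smul_def]
  have haK : 2 * (u : K) = a := by exact_mod_cast congrArg (algebraMap ℚ K) ha
  have hN : ∃ m : ℤ, u ^ 2 - d * v ^ 2 = m := by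
    apply rat_int_of_integral (K := K)
    have : algebraMap ℚ K (u ^ 2 - d * v ^ 2) = (algebraMap ℤ K a) * x - x ^ 2 := by
      simp
      rw [← haK, huv']
      linear_combination ((v:K)^2) * hα
    rw [this]
    exact (isIntegral_algebraMap.mul hxi).sub (hxi.pow 2)
  obtain ⟨m, hm⟩ := hN
  obtain ⟨b, hb⟩ := int_of_rat_sq d hd (2 * v) (a ^ 2 - 4 * m) (by push_cast; rw [← ha, ← hm]; ring)
  refine ⟨a, b, ?_⟩
  have hbK : 2 * (v : K) = b := by exact_mod_cast congrArg (algebraMap ℚ K) hb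
  rw [← haK, ← hbK, huv']; ring

lemma card_residue (d : ℤ) (hd : Squarefree d) (hd1 : d ≠ 1)
    (K : Type*) [Field K] [NumberField K]
    (α : K) (hα : α ^ 2 = (d : K)) (hrank : Module.finrank ℚ K = 2)
    (p : ℕ) [Fact p.Prime] (hp2 : p ≠ 2)
    (𝔭 : Ideal (𝓞 K)) [𝔭.IsPrime] (h𝔭 : 𝔭 ≠ ⊥)
    (hcomap : Ideal.comap (algebraMap ℤ (𝓞 K)) 𝔭 = Ideal.span {(p : ℤ)}) :
    (IsSquare (d : ZMod p) → Nat.card (𝓞 K ⧸ 𝔭) = p) ∧ (¬ IsSquare (d : ZMod p) → Nat.card (𝓞 K ⧸ 𝔭) = p ^ 2) := by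
  have hmax : 𝔭.IsMaximal := Ideal.IsPrime.isMaximal inferInstance h𝔭
  have hint : IsIntegral ℤ α := by
    refine ⟨X ^ 2 - C d, monic_X_pow_sub_C _ (by norm_num), ?_⟩
    simp [hα, -map_intCast, -eq_intCast, eval₂_C]
  let A : 𝓞 K := ⟨α, hint⟩
  have hAK : algebraMap (𝓞 K) K A = α := rfl
  have hA : A ^ 2 = (d : 𝓞 K) := by
    apply RingOfIntegers.ext
    change algebraMap (𝓞 K) K (A ^ 2) = algebraMap (𝓞 K) K (d : 𝓞 K)
    rw [map_pow, hAK, hα, map_intCast]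
  have hform : ∀ x : 𝓞 K, ∃ a b : ℤ, 2 * x = a + b * A := by
    intro x
    obtain ⟨a, b, h⟩ := two_mul_integer_form d hd hd1 K α hα hrank x
    refine ⟨a, b, ?_⟩
    apply RingOfIntegers.ext
    change algebraMap (𝓞 K) K (2 * x) = algebraMap (𝓞 K) K (a + b * A)
    rw [map_mul, map_add, map_mul, hAK, map_intCast, map_intCast, map_ofNat]
    exact h
  let : Field (𝓞 K ⧸ 𝔭) := Ideal.Quotient.field 𝔭
  have hpmem : ∀ m : ℤ, ((m : 𝓞 K ⧸ 𝔭) = 0 ↔ (p : ℤ) ∣ m) := by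
    intro m
    rw [← Ideal.mem_span_singleton, ← hcomap, Ideal.mem_comap, ← Ideal.Quotient.eq_zero_iff_mem]
    simp
  have hch : CharP (𝓞 K ⧸ 𝔭) p := ⟨fun m => by
    have := hpmem m
    rw [Int.natCast_dvd_natCast] at this
    exact_mod_cast this⟩
  let : Algebra (ZMod p) (𝓞 K ⧸ 𝔭) := ZMod.algebra _ p
  set β : 𝓞 K ⧸ 𝔭 := Ideal.Quotient.mk 𝔭 A with hβ
  have hβ2 : β ^ 2 = algebraMap (ZMod p) _ (d : ZMod p) := by
    rw [hβ, ← map_pow, hA]; simp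
  have h2 : (2 : 𝓞 K ⧸ 𝔭) ≠ 0 := by
    have := (hpmem 2).not.2 (by
      intro h
      have h' : p ∣ 2 := by exact_mod_cast h
      exact hp2 ((Nat.prime_dvd_prime_iff_eq Fact.out Nat.prime_two).1 h'))
    exact_mod_cast this
  have h2' : (2 : ZMod p) ≠ 0 := by
    intro h
    apply h2
    have := congrArg (algebraMap (ZMod p) (𝓞 K ⧸ 𝔭)) h
    rwa [map_ofNat, map_zero] at this
  have hformk : ∀ y : 𝓞 K ⧸ 𝔭, ∃ a b : ZMod p, y = algebraMap _ _ a + algebraMap _ _ b * β := by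
    intro y
    obtain ⟨x, rfl⟩ := Ideal.Quotient.mk_surjective y
    obtain ⟨a, b, h⟩ := hform x
    refine ⟨(a : ZMod p) / 2, (b : ZMod p) / 2, ?_⟩
    have := congrArg (Ideal.Quotient.mk 𝔭) h
    simp only [map_mul, map_ofNat, map_add, map_intCast] at this
    simp only [map_div₀, map_intCast, map_ofNat]
    field_simp
    rw [mul_comm, this]
  have hspan : Submodule.span (ZMod p) {1, β} = ⊤ := by
    rw [eq_top_iff]
    intro y _
    obtain ⟨a, b, h⟩ := hformk y
    rw [Submodule.mem_span_pair]
    exact ⟨a, b, by rw [h, Algebra.smul_def, Algebra.smul_def, mul_one]⟩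
  have hfin : Module.Finite (ZMod p) (𝓞 K ⧸ 𝔭) := by
    classical
    exact ⟨⟨{1, β}, by simpa using hspan⟩⟩
  have hcard : Nat.card (𝓞 K ⧸ 𝔭) = p ^ Module.finrank (ZMod p) (𝓞 K ⧸ 𝔭) := by
    rw [Module.natCard_eq_pow_finrank (K := ZMod p), Nat.card_zmod]
  have hle : Module.finrank (ZMod p) (𝓞 K ⧸ 𝔭) ≤ 2 := by
    rw [← finrank_top, ← hspan]
    classical
    have := finrank_span_finset_le_card (R := ZMod p) ({1, β} : Finset (𝓞 K ⧸ 𝔭))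
    have h3 := Finset.card_le_two (a := (1 : 𝓞 K ⧸ 𝔭)) (b := β)
    simp only [Finset.coe_insert, Finset.coe_singleton] at this
    exact this.trans h3
  have hpos : 0 < Module.finrank (ZMod p) (𝓞 K ⧸ 𝔭) := Module.finrank_pos
  have hone : Module.finrank (ZMod p) (𝓞 K ⧸ 𝔭) = 1 ↔ IsSquare (d : ZMod p) := by
    rw [← Subalgebra.bot_eq_top_iff_finrank_eq_one]
    constructor
    · intro h
      have : β ∈ (⊥ : Subalgebra (ZMod p) (𝓞 K ⧸ 𝔭)) := h ▸ Algebra.mem_top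
      obtain ⟨c, hc⟩ := Algebra.mem_bot.1 this
      refine ⟨c, ?_⟩
      apply (algebraMap (ZMod p) (𝓞 K ⧸ 𝔭)).injective
      rw [← hβ2, ← hc, map_mul, sq]
    · rintro ⟨c, hc⟩
      have hb : β ∈ (⊥ : Subalgebra (ZMod p) (𝓞 K ⧸ 𝔭)) := by
        rw [hc, map_mul, ← sq, sq_eq_sq_iff_eq_or_eq_neg] at hβ2
        rcases hβ2 with h | h
        · rw [h]; exact Subalgebra.algebraMap_mem _ _
        · rw [h]; exact neg_mem (Subalgebra.algebraMap_mem _ _)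
      rw [eq_top_iff]
      intro y _
      obtain ⟨a, b, rfl⟩ := hformk y
      exact add_mem (Subalgebra.algebraMap_mem _ _) (mul_mem (Subalgebra.algebraMap_mem _ _) hb)
  constructor
  · intro h
    rw [hcard, hone.2 h, pow_one]
  · intro h
    rw [hcard]
    congr 1
    have := hone.not.2 h
    omega


/-- Idempotents in the linear span of (images of) finitely many idempotents lift. -/
lemma lift_idem {R S k ι : Type*} [CommRing R] [CommRing S] [Field k] [Algebra k S] [Fintype ι]
    (φ : R →+* S) (E : ι → R) (hE : ∀ i, E i * E i = E i) (x : S)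
    (hx : x ∈ Submodule.span k (Set.range fun i => φ (E i))) (hxx : x * x = x) :
    ∃ e : R, IsIdempotentElem e ∧ φ e = x := by
  classical
  let F : Finset ι → R := fun s => (∏ i ∈ s, E i) * ∏ i ∈ Finset.univ \ s, (1 - E i)
  have hF1 : ∑ s : Finset ι, F s = 1 := by
    have := Finset.prod_add (fun i => E i) (fun i => 1 - E i) Finset.univ
    simpa using this.symm
  have hin : ∀ i s, i ∈ s → E i * F s = F s := by
    intro i s hi
    simp only [F]
    rw [← Finset.mul_prod_erase s _ hi, ← mul_assoc, ← mul_assoc, hE]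
  have hout : ∀ i s, i ∉ s → E i * F s = 0 := by
    intro i s hi
    simp only [F]
    rw [← Finset.mul_prod_erase (Finset.univ \ s) _ (by simpa using hi)]
    have : E i * (1 - E i) = 0 := by rw [mul_sub, hE]; ring
    linear_combination ((∏ i ∈ s, E i) * ∏ x ∈ (Finset.univ \ s).erase i, (1 - E x)) * this
  have horth : ∀ s t, s ≠ t → F s * F t = 0 := by
    intro s t hst
    obtain ⟨i, hi⟩ : ∃ i, ¬ (i ∈ s ↔ i ∈ t) := by
      by_contra h
      push Not at h
      exact hst (Finset.ext h)
    by_cases his : i ∈ s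
    · have hit : i ∉ t := fun h => hi ⟨fun _ => h, fun _ => his⟩
      rw [← hin i s his, mul_comm (E i), mul_assoc, hout i t hit, mul_zero]
    · have hit : i ∈ t := by
        by_contra h
        exact hi ⟨fun h' => absurd h' his, fun h' => absurd h' h⟩
      rw [← hin i t hit, ← mul_assoc, mul_comm (F s), hout i s his, zero_mul]
  have hFF : ∀ s, F s * F s = F s := by
    intro s
    have : F s * ∑ t, F t = F s := by rw [hF1, mul_one]
    rwa [Finset.mul_sum, Finset.sum_eq_single s (fun t _ ht => horth s t ht.symm) (by simp)] at this
  have hscal : ∀ y ∈ Submodule.span k (Set.range fun i => φ (E i)), ∀ s, ∃ c : k, y * φ (F s) = c • φ (F s) := by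
    intro y hy s
    induction hy using Submodule.span_induction with
    | mem y hy =>
      obtain ⟨i, rfl⟩ := hy
      by_cases hi : i ∈ s
      · exact ⟨1, by simp only; rw [← map_mul, hin i s hi, one_smul]⟩
      · exact ⟨0, by simp only; rw [← map_mul, hout i s hi, zero_smul, map_zero]⟩
    | zero => exact ⟨0, by simp⟩
    | add y z _ _ h1 h2 =>
      obtain ⟨a, ha⟩ := h1
      obtain ⟨b, hb⟩ := h2
      exact ⟨a + b, by rw [add_mul, ha, hb, add_smul]⟩
    | smul a y _ h =>
      obtain ⟨b, hb⟩ := h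
      exact ⟨a * b, by rw [smul_mul_assoc, hb, mul_smul]⟩
  have h01 : ∀ s, x * φ (F s) = 0 ∨ x * φ (F s) = φ (F s) := by
    intro s
    obtain ⟨c, hc⟩ := hscal x hx s
    have h1 : x * (x * φ (F s)) = c • c • φ (F s) := by rw [hc, mul_smul_comm, hc]
    rw [← mul_assoc, hxx, hc, smul_smul] at h1
    by_cases hz : φ (F s) = 0
    · left; rw [hz, mul_zero]
    · have h2 : (c - c * c) • φ (F s) = 0 := by rw [sub_smul, h1, sub_self]
      have h3 := (smul_eq_zero.1 h2).resolve_right hz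
      have h4 : c * (1 - c) = 0 := by linear_combination h3
      rcases mul_eq_zero.1 h4 with h | h
      · left; rw [hc, h, zero_smul]
      · right; rw [hc, ← sub_eq_zero.1 h, one_smul]
  let T : Finset (Finset ι) := Finset.univ.filter fun s => x * φ (F s) = φ (F s)
  refine ⟨∑ s ∈ T, F s, ?_, ?_⟩
  · unfold IsIdempotentElem
    rw [Finset.sum_mul]
    refine Finset.sum_congr rfl fun s hs => ?_
    rw [Finset.mul_sum, Finset.sum_eq_single s (fun t _ ht => horth s t ht.symm) (by simp [hs]), hFF]
  · have : x = ∑ s, x * φ (F s) := by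
      rw [← Finset.mul_sum, ← map_sum, hF1, map_one, mul_one]
    rw [this, map_sum, Finset.sum_filter]
    refine Finset.sum_congr rfl fun s _ => ?_
    split_ifs with h
    · exact h.symm
    · exact ((h01 s).resolve_right h).symm

section
variable {G : Type*} [CommGroup G] [Fintype G]

lemma exists_pow_of_zpowers_eq {n q : ℕ} (hn : Monoid.exponent G = n) (hcop : q.Coprime n)
    (hq : n.totient = orderOf (q : ZMod n)) (g h : G) (hgh : Subgroup.zpowers g = Subgroup.zpowers h) :
    ∃ i : ℕ, h = g ^ (q ^ i) := by
  have hn0 : NeZero n := ⟨by rw [← hn]; exact Monoid.exponent_ne_zero_of_finite⟩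
  have hm : h ∈ Subgroup.zpowers g := hgh ▸ Subgroup.mem_zpowers h
  rw [← mem_powers_iff_mem_zpowers] at hm
  obtain ⟨a, rfl⟩ := hm
  have hord : orderOf (g ^ a) = orderOf g := by
    rw [← Nat.card_zpowers, ← Nat.card_zpowers, ← hgh]
  have hpos := orderOf_pos g
  have hac : a.Coprime (orderOf g) := by
    rw [orderOf_pow] at hord
    have hg := Nat.gcd_dvd_left (orderOf g) a
    obtain ⟨c, hc⟩ := hg
    have hgp : 0 < (orderOf g).gcd a := Nat.gcd_pos_of_pos_left _ hpos
    rw [Nat.coprime_comm]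
    unfold Nat.Coprime
    have h1 : orderOf g = orderOf g * (orderOf g).gcd a := by
      conv_lhs => rw [← Nat.div_mul_cancel (Nat.gcd_dvd_left (orderOf g) a), hord]
    nlinarith
  have hdvd : orderOf g ∣ n := hn ▸ Monoid.order_dvd_exponent g
  obtain ⟨b, hb⟩ := ZMod.unitsMap_surjective hdvd (ZMod.unitOfCoprime a hac)
  have hgen : b ∈ Subgroup.zpowers (ZMod.unitOfCoprime q hcop) := by
    have : Subgroup.zpowers (ZMod.unitOfCoprime q hcop) = ⊤ := by
      apply Subgroup.eq_top_of_card_eq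
      rw [Nat.card_zpowers, ← orderOf_units, ZMod.coe_unitOfCoprime, ← hq, Nat.card_eq_fintype_card, ZMod.card_units_eq_totient]
    rw [this]; trivial
  rw [← mem_powers_iff_mem_zpowers] at hgen
  obtain ⟨i, hi⟩ := hgen
  refine ⟨i, ?_⟩
  rw [pow_eq_pow_iff_modEq, ← ZMod.natCast_eq_natCast_iff]
  have := congrArg Units.val hb
  rw [← hi] at this
  simp [ZMod.unitsMap_def] at this
  simp [← this]

/-- Sum of the elements of the cyclic group generated by `g`. -/
noncomputable def cycSum (A : Type*) [CommRing A] (g : G) : MonoidAlgebra A G :=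
  open Classical in ∑ h ∈ Finset.univ.filter (fun h => h ∈ Subgroup.zpowers g), MonoidAlgebra.single h 1

lemma cycSum_mul_self (A : Type*) [CommRing A] (g : G) :
    cycSum A g * cycSum A g = (orderOf g : A) • cycSum A g := by
  classical
  have h1 : ∀ h ∈ Subgroup.zpowers g, MonoidAlgebra.single h (1 : A) * cycSum A g = cycSum A g := by
    intro h hh
    unfold cycSum
    rw [Finset.mul_sum]
    refine Finset.sum_bij (fun a _ => h * a) ?_ ?_ ?_ ?_
    · intro a ha
      simp only [Finset.mem_filter, Finset.mem_univ, true_and] at ha ⊢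
      exact mul_mem hh ha
    · intro a _ b _ hab
      exact mul_left_cancel hab
    · intro b hb
      simp only [Finset.mem_filter, Finset.mem_univ, true_and] at hb
      refine ⟨h⁻¹ * b, ?_, by simp⟩
      simp only [Finset.mem_filter, Finset.mem_univ, true_and]
      exact mul_mem (inv_mem hh) hb
    · intro a _
      simp [MonoidAlgebra.single_mul_single]
  conv_lhs => enter [1]; unfold cycSum
  rw [Finset.sum_mul, Finset.sum_congr rfl (fun h hh => h1 h (by simpa using hh)), Finset.sum_const,
    ← Nat.cast_smul_eq_nsmul A]
  congr 2
  rw [← Nat.card_zpowers, Nat.card_eq_fintype_card, Fintype.card_subtype]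

lemma sum_class_mem {k : Type*} [Field k] (W : Submodule k (MonoidAlgebra k G)) (T : Finset G) [DecidableEq (Subgroup G)]
    (hT : ∀ g h, Subgroup.zpowers g = Subgroup.zpowers h → g ∈ T → h ∈ T)
    (c : G → k) (hc : ∀ g h, Subgroup.zpowers g = Subgroup.zpowers h → c g = c h)
    (hW : ∀ g ∈ T, ∑ h ∈ Finset.univ.filter (fun h => Subgroup.zpowers h = Subgroup.zpowers g), MonoidAlgebra.single h (1 : k) ∈ W) :
    ∑ h ∈ T, MonoidAlgebra.single h (c h) ∈ W := by
  rw [← Finset.sum_fiberwise_of_maps_to (t := T.image Subgroup.zpowers) (g := Subgroup.zpowers) (fun i hi => Finset.mem_image_of_mem _ hi)]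
  refine Submodule.sum_mem _ fun C hC => ?_
  obtain ⟨g, hg, rfl⟩ := Finset.mem_image.1 hC
  have : ∑ h ∈ T with Subgroup.zpowers h = Subgroup.zpowers g, MonoidAlgebra.single h (c h) =
      c g • ∑ h ∈ Finset.univ.filter (fun h => Subgroup.zpowers h = Subgroup.zpowers g), MonoidAlgebra.single h (1 : k) := by
    rw [Finset.smul_sum]
    refine Finset.sum_congr ?_ ?_
    · ext h
      simp only [Finset.mem_filter, Finset.mem_univ, true_and, and_iff_right_iff_imp]
      exact fun h' => hT g h h'.symm hg
    · intro h hh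
      simp only [Finset.mem_filter, Finset.mem_univ, true_and] at hh
      rw [MonoidAlgebra.smul_single', mul_one, hc h g hh]
  rw [this]
  exact W.smul_mem _ (hW g hg)

lemma class_mem {k : Type*} [Field k] [DecidableEq (Subgroup G)] (g : G) :
    ∑ h ∈ Finset.univ.filter (fun h => Subgroup.zpowers h = Subgroup.zpowers g), MonoidAlgebra.single h (1 : k)
      ∈ Submodule.span k (Set.range (cycSum (G := G) k)) := by
  classical
  induction hm : orderOf g using Nat.strong_induction_on generalizing g with
  | _ m ih =>
  subst hm
  have hsplit := Finset.sum_filter_add_sum_filter_not (Finset.univ.filter (fun h => h ∈ Subgroup.zpowers g))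
    (fun h => Subgroup.zpowers h = Subgroup.zpowers g) (fun h => MonoidAlgebra.single h (1 : k))
  have hN : ∑ h ∈ Finset.univ.filter (fun h => h ∈ Subgroup.zpowers g), MonoidAlgebra.single h (1 : k) = cycSum k g := by
    unfold cycSum
    congr!
  rw [hN] at hsplit
  have hfil : (Finset.univ.filter (fun h => h ∈ Subgroup.zpowers g)).filter (fun h => Subgroup.zpowers h = Subgroup.zpowers g) = Finset.univ.filter (fun h => Subgroup.zpowers h = Subgroup.zpowers g) := by
    ext h
    simp only [Finset.mem_filter, Finset.mem_univ, true_and, and_iff_right_iff_imp]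
    intro h'
    rw [← h']; exact Subgroup.mem_zpowers h
  rw [hfil] at hsplit
  rw [← eq_sub_iff_add_eq] at hsplit
  rw [hsplit]
  refine Submodule.sub_mem _ (Submodule.subset_span ⟨g, rfl⟩) ?_
  refine sum_class_mem _ _ ?_ (fun _ => 1) (fun _ _ _ => rfl) ?_
  · intro a b hab ha
    simp only [Finset.mem_filter, Finset.mem_univ, true_and] at ha ⊢
    refine ⟨?_, hab ▸ ha.2⟩
    have : b ∈ Subgroup.zpowers a := hab ▸ Subgroup.mem_zpowers b
    exact (Subgroup.zpowers_le.2 ha.1) this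
  · intro a ha
    simp only [Finset.mem_filter, Finset.mem_univ, true_and] at ha
    refine ih (orderOf a) ?_ a rfl
    have hle : Subgroup.zpowers a ≤ Subgroup.zpowers g := Subgroup.zpowers_le.2 ha.1
    rw [← Nat.card_zpowers, ← Nat.card_zpowers]
    by_contra hlt
    push Not at hlt
    exact ha.2 (Subgroup.eq_of_le_of_card_ge hle hlt)

lemma sum_single_univ {A : Type*} [CommRing A] (x : MonoidAlgebra A G) :
    ∑ g, MonoidAlgebra.single g (x.coeff g) = x := by
  classical
  ext h
  rw [MonoidAlgebra.coeff_sum, Finsupp.finsetSum_apply]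
  simp [Finsupp.single_apply]

lemma isUnit_of_map {A : Type*} [CommRing A] [IsLocalRing A] (r : MonoidAlgebra A G)
    (hr : IsUnit (MonoidAlgebra.mapRingHom G (IsLocalRing.residue A) r)) : IsUnit r := by
  set φ := MonoidAlgebra.mapRingHom G (IsLocalRing.residue A) with hφ
  have hker : ∀ t, φ t = 0 → t ∈ IsLocalRing.maximalIdeal A • (⊤ : Submodule A (MonoidAlgebra A G)) := by
    intro t ht
    rw [← sum_single_univ t]
    refine Submodule.sum_mem _ fun g _ => ?_
    have hg : t.coeff g ∈ IsLocalRing.maximalIdeal A := by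
      rw [← IsLocalRing.residue_eq_zero_iff]
      have := congrArg (fun y => y.coeff g) ht
      simpa [hφ] using this
    have : MonoidAlgebra.single g (t.coeff g) = t.coeff g • MonoidAlgebra.single g (1 : A) := by
      rw [MonoidAlgebra.smul_single', mul_one]
    rw [this]
    exact Submodule.smul_mem_smul hg trivial
  have hsurj : Function.Surjective φ := by
    intro y
    rw [← sum_single_univ y]
    choose a ha using fun g => IsLocalRing.residue_surjective (y.coeff g)
    refine ⟨∑ g, MonoidAlgebra.single g (a g), ?_⟩
    rw [map_sum]
    simp [hφ, ha]
  have hfin : Module.Finite A (MonoidAlgebra A G) := by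
    refine ⟨⟨Finset.univ.map ⟨fun g => MonoidAlgebra.single g 1, ?_⟩, ?_⟩⟩
    · exact MonoidAlgebra.of_injective
    · rw [eq_top_iff]
      intro x _
      rw [← sum_single_univ x]
      refine Submodule.sum_mem _ fun g _ => ?_
      have : MonoidAlgebra.single g (x.coeff g) = x.coeff g • MonoidAlgebra.single g (1 : A) := by
        rw [MonoidAlgebra.smul_single', mul_one]
      rw [this]
      exact Submodule.smul_mem _ _ (Submodule.subset_span (Finset.mem_coe.2 (Finset.mem_map.2 ⟨g, Finset.mem_univ _, rfl⟩)))
  obtain ⟨u, hu⟩ := hr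
  obtain ⟨s, hs⟩ := hsurj (↑u⁻¹)
  have htop : (⊤ : Submodule A (MonoidAlgebra A G)) ≤ LinearMap.range (LinearMap.mulLeft A r) := by
    refine Submodule.le_of_le_smul_of_le_jacobson_bot (I := IsLocalRing.maximalIdeal A) hfin.1 ?_ ?_
    · rw [IsLocalRing.jacobson_eq_maximalIdeal _ bot_ne_top]
    · intro x _
      have : x = r * (s * x) + (x - r * (s * x)) := by ring
      rw [this]
      refine Submodule.add_mem_sup ⟨s * x, rfl⟩ (hker _ ?_)
      rw [map_sub, map_mul, map_mul, hs, ← hu, Units.mul_inv_cancel_left, sub_self]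
  obtain ⟨y, hy⟩ := htop (x := 1) trivial
  exact IsUnit.of_mul_eq_one y hy

lemma clean_of_order {A : Type*} [CommRing A] [IsLocalRing A] [Fintype (IsLocalRing.ResidueField A)]
    {p f n : ℕ} [hp : Fact p.Prime] (hcard : Fintype.card (IsLocalRing.ResidueField A) = p ^ f)
    (hn : Monoid.exponent G = n) (hcop : p.Coprime n)
    (hq : n.totient = orderOf ((p ^ f : ℕ) : ZMod n)) : IsCleanRing (MonoidAlgebra A G) := by
  classical
  set φ := MonoidAlgebra.mapRingHom G (IsLocalRing.residue A) with hφ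
  have hn0 : NeZero n := ⟨by rw [← hn]; exact Monoid.exponent_ne_zero_of_finite⟩
  have hf : f ≠ 0 := by
    rintro rfl
    have := Fintype.one_lt_card (α := (IsLocalRing.ResidueField A))
    rw [hcard] at this
    simp at this
  have hchk : CharP (IsLocalRing.ResidueField A) p := by
    have : (p : (IsLocalRing.ResidueField A)) = 0 := by
      have h1 : ((Fintype.card (IsLocalRing.ResidueField A) : ℕ) : (IsLocalRing.ResidueField A)) = 0 := Nat.cast_card_eq_zero (IsLocalRing.ResidueField A)
      rw [hcard, Nat.cast_pow] at h1
      exact (pow_eq_zero_iff hf).1 h1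
    obtain ⟨r, hr⟩ := CharP.exists (IsLocalRing.ResidueField A)
    have hrp := (CharP.cast_eq_zero_iff (IsLocalRing.ResidueField A) r p).1 this
    rcases (Nat.dvd_prime hp.1).1 hrp with h | h
    · subst h
      exact absurd (CharP.ringChar_ne_one (R := (IsLocalRing.ResidueField A))) (by rw [ringChar.eq (IsLocalRing.ResidueField A) 1]; simp)
    · exact h ▸ hr
  have hchS : CharP (MonoidAlgebra (IsLocalRing.ResidueField A) G) p :=
    charP_of_injective_algebraMap (algebraMap (IsLocalRing.ResidueField A) (MonoidAlgebra (IsLocalRing.ResidueField A) G)).injective p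
  have hcopq : (p ^ f).Coprime n := hcop.pow_left f
  -- Frobenius
  have hfrob : ∀ (x : MonoidAlgebra (IsLocalRing.ResidueField A) G) (j : ℕ), x ^ ((p ^ f) ^ j) = ∑ g, MonoidAlgebra.single (g ^ ((p ^ f) ^ j)) (x.coeff g) := by
    intro x j
    conv_lhs => rw [← sum_single_univ x]
    rw [← pow_mul, sum_pow_char_pow]
    refine Finset.sum_congr rfl fun g _ => ?_
    rw [MonoidAlgebra.single_pow, pow_mul, ← hcard, FiniteField.pow_card_pow]
  -- the lifting of idempotents
  have hlift : ∀ x : MonoidAlgebra (IsLocalRing.ResidueField A) G, x * x = x → ∃ e, IsIdempotentElem e ∧ φ e = x := by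
    intro x hx
    have hxp : ∀ j, x ^ ((p ^ f) ^ j) = x := fun j =>
      IsIdempotentElem.pow_eq (show IsIdempotentElem x from hx) (by
        have := hp.1.pos; positivity)
    have hcoef : ∀ g i, x.coeff (g ^ ((p ^ f) ^ i)) = x.coeff g := by
      intro g i
      have h1 := hfrob x i
      rw [hxp] at h1
      have hinj : Function.Injective fun h : G => h ^ ((p ^ f) ^ i) := by
        have hc : ∀ h : G, (h ^ ((p ^ f) ^ i)) ^ (((p ^ f) ^ i) ^ (n.totient - 1)) = h := by
          intro h
          have h1 : ((p ^ f) ^ i) ^ n.totient ≡ 1 [MOD n] := Nat.ModEq.pow_totient (hcopq.pow_left i)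
          have h2 := h1.of_dvd (hn ▸ Monoid.order_dvd_exponent h)
          have hpos : 0 < n.totient := Nat.totient_pos.2 (Nat.pos_of_ne_zero hn0.1)
          rw [← pow_mul, ← pow_succ', Nat.sub_add_cancel hpos]
          conv_rhs => rw [← pow_one h]
          exact pow_eq_pow_iff_modEq.2 h2
        intro a b hab
        have hab' : a ^ ((p ^ f) ^ i) = b ^ ((p ^ f) ^ i) := hab
        rw [← hc a, hab', hc b]
      conv_lhs => rw [h1]
      rw [MonoidAlgebra.coeff_sum, Finsupp.finsetSum_apply, Finset.sum_eq_single g]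
      · simp
      · intro h _ hh
        rw [MonoidAlgebra.coeff_single, Finsupp.single_eq_of_ne]
        exact fun h' => hh (hinj h').symm
      · simp
    have hcls : ∀ g h, Subgroup.zpowers g = Subgroup.zpowers h → x.coeff g = x.coeff h := by
      intro g h hgh
      obtain ⟨i, rfl⟩ := exists_pow_of_zpowers_eq hn hcopq hq g h hgh
      rw [hcoef]
    have hunit : ∀ g : G, IsUnit (orderOf g : A) := by
      intro g
      by_contra hnu
      have h1 : (orderOf g : A) ∈ IsLocalRing.maximalIdeal A := hnu
      rw [← IsLocalRing.residue_eq_zero_iff, map_natCast, CharP.cast_eq_zero_iff (IsLocalRing.ResidueField A) p] at h1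
      have h2 := h1.trans (Monoid.order_dvd_exponent g)
      rw [hn] at h2
      exact (Nat.Prime.coprime_iff_not_dvd hp.1).1 hcop h2
    choose c hc using fun g => (hunit g).exists_right_inv
    refine lift_idem (k := (IsLocalRing.ResidueField A)) φ (fun g => c g • cycSum A g) ?_ x ?_ hx
    · intro g
      rw [smul_mul_smul_comm, cycSum_mul_self, smul_smul]
      congr 1
      linear_combination c g * hc g
    · have hx' : x ∈ Submodule.span (IsLocalRing.ResidueField A) (Set.range (cycSum (G := G) (IsLocalRing.ResidueField A))) := by
        rw [← sum_single_univ x]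
        exact sum_class_mem _ _ (fun _ _ _ _ => Finset.mem_univ _) _ hcls (fun g _ => class_mem g)
      refine (Submodule.span_le.2 ?_) hx'
      rintro _ ⟨g, rfl⟩
      have hmap : φ (c g • cycSum A g) = IsLocalRing.residue A (c g) • cycSum (IsLocalRing.ResidueField A) g := by
        unfold cycSum
        rw [Finset.smul_sum, Finset.smul_sum, map_sum]
        refine Finset.sum_congr rfl fun h _ => ?_
        simp [hφ, MonoidAlgebra.smul_single']
      have : cycSum (IsLocalRing.ResidueField A) g = (orderOf g : (IsLocalRing.ResidueField A)) • φ (c g • cycSum A g) := by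
        rw [hmap, smul_smul]
        have := congrArg (IsLocalRing.residue A) (hc g)
        rw [map_mul, map_natCast, map_one] at this
        rw [this, one_smul]
      rw [this]
      exact Submodule.smul_mem _ _ (Submodule.subset_span ⟨g, rfl⟩)
  intro r
  let x := φ r
  let j := 2 * n.totient
  have hj : 0 < n.totient := Nat.totient_pos.2 (Nat.pos_of_ne_zero hn0.1)
  have hxQ : x ^ ((p ^ f) ^ j) = x := by
    rw [hfrob]
    conv_rhs => rw [← sum_single_univ x]
    refine Finset.sum_congr rfl fun g _ => ?_
    congr 1
    have h1 : (p ^ f) ^ j ≡ 1 [MOD n] := by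
      have := (Nat.ModEq.pow_totient hcopq).pow 2
      rw [← pow_mul, one_pow, mul_comm] at this
      exact this
    have h2 := h1.of_dvd (hn ▸ Monoid.order_dvd_exponent g)
    conv_rhs => rw [← pow_one g]
    exact pow_eq_pow_iff_modEq.2 h2
  obtain ⟨N, hN⟩ : ∃ N, (p ^ f) ^ j = N + 3 := by
    refine ⟨(p ^ f) ^ j - 3, ?_⟩
    have h1 : 2 ≤ p ^ f := hp.1.two_le.trans (Nat.le_self_pow hf p)
    have h2 : (p ^ f) ^ 2 ≤ (p ^ f) ^ j := Nat.pow_le_pow_right (by omega) (by simp only [j]; omega)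
    have : 4 ≤ (p ^ f) ^ 2 := by nlinarith
    omega
  rw [hN] at hxQ
  have hidem : x ^ (N + 2) * x ^ (N + 2) = x ^ (N + 2) := by
    calc x ^ (N + 2) * x ^ (N + 2) = x ^ (N + 3) * x ^ (N + 1) := by ring
      _ = x ^ (N + 2) := by rw [hxQ]; ring
  obtain ⟨F, hF, hFx⟩ := hlift _ hidem
  refine ⟨r - (1 - F), 1 - F, ?_, hF.one_sub, by ring⟩
  apply isUnit_of_map
  rw [← hφ, map_sub, map_sub, map_one, hFx]
  change IsUnit (x - (1 - x ^ (N + 2)))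
  refine IsUnit.of_mul_eq_one (x ^ (N + 1) - (1 - x ^ (N + 2))) ?_
  have e1 : x ^ (N + 2) * x ^ (N + 1) = x ^ (N + 1) := by
    calc x ^ (N + 2) * x ^ (N + 1) = x ^ (N + 3) * x ^ N := by ring
      _ = x ^ (N + 1) := by rw [hxQ]; ring
  linear_combination hidem + e1 + hxQ
end


lemma clean_of_surjective {R S : Type*} [Ring R] [Ring S] (f : R →+* S)
    (hf : Function.Surjective f) (h : IsCleanRing R) : IsCleanRing S := by
  intro s
  obtain ⟨r, rfl⟩ := hf s
  obtain ⟨u, e, hu, he, rfl⟩ := h r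
  exact ⟨f u, f e, hu.map f, he.map f, map_add f u e⟩

lemma exists_char_eq {B : Type*} [CommRing B] [IsDomain B] {G : Type*} [CommGroup G] [Fintype G]
    {n : ℕ} (hn : Monoid.exponent G = n) [NeZero n] (ζ : B) (hζ : IsPrimitiveRoot ζ n) :
    ∃ (χ : G →* Bˣ) (g₀ : G), ((χ g₀ : Bˣ) : B) = ζ := by
  have hE : HasEnoughRootsOfUnity B n := ⟨⟨ζ, hζ⟩, rootsOfUnity.isCyclic B n⟩
  have hE' : HasEnoughRootsOfUnity B (Monoid.exponent G) := hn ▸ hE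
  obtain ⟨eqv⟩ := CommGroup.monoidHom_mulEquiv_of_hasEnoughRootsOfUnity G B
  obtain ⟨g, hg⟩ := Monoid.exists_orderOf_eq_exponent (G := G) (Monoid.ExponentExists.of_finite)
  let χ : G →* Bˣ := eqv.symm g
  have hχ : orderOf χ = n := by
    rw [← hn, ← hg]; exact MulEquiv.orderOf_eq eqv.symm g
  have hle : χ.range ≤ rootsOfUnity n B := by
    rintro _ ⟨a, rfl⟩
    rw [mem_rootsOfUnity, ← map_pow, ← hn, Monoid.pow_exponent_eq_one, map_one]
  have hfinr : Finite χ.range := Finite.of_surjective _ χ.rangeRestrict_surjective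
  have hcard : n ≤ Nat.card χ.range := by
    refine Nat.le_of_dvd Nat.card_pos ?_
    rw [← hχ]
    refine orderOf_dvd_of_pow_eq_one ?_
    ext a : 1
    have := pow_card_eq_one' (x := (⟨χ a, a, rfl⟩ : χ.range))
    simpa using congrArg Subtype.val this
  have heq : χ.range = rootsOfUnity n B := by
    refine Subgroup.eq_of_le_of_card_ge hle ?_
    rw [hζ.card_rootsOfUnity]
    exact hcard
  have hu : hζ.toRootsOfUnity.1 ∈ χ.range := by rw [heq]; exact hζ.toRootsOfUnity.2
  obtain ⟨a, ha⟩ := hu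
  exact ⟨χ, a, by rw [ha]; simp⟩

lemma clean_quotient_of_clean {A : Type*} [CommRing A] {G : Type*} [CommGroup G] [Fintype G]
    {n : ℕ} (hn : Monoid.exponent G = n) (hnA : IsUnit (n : A))
    [hdom : IsDomain (A[X] ⧸ Ideal.span {cyclotomic n A})]
    (h : IsCleanRing (MonoidAlgebra A G)) : IsCleanRing (A[X] ⧸ Ideal.span {cyclotomic n A}) := by
  have hn0 : NeZero n := ⟨by rw [← hn]; exact Monoid.exponent_ne_zero_of_finite⟩
  let B := A[X] ⧸ Ideal.span {cyclotomic n A}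
  let π : A[X] →ₐ[A] B := Ideal.Quotient.mkₐ A (Ideal.span {cyclotomic n A})
  let ζ : B := π X
  have hnB : NeZero ((n : ℕ) : B) := by
    refine ⟨?_⟩
    have := hnA.map (algebraMap A B)
    rw [map_natCast] at this
    exact this.ne_zero
  have hζ : IsPrimitiveRoot ζ n := by
    rw [← isRoot_cyclotomic_iff]
    rw [IsRoot.def, ← map_cyclotomic n (algebraMap A B), eval_map_algebraMap]
    have : aeval ζ (cyclotomic n A) = π (cyclotomic n A) := by
      change aeval (π X) (cyclotomic n A) = π (cyclotomic n A)
      rw [aeval_algHom_apply, aeval_X_left_apply]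
    rw [this]
    exact Ideal.Quotient.eq_zero_iff_mem.2 (Ideal.mem_span_singleton_self _)
  obtain ⟨χ, g₀, hg₀⟩ := exists_char_eq (G := G) hn ζ hζ
  let F : MonoidAlgebra A G →ₐ[A] B := MonoidAlgebra.lift A B G ((Units.coeHom B).comp χ)
  refine clean_of_surjective F.toRingHom ?_ h
  intro b
  obtain ⟨P, rfl⟩ := Ideal.Quotient.mk_surjective b
  refine ⟨aeval (MonoidAlgebra.of A G g₀) P, ?_⟩
  change F (aeval (MonoidAlgebra.of A G g₀) P) = π P
  rw [← aeval_algHom_apply]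
  have : F (MonoidAlgebra.of A G g₀) = π X := by
    simp only [F, MonoidAlgebra.lift_of]
    exact hg₀
  rw [this, aeval_algHom_apply, aeval_X_left_apply]

lemma order_of_clean {A : Type*} [CommRing A] [IsLocalRing A] [Fintype (IsLocalRing.ResidueField A)]
    {p f n : ℕ} [hp : Fact p.Prime] (hcard : Fintype.card (IsLocalRing.ResidueField A) = p ^ f)
    (hn : 0 < n) (hcop : p.Coprime n) [hdom : IsDomain (A[X] ⧸ Ideal.span {cyclotomic n A})]
    (hnA : IsUnit (n : A))
    (h : IsCleanRing (A[X] ⧸ Ideal.span {cyclotomic n A})) :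
    n.totient = orderOf ((p ^ f : ℕ) : ZMod n) := by
  have hloc : IsLocalRing (A[X] ⧸ Ideal.span {cyclotomic n A}) := by
    refine IsLocalRing.of_isUnit_or_isUnit_one_sub_self fun a => ?_
    obtain ⟨u, e, hu, he, hr⟩ := h a
    rcases IsIdempotentElem.iff_eq_zero_or_one.1 he with rfl | rfl
    · left; rw [hr, add_zero]; exact hu
    · right
      have h1 : (1 : A[X] ⧸ Ideal.span {cyclotomic n A}) - a = -u := by rw [hr]; ring
      rw [h1]; exact hu.neg
  let k := IsLocalRing.ResidueField A
  let Φ : k[X] := cyclotomic n k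
  have hnk : NeZero ((n : ℕ) : k) := by
    refine ⟨?_⟩
    have := hnA.map (IsLocalRing.residue A)
    rw [map_natCast] at this
    exact this.ne_zero
  have hdegpos : 0 < Φ.natDegree := by
    rw [natDegree_cyclotomic]; exact Nat.totient_pos.2 hn
  have hnt : Nontrivial (k[X] ⧸ Ideal.span {Φ}) := by
    refine Ideal.Quotient.nontrivial_iff.2 ?_
    rw [Ne, Ideal.span_singleton_eq_top]
    intro hu
    have := natDegree_eq_zero_of_isUnit hu
    omega
  have hlock : IsLocalRing (k[X] ⧸ Ideal.span {Φ}) := by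
    let ψ : A[X] →+* k[X] := mapRingHom (IsLocalRing.residue A)
    have hψ : Ideal.span {cyclotomic n A} ≤ (Ideal.span {Φ}).comap ψ := by
      rw [Ideal.span_singleton_le_iff_mem, Ideal.mem_comap]
      have : ψ (cyclotomic n A) = Φ := by simp [ψ, Φ]
      rw [this]
      exact Ideal.mem_span_singleton_self _
    refine IsLocalRing.of_surjective' (Ideal.quotientMap (Ideal.span {Φ}) ψ hψ) ?_
    exact Ideal.quotientMap_surjective (map_surjective _ IsLocalRing.residue_surjective)
  obtain ⟨P, hPirr, Q, hPQ⟩ := exists_irreducible_of_natDegree_pos hdegpos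
  have hsep : Φ.Separable := separable_cyclotomic n k
  have hΦ0 : Φ ≠ 0 := cyclotomic_ne_zero n k
  have hcopPQ : IsCoprime P Q := by
    rw [hPQ] at hsep
    exact hsep.isCoprime
  obtain ⟨a, b, hab⟩ := hcopPQ
  have hΦP : Φ ∣ P := by
    have hsum : Ideal.Quotient.mk (Ideal.span {Φ}) (a * P) + Ideal.Quotient.mk (Ideal.span {Φ}) (b * Q) = 1 := by
      rw [← map_add, hab, map_one]
    have hPQ0 : Ideal.Quotient.mk (Ideal.span {Φ}) P * Ideal.Quotient.mk (Ideal.span {Φ}) Q = 0 := by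
      rw [← map_mul, ← hPQ]
      exact Ideal.Quotient.eq_zero_iff_mem.2 (Ideal.mem_span_singleton_self _)
    rcases IsLocalRing.isUnit_or_isUnit_of_add_one hsum with hu | hu
    · exfalso
      rw [map_mul] at hu
      have hu' := isUnit_of_mul_isUnit_right hu
      have hQ0 : Ideal.Quotient.mk (Ideal.span {Φ}) Q = 0 := by
        exact (hu'.mul_right_eq_zero).1 hPQ0
      rw [Ideal.Quotient.eq_zero_iff_mem, Ideal.mem_span_singleton] at hQ0
      have hQne : Q ≠ 0 := by rintro rfl; exact hΦ0 (by rw [hPQ, mul_zero])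
      obtain ⟨c, hc⟩ := hQ0
      rw [hPQ] at hc
      have : P * c = 1 := by
        apply mul_left_cancel₀ hQne
        linear_combination -hc
      exact hPirr.not_isUnit (IsUnit.of_mul_eq_one c this)
    · rw [map_mul] at hu
      have hu' := isUnit_of_mul_isUnit_right hu
      have := (hu'.mul_left_eq_zero).1 hPQ0
      rwa [Ideal.Quotient.eq_zero_iff_mem, Ideal.mem_span_singleton] at this
  have hdeg : P.natDegree = n.totient := by
    rw [← natDegree_cyclotomic n k]
    exact le_antisymm (natDegree_le_of_dvd ⟨Q, hPQ⟩ hΦ0) (natDegree_le_of_dvd hΦP hPirr.ne_zero)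
  have := natDegree_of_dvd_cyclotomic_of_irreducible hcard hcop (P := P) ⟨Q, hPQ⟩ hPirr
  rw [← hdeg, this, ← orderOf_units, ZMod.coe_unitOfCoprime]

lemma totient_orderOf_sq {p n : ℕ} (hpn : p.Coprime n) (hn1 : n ≠ 1) (hn0 : 0 < n) :
    n.totient = orderOf ((p ^ 2 : ℕ) : ZMod n) ↔ n = 2 := by
  constructor
  · intro h
    by_contra hn2
    have hn3 : 2 < n := by omega
    obtain ⟨m, hm⟩ := Nat.totient_even hn3
    have hpos : 0 < n.totient := Nat.totient_pos.2 hn0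
    have h1 : ((p ^ 2 : ℕ) : ZMod n) ^ m = 1 := by
      have := Nat.ModEq.pow_totient hpn
      rw [← ZMod.natCast_eq_natCast_iff] at this
      rw [hm, ← two_mul, pow_mul] at this
      push_cast at this ⊢
      exact this
    have := Nat.le_of_dvd (by omega) (orderOf_dvd_of_pow_eq_one h1)
    omega
  · rintro rfl
    have hodd : Odd p := (Nat.coprime_two_right).1 hpn
    have : ((p ^ 2 : ℕ) : ZMod 2) = 1 := by
      rw [ZMod.natCast_eq_one_iff_odd]
      exact hodd.pow
    rw [this, orderOf_one]
    simp

lemma prime_cyclotomic_localization {R K : Type*} [CommRing R] [IsDedekindDomain R]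
    [Field K] [Algebra R K] [IsFractionRing R K] (𝔭 : Ideal R) [𝔭.IsPrime] (h𝔭 : 𝔭 ≠ ⊥) (n : ℕ)
    (hirr : Irreducible (cyclotomic n K)) : Prime (cyclotomic n (Localization.AtPrime 𝔭)) := by
  have hdvr : IsDiscreteValuationRing (Localization.AtPrime 𝔭) :=
    IsLocalization.AtPrime.isDiscreteValuationRing_of_dedekind_domain R h𝔭 _
  rw [← UniqueFactorizationMonoid.irreducible_iff_prime]
  have hinj : Function.Injective (algebraMap R K) := IsFractionRing.injective R K
  let ψ : Localization.AtPrime 𝔭 →+* K := IsLocalization.lift (M := 𝔭.primeCompl) (g := algebraMap R K) (by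
    intro y
    refine IsUnit.mk0 _ ?_
    rw [Ne, map_eq_zero_iff _ hinj]
    intro hy
    exact y.2 (hy ▸ 𝔭.zero_mem))
  refine Monic.irreducible_of_irreducible_map ψ _ (cyclotomic.monic n _) ?_
  rw [map_cyclotomic]
  exact hirr

end CleanAux

/-- Let `d ≠ 0, 1` be a squarefree integer, `K = ℚ(√d)` with ring of integers `𝒪` and
discriminant `Δ`, let `𝔭` be a nonzero prime ideal of `𝒪` lying over an odd prime `p`,
and let `G` be a nontrivial finite abelian group with `p ∤ exp(G)` and `Δ ∤ exp(G)`.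
Then the following are equivalent: (i) `𝒪_𝔭[G]` is clean;
(ii) `𝒪_𝔭[x]/(Φ_{exp G}(x))` is clean; (iii) either `φ(exp G) = ord_{exp G}(p)` and the
Legendre symbol `(Δ/p)` is `1` or `0`, or `exp G = 2` and `(Δ/p) = -1`. -/
theorem clean_quadratic_localization_monoidAlgebra_iff
    (d : ℤ) (hd : Squarefree d) (hd0 : d ≠ 0) (hd1 : d ≠ 1)
    (K : Type*) [Field K] [NumberField K]
    (α : K) (hα : α ^ 2 = (d : K)) (hrank : Module.finrank ℚ K = 2)
    (Δ : ℤ) (hΔ : (d % 4 = 1 ∧ Δ = d) ∨ (d % 4 ≠ 1 ∧ Δ = 4 * d))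
    (p : ℕ) [Fact p.Prime] (hp2 : p ≠ 2)
    (𝔭 : Ideal (𝓞 K)) [𝔭.IsPrime] (h𝔭 : 𝔭 ≠ ⊥)
    (hcomap : Ideal.comap (algebraMap ℤ (𝓞 K)) 𝔭 = Ideal.span {(p : ℤ)})
    (G : Type*) [CommGroup G] [Fintype G] [Nontrivial G]
    (n : ℕ) (hn : Monoid.exponent G = n) (hpn : ¬ p ∣ n)
    (hΔn : ¬ Δ ∣ (n : ℤ)) :
    (IsCleanRing (MonoidAlgebra (Localization.AtPrime 𝔭) G) ↔
      IsCleanRing (Polynomial (Localization.AtPrime 𝔭) ⧸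
        Ideal.span {Polynomial.cyclotomic n (Localization.AtPrime 𝔭)})) ∧
    (IsCleanRing (MonoidAlgebra (Localization.AtPrime 𝔭) G) ↔
      ((Nat.totient n = orderOf ((p : ZMod n)) ∧
          (legendreSym p Δ = 1 ∨ legendreSym p Δ = 0)) ∨
        (n = 2 ∧ legendreSym p Δ = -1))) := by
  classical
  have hp : p.Prime := Fact.out
  have hnpos : 0 < n := hn ▸ Nat.pos_of_ne_zero Monoid.exponent_ne_zero_of_finite
  have hn1 : n ≠ 1 := by
    intro h
    rw [h, Monoid.exp_eq_one_iff] at hn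
    exact not_subsingleton G hn
  have hcop : p.Coprime n := (Nat.Prime.coprime_iff_not_dvd hp).2 hpn
  have hirr := irreducible_cyclotomic_quadratic d hd hd0 K α hα hrank Δ hΔ n hnpos hΔn
  have hprime := prime_cyclotomic_localization (K := K) 𝔭 h𝔭 n hirr
  have hdom : IsDomain (Polynomial (Localization.AtPrime 𝔭) ⧸
        Ideal.span {Polynomial.cyclotomic n (Localization.AtPrime 𝔭)}) := by
    rw [Ideal.Quotient.isDomain_iff_prime, Ideal.span_singleton_prime hprime.ne_zero]
    exact hprime
  have hmax : 𝔭.IsMaximal := Ideal.IsPrime.isMaximal inferInstance h𝔭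
  have hcardeq : Nat.card (IsLocalRing.ResidueField (Localization.AtPrime 𝔭)) = Nat.card (𝓞 K ⧸ 𝔭) :=
    (Nat.card_congr (IsLocalization.AtPrime.equivQuotMaximalIdeal 𝔭 (Localization.AtPrime 𝔭)).toEquiv).symm
  obtain ⟨hsq, hnsq⟩ := card_residue d hd hd1 K α hα hrank p hp2 𝔭 h𝔭 hcomap
  have hnA : IsUnit ((n : ℕ) : Localization.AtPrime 𝔭) := by
    have h1 : IsUnit (algebraMap (𝓞 K) (Localization.AtPrime 𝔭) (n : 𝓞 K)) := by
      refine IsLocalization.map_units (M := 𝔭.primeCompl) (Localization.AtPrime 𝔭) ⟨(n : 𝓞 K), ?_⟩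
      intro hmem
      have h2 : (n : ℤ) ∈ Ideal.comap (algebraMap ℤ (𝓞 K)) 𝔭 := by
        rw [Ideal.mem_comap, map_natCast]
        exact hmem
      rw [hcomap, Ideal.mem_span_singleton] at h2
      exact hpn (Int.natCast_dvd_natCast.1 h2)
    rwa [map_natCast] at h1
  have key : ∀ f, f ≠ 0 → Nat.card (𝓞 K ⧸ 𝔭) = p ^ f →
      (IsCleanRing (MonoidAlgebra (Localization.AtPrime 𝔭) G) ↔
        IsCleanRing (Polynomial (Localization.AtPrime 𝔭) ⧸
          Ideal.span {Polynomial.cyclotomic n (Localization.AtPrime 𝔭)})) ∧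
      (IsCleanRing (MonoidAlgebra (Localization.AtPrime 𝔭) G) ↔
        n.totient = orderOf ((p ^ f : ℕ) : ZMod n)) := by
    intro f hf hcard
    rw [← hcardeq] at hcard
    have hfin : Finite (IsLocalRing.ResidueField (Localization.AtPrime 𝔭)) :=
      Nat.finite_of_card_ne_zero (by rw [hcard]; exact (pow_pos hp.pos f).ne')
    have hft : Fintype (IsLocalRing.ResidueField (Localization.AtPrime 𝔭)) := Fintype.ofFinite _
    rw [Nat.card_eq_fintype_card] at hcard
    have h12 := clean_quotient_of_clean (A := Localization.AtPrime 𝔭) (G := G) hn hnA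
    have h23 := order_of_clean (A := Localization.AtPrime 𝔭) hcard hnpos hcop hnA
    have h31 := clean_of_order (A := Localization.AtPrime 𝔭) (G := G) hcard hn hcop
    exact ⟨⟨h12, fun h => h31 (h23 h)⟩, ⟨fun h => h23 (h12 h), h31⟩⟩
  have hleg : legendreSym p Δ = -1 ↔ ¬ IsSquare (d : ZMod p) := by
    have h2 : legendreSym p Δ = legendreSym p d := by
      rcases hΔ with ⟨_, h⟩ | ⟨_, h⟩
      · rw [h]
      · have h20 : ((2 : ℤ) : ZMod p) ≠ 0 := by
          intro h0
          have h0' : ((2 : ℕ) : ZMod p) = 0 := by exact_mod_cast h0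
          rw [ZMod.natCast_eq_zero_iff] at h0'
          exact hp2 ((Nat.prime_dvd_prime_iff_eq hp Nat.prime_two).1 h0')
        rw [h, legendreSym.mul, show (4 : ℤ) = 2 ^ 2 by norm_num, legendreSym.sq_one' p h20, one_mul]
    rw [h2, legendreSym.eq_neg_one_iff]
  by_cases hs : IsSquare (d : ZMod p)
  · obtain ⟨hA, hB⟩ := key 1 one_ne_zero (by rw [pow_one]; exact hsq hs)
    refine ⟨hA, hB.trans ?_⟩
    have hne : legendreSym p Δ ≠ -1 := fun h => (hleg.1 h) hs
    have hor : legendreSym p Δ = 1 ∨ legendreSym p Δ = 0 := by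
      by_cases h0 : (Δ : ZMod p) = 0
      · right; exact (legendreSym.eq_zero_iff p Δ).2 h0
      · left; exact (legendreSym.eq_one_or_neg_one p h0).resolve_right hne
    rw [pow_one]
    constructor
    · exact fun h => Or.inl ⟨h, hor⟩
    · rintro (⟨h, _⟩ | ⟨_, h⟩)
      · exact h
      · exact absurd h hne
  · obtain ⟨hA, hB⟩ := key 2 two_ne_zero (hnsq hs)
    refine ⟨hA, hB.trans ?_⟩
    have hm := hleg.2 hs
    rw [totient_orderOf_sq hcop hn1 hnpos, hm]
    constructor
    · exact fun h => Or.inr ⟨h, rfl⟩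
    · rintro (⟨_, h⟩ | ⟨h, _⟩)
      · rcases h with h | h <;> norm_num at h
      · exact h
end
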